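/- Let f : J̃ → ℝ be Hölder continuous with P(f) > sup f + log N, and suppose there exists μ_f ∈ M_T such that L(μ_f) = 0 and L(m) > 0 for every m ∈ M with m ≠ μ_f. Then for every weak*-open neighbourhood 𝒰 ⊆ M of μ_f and every x ∈ J̃ one has ρ(M∖𝒰) > 0 and limsup_{n→∞} (1/n) log [ (Σ_{y : T^n(y)=x, μ_{y,n}∉𝒰} e^{f^n(y)}) / (Σ_{y : T^n(y)=x} e^{f^n(y)}) ] ≤ −ρ(M∖𝒰) < 0; that is, the e^{f^n}-weighted proportion of n-th order preimages of x whose orbital measure lies outside 𝒰 decays to zero exponentially fast. -/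

import Mathlib

open MeasureTheory Filter Topology Polynomial
open scoped OnePoint Classical ENNReal

noncomputable section

namespace SkewRational

/-- The Riemann sphere, modelled as the one-point compactification of `ℂ`. -/
abbrev Sphere : Type := OnePoint ℂ

/-- The product space `X = Σ_N⁺ × ℂ̂`. -/
abbrev SymX (N : ℕ) : Type := (ℕ → Fin N) × Sphere

variable {N : ℕ}

/-- The left shift on `Σ_N⁺`. -/
def shiftW (w : ℕ → Fin N) : ℕ → Fin N := fun n => w (n + 1)

/-- Prepending a letter to an infinite word. -/
def consW (v : Fin N) (w : ℕ → Fin N) : ℕ → Fin N := fun n => if n = 0 then v else w (n - 1)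

/-- Evaluation of the rational map `P/Q` (in irreducible form) on the Riemann sphere. -/
def ratEval (P Q : ℂ[X]) : Sphere → Sphere := fun z =>
  OnePoint.elim z
    (if Q.natDegree < P.natDegree then (OnePoint.infty : Sphere)
     else if P.natDegree < Q.natDegree then ((0 : ℂ) : Sphere)
     else ((P.leadingCoeff / Q.leadingCoeff : ℂ) : Sphere))
    (fun a => if Q.eval a = 0 then (OnePoint.infty : Sphere) else ((P.eval a / Q.eval a : ℂ) : Sphere))

/-- The multiset of preimages (with multiplicity) of a point of the sphere under `P/Q`. -/
def fiber (P Q : ℂ[X]) (a : Sphere) : Multiset Sphere :=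
  OnePoint.elim a
    ((Q.roots.map fun z => (z : Sphere)) +
      Multiset.replicate (max P.natDegree Q.natDegree - Q.natDegree) (OnePoint.infty : Sphere))
    (fun b =>
      (((P - Polynomial.C b * Q).roots.map fun z => (z : Sphere)) +
        Multiset.replicate
          (max P.natDegree Q.natDegree - (P - Polynomial.C b * Q).natDegree) (OnePoint.infty : Sphere)))

variable (p q : Fin N → ℂ[X])

/-- The degree `d_i` of the rational map `R_i = p i / q i`. -/
def degR (i : Fin N) : ℕ := max (p i).natDegree (q i).natDegree

/-- `D = d₁ + ⋯ + d_N`. -/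
def Dtot : ℕ := ∑ i, degR p q i

/-- Standing assumptions: `N ≥ 1`, each `R_i = p i / q i` in irreducible form, all degrees
at least `1`, and at least one degree at least `2`. -/
def Good : Prop :=
  1 ≤ N ∧ (∀ i, IsCoprime (p i) (q i)) ∧ (∀ i, 1 ≤ degR p q i) ∧ (∃ i, 2 ≤ degR p q i)

/-- The skew-product map `T(w, z) = (σ w, R_{w 0} z)`. -/
def Tmap : SymX N → SymX N := fun x => (shiftW x.1, ratEval (p (x.1 0)) (q (x.1 0)) x.2)

/-- The multiset of preimages of a point under `T`, counted with multiplicity. -/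
def preimT (x : SymX N) : Multiset (SymX N) :=
  ∑ v : Fin N, (fiber (p v) (q v) x.2).map fun z => (consW v x.1, z)

/-- The multiset of `n`-th order preimages under `T^n`, counted with multiplicity. -/
def preimTn : ℕ → SymX N → Multiset (SymX N)
  | 0, x => {x}
  | n + 1, x => (preimT p q x).bind fun y => preimTn n y

/-- The chordal (spherical) metric on the Riemann sphere. -/
def sphDist : Sphere → Sphere → ℝ := fun z w =>
  OnePoint.elim z
    (OnePoint.elim w 0 fun b => 2 / Real.sqrt (1 + ‖b‖ ^ 2))
    (fun a =>
      OnePoint.elim w (2 / Real.sqrt (1 + ‖a‖ ^ 2))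
        (fun b => 2 * dist a b / (Real.sqrt (1 + ‖a‖ ^ 2) * Real.sqrt (1 + ‖b‖ ^ 2))))

/-- The metric `d(w, w') = 2^{-n(w,w')}` on `Σ_N⁺`. -/
def shiftDist (w w' : ℕ → Fin N) : ℝ :=
  if h : ∃ n, w n ≠ w' n then (2 : ℝ)⁻¹ ^ (Nat.find h + 1) else 0

/-- The metric on `X`: maximum of the two coordinate metrics. -/
def dX : SymX N → SymX N → ℝ := fun x y => max (shiftDist x.1 y.1) (sphDist x.2 y.2)

/-- Montel normality of a family of self-maps of the sphere on a set `U`. -/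
def NormalOn (F : Set (Sphere → Sphere)) (U : Set Sphere) : Prop :=
  ∀ s : ℕ → Sphere → Sphere, (∀ n, s n ∈ F) →
    ∃ φ : ℕ → ℕ, StrictMono φ ∧ ∃ g : Sphere → Sphere,
      ∀ K : Set Sphere, K ⊆ U → IsCompact K → ∀ ε : ℝ, 0 < ε →
        ∀ᶠ n in atTop, ∀ z ∈ K, sphDist (s (φ n) z) (g z) < ε

/-- The compositions `R_{w (n-1)} ∘ ⋯ ∘ R_{w 0}`. -/
def itComp (w : ℕ → Fin N) : ℕ → Sphere → Sphere
  | 0 => id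
  | n + 1 => ratEval (p (w n)) (q (w n)) ∘ itComp w n

/-- The fibrewise Fatou set `F_w`. -/
def fatouW (w : ℕ → Fin N) : Set Sphere :=
  {z | ∃ U : Set Sphere, IsOpen U ∧ z ∈ U ∧
    NormalOn {g | ∃ n, 1 ≤ n ∧ g = itComp p q w n} U}

/-- The fibrewise Julia set `J_w`. -/
def juliaW (w : ℕ → Fin N) : Set Sphere := (fatouW p q w)ᶜ

/-- The Julia set `J̃` of the skew-product map `T`. -/
def juliaSet : Set (SymX N) :=
  closure (⋃ w : ℕ → Fin N, {w} ×ˢ juliaW p q w)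

/-- The critical points of `T`: `(w, z)` with `z` a critical point of `R_{w 0}`. -/
def critSet : Set (SymX N) :=
  {x | 2 ≤ (fiber (p (x.1 0)) (q (x.1 0))
        (ratEval (p (x.1 0)) (q (x.1 0)) x.2)).count x.2}

/-- Assumption (A1): no super-attracting periodic point of `T` lies in the Julia set
(a periodic point is super-attracting exactly when its orbit meets the critical set,
i.e. the derivative of the return composition vanishes). -/
def NoSuperAttract : Prop :=
  ∀ x ∈ juliaSet p q, ∀ m : ℕ, 1 ≤ m → (Tmap p q)^[m] x = x →
    ∀ k < m, (Tmap p q)^[k] x ∉ critSet p q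

instance : MeasurableSpace (SymX N) := borel _
instance : BorelSpace (SymX N) := ⟨rfl⟩

instance : MeasurableSpace ↥(juliaSet p q) := borel _
instance : BorelSpace ↥(juliaSet p q) := ⟨rfl⟩

/-! ### Fixed points counted with multiplicity -/

/-- Formal composition of rational maps as pairs of polynomials: `compPair a b = a ∘ b`. -/
def compPair (a b : ℂ[X] × ℂ[X]) : ℂ[X] × ℂ[X] :=
  (∑ i ∈ Finset.range (max a.1.natDegree a.2.natDegree + 1),
      Polynomial.C (a.1.coeff i) * b.1 ^ i * b.2 ^ (max a.1.natDegree a.2.natDegree - i),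
   ∑ i ∈ Finset.range (max a.1.natDegree a.2.natDegree + 1),
      Polynomial.C (a.2.coeff i) * b.1 ^ i * b.2 ^ (max a.1.natDegree a.2.natDegree - i))

/-- For a word `[v₁, …, v_m]`, the composite `R_{v_m} ∘ ⋯ ∘ R_{v₁}` as a pair of
polynomials. -/
def wordPair : List (Fin N) → ℂ[X] × ℂ[X]
  | [] => (Polynomial.X, 1)
  | v :: t => compPair (wordPair t) (p v, q v)

/-- The multiset of fixed points (with multiplicity) on the sphere of the rational map given
by a pair of polynomials; a degree-`k` map has `k + 1` fixed points with multiplicity. -/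
def fixMul (a : ℂ[X] × ℂ[X]) : Multiset Sphere :=
  ((a.1 - Polynomial.X * a.2).roots.map fun z => (z : Sphere)) +
    Multiset.replicate
      (max a.1.natDegree a.2.natDegree + 1 - (a.1 - Polynomial.X * a.2).natDegree) (OnePoint.infty : Sphere)

/-- The periodic word `(v₁ ⋯ v_m v₁ ⋯ v_m ⋯)`. -/
def perW {m : ℕ} (hm : 0 < m) (v : Fin m → Fin N) : ℕ → Fin N :=
  fun n => v ⟨n % m, Nat.mod_lt n hm⟩

/-- The multiset `Fix_m(T)` of fixed points of `T^m`, counted with multiplicity. -/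
def fixMultiset (m : ℕ) : Multiset (SymX N) :=
  if hm : 0 < m then
    ∑ v : Fin m → Fin N, (fixMul (wordPair p q (List.ofFn v))).map fun z => (perW hm v, z)
  else 0

/-! ### Thermodynamic formalism -/

/-- The ergodic (Birkhoff) sum `f^n`. -/
def birk (f : SymX N → ℝ) (n : ℕ) (y : SymX N) : ℝ :=
  ∑ k ∈ Finset.range n, f ((Tmap p q)^[k] y)

/-- `(L_f^n 1)(x) = Σ_{T^n y = x} e^{f^n(y)}`. -/
def LSum (f : SymX N → ℝ) (n : ℕ) (x : SymX N) : ℝ :=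
  ((preimTn p q n x).map fun y => Real.exp (birk p q f n y)).sum

/-- The pressure `P(f) = sup_{x ∈ J̃} limsup (1/n) log (L_f^n 1)(x)`. -/
def pressure (f : SymX N → ℝ) : ℝ :=
  ⨆ x : ↥(juliaSet p q), limsup (fun n : ℕ => (n : ℝ)⁻¹ * Real.log (LSum p q f n ↑x)) atTop

/-- Extension by zero of a function on `J̃` to all of `X`; since `T⁻¹ J̃ = J̃`, the values
outside `J̃` are irrelevant in all expressions below. -/
def jextend (f : ↥(juliaSet p q) → ℝ) : SymX N → ℝ :=
  fun x => if hx : x ∈ juliaSet p q then f ⟨x, hx⟩ else 0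

/-- Hölder continuity on `J̃` with respect to the metric `d_X`. -/
def HolderOnJ (f : ↥(juliaSet p q) → ℝ) : Prop :=
  ∃ C : ℝ, 0 < C ∧ ∃ α : ℝ, α ∈ Set.Ioc (0 : ℝ) 1 ∧
    ∀ x y : ↥(juliaSet p q), |f x - f y| ≤ C * dX (x : SymX N) (y : SymX N) ^ α

/-- `Q(g) = P(f + g) − P(f)`. -/
def Qfun (f g : ↥(juliaSet p q) → ℝ) : ℝ :=
  pressure p q (jextend p q fun x => f x + g x) - pressure p q (jextend p q f)

/-- The Legendre transform `L(m) = sup_g (∫ g dm − Q(g)) ∈ [0, (OnePoint.infty : Sphere)]`. -/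
def LLfun (f : ↥(juliaSet p q) → ℝ) (m : ProbabilityMeasure ↥(juliaSet p q)) : EReal :=
  ⨆ g : C(↥(juliaSet p q), ℝ),
    (((∫ x, g x ∂(m : Measure ↥(juliaSet p q))) - Qfun p q f g : ℝ) : EReal)

/-- `ρ(K) = inf_{m ∈ K} L(m)`. -/
def rho (f : ↥(juliaSet p q) → ℝ) (K : Set (ProbabilityMeasure ↥(juliaSet p q))) : EReal :=
  ⨅ m ∈ K, LLfun p q f m

/-- Membership in `M_T`: `T`-invariance of a probability measure on `J̃`. -/
def MTinv (m : ProbabilityMeasure ↥(juliaSet p q)) : Prop :=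
  ∀ A : Set (SymX N), MeasurableSet A →
    ((m : Measure ↥(juliaSet p q)).map Subtype.val) (Tmap p q ⁻¹' A) =
      ((m : Measure ↥(juliaSet p q)).map Subtype.val) A

/-- The orbital measure `μ_{y,n} = (1/n)(δ_y + δ_{Ty} + ⋯ + δ_{T^{n-1}y})`, viewed as a
measure on `J̃`. -/
def orbMeas (y : SymX N) (n : ℕ) : Measure ↥(juliaSet p q) :=
  Measure.comap Subtype.val
    ((n : ℝ≥0∞)⁻¹ • ∑ k ∈ Finset.range n, Measure.dirac ((Tmap p q)^[k] y))

/-- The (unique, if it exists) probability-measure avatar of `μ` lies in `K`. -/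
def inK (μ : Measure ↥(juliaSet p q)) (K : Set (ProbabilityMeasure ↥(juliaSet p q))) : Prop :=
  ∃ ν : ProbabilityMeasure ↥(juliaSet p q), (ν : Measure ↥(juliaSet p q)) = μ ∧ ν ∈ K

/-- The sequence `(1/n) log [Σ_{T^n y = x, μ_{y,n} ∈ K} e^{f^n(y)} / Σ_{T^n y = x} e^{f^n(y)}]`,
valued in `EReal` with the convention `log 0 = ⊥`. -/
def preimLDSeq (f : ↥(juliaSet p q) → ℝ) (x : SymX N)
    (K : Set (ProbabilityMeasure ↥(juliaSet p q))) : ℕ → EReal := fun n =>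
  if (((preimTn p q n x).filter fun y => inK p q (orbMeas p q y n) K).map
        fun y => Real.exp (birk p q (jextend p q f) n y)).sum = 0 then ⊥
  else
    (((n : ℝ)⁻¹ * Real.log
      (((((preimTn p q n x).filter fun y => inK p q (orbMeas p q y n) K).map
          fun y => Real.exp (birk p q (jextend p q f) n y)).sum) /
        LSum p q (jextend p q f) n x) : ℝ) : EReal)

/-- `Fix_m(T) ∩ J̃` as a multiset. -/
def fixJ (m : ℕ) : Multiset (SymX N) := (fixMultiset p q m).filter fun y => y ∈ juliaSet p q

/-- `Σ_{(ω,ζ) ∈ Fix_m(T) ∩ J̃} e^{f^m(ω,ζ)}`. -/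
def fixSum (f : SymX N → ℝ) (m : ℕ) : ℝ :=
  ((fixJ p q m).map fun y => Real.exp (birk p q f m y)).sum

/-- The periodic-point analogue of `preimLDSeq`, with the convention `log 0 = ⊥`. -/
def fixLDSeq (f : ↥(juliaSet p q) → ℝ)
    (K : Set (ProbabilityMeasure ↥(juliaSet p q))) : ℕ → EReal := fun m =>
  if (((fixJ p q m).filter fun y => inK p q (orbMeas p q y m) K).map
        fun y => Real.exp (birk p q (jextend p q f) m y)).sum = 0 then ⊥
  else
    (((m : ℝ)⁻¹ * Real.log
      (((((fixJ p q m).filter fun y => inK p q (orbMeas p q y m) K).map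
          fun y => Real.exp (birk p q (jextend p q f) m y)).sum) /
        fixSum p q (jextend p q f) m) : ℝ) : EReal)

/-! ### Inverse branches -/

/-- Projection of a subset of `X` to the sphere coordinate. -/
def projC (E : Set (SymX N)) : Set Sphere := Prod.snd '' E

/-- For a word `[v₁, …, v_m]`, the composite map `R_{v₁} ∘ R_{v₂} ∘ ⋯ ∘ R_{v_m}`. -/
def mapWord (l : List (Fin N)) : Sphere → Sphere :=
  l.foldr (fun i f => ratEval (p i) (q i) ∘ f) id

/-- `γ_m(U)`: the total number of analytic inverse branches of `T^m` on `U`, counted over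
all `m`-strings.  (A continuous section of a rational map off its critical values is
automatically holomorphic.) -/
def gammaCount (U : Set (SymX N)) (m : ℕ) : ℕ :=
  Nat.card ((v : Fin m → Fin N) ×
    { s : C(↥(projC U), Sphere) // ∀ z : ↥(projC U), mapWord p q (List.ofFn v) (s z) = ↑z })

/-- `C_n = ⋃_{k=1}^n T^k(C)`, the critical values of `T` of order up to `n`. -/
def critValSet (n : ℕ) : Set (SymX N) :=
  ⋃ k ∈ Finset.Icc 1 n, (Tmap p q)^[k] '' critSet p q

/-- `τ`: the number of distinct critical values of `T` in `U` (projected to the sphere). -/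
def tauCount (U : Set (SymX N)) : ℕ := (Prod.snd '' (Tmap p q '' critSet p q ∩ U)).ncard

/-! ### The averaging operator `G` -/

/-- `(G^m h)(x) = D^{-m} Σ_{T^m y = x} h(y)`. -/
def GmFun (h : SymX N → ℝ) (m : ℕ) (x : SymX N) : ℝ :=
  ((Dtot p q : ℝ) ^ m)⁻¹ * ((preimTn p q m x).map h).sum

/-- The supremum norm on functions on `J̃`. -/
def supJ (f : ↥(juliaSet p q) → ℝ) : ℝ := ⨆ x, |f x|

/-! ## Part A : the chordal metric -/

lemma sph_ii : sphDist (OnePoint.infty : Sphere) OnePoint.infty = 0 := rfl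
lemma sph_ic (b : ℂ) : sphDist (OnePoint.infty : Sphere) (b : Sphere) = 2 / Real.sqrt (1 + ‖b‖ ^ 2) := rfl
lemma sph_ci (a : ℂ) : sphDist (a : Sphere) OnePoint.infty = 2 / Real.sqrt (1 + ‖a‖ ^ 2) := rfl
lemma sph_cc (a b : ℂ) : sphDist (a : Sphere) (b : Sphere) =
    2 * dist a b / (Real.sqrt (1 + ‖a‖ ^ 2) * Real.sqrt (1 + ‖b‖ ^ 2)) := rfl

/-- stereographic embedding -/
def stE (z : Sphere) : WithLp 2 (ℂ × ℝ) :=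
  OnePoint.elim z (WithLp.toLp 2 (0, 1))
    (fun a => WithLp.toLp 2 (((2 / (1 + ‖a‖ ^ 2) : ℝ) : ℂ) * a, 1 - 2 / (1 + ‖a‖ ^ 2)))

lemma stE_i : stE (OnePoint.infty : Sphere) = WithLp.toLp 2 (0, 1) := rfl
lemma stE_c (a : ℂ) : stE (a : Sphere) = WithLp.toLp 2 (((2 / (1 + ‖a‖ ^ 2) : ℝ) : ℂ) * a, 1 - 2 / (1 + ‖a‖ ^ 2)) := rfl

lemma stE_i_fst : (stE (OnePoint.infty : Sphere)).fst = 0 := rfl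
lemma stE_i_snd : (stE (OnePoint.infty : Sphere)).snd = 1 := rfl
lemma stE_c_fst (a : ℂ) : (stE (a : Sphere)).fst = ((2 / (1 + ‖a‖ ^ 2) : ℝ) : ℂ) * a := rfl
lemma stE_c_snd (a : ℂ) : (stE (a : Sphere)).snd = 1 - 2 / (1 + ‖a‖ ^ 2) := rfl

lemma one_add_sq_pos (a : ℂ) : 0 < 1 + ‖a‖ ^ 2 := by positivity

lemma sph_eq_dist (z w : Sphere) : sphDist z w = dist (stE z) (stE w) := by
  have key : ∀ a : ℂ, dist (stE (a : Sphere)) (stE (OnePoint.infty : Sphere)) = 2 / Real.sqrt (1 + ‖a‖ ^ 2) := by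
    intro a
    have h := one_add_sq_pos a
    rw [WithLp.prod_dist_eq_of_L2, Real.sqrt_eq_iff_mul_self_eq (by positivity) (by positivity)]
    simp only [stE_c_fst, stE_c_snd, stE_i_fst, stE_i_snd, dist_zero_right, norm_mul, Complex.norm_real, Real.dist_eq]
    rw [div_mul_div_comm, Real.mul_self_sqrt h.le, sq_abs, Real.norm_of_nonneg (by positivity)]
    field_simp
    ring
  induction z using OnePoint.rec with
  | infty =>
    induction w using OnePoint.rec with
    | infty => simp [sph_ii]
    | coe b => rw [sph_ic, dist_comm, key]
  | coe a =>
    induction w using OnePoint.rec with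
    | infty => rw [sph_ci, key]
    | coe b =>
      have h := one_add_sq_pos a
      have h' := one_add_sq_pos b
      rw [sph_cc, WithLp.prod_dist_eq_of_L2, eq_comm, Real.sqrt_eq_iff_mul_self_eq (by positivity) (by positivity)]
      simp only [stE_c_fst, stE_c_snd, Complex.dist_eq, Real.dist_eq]
      rw [div_mul_div_comm, mul_mul_mul_comm (Real.sqrt _), Real.mul_self_sqrt h.le, Real.mul_self_sqrt h'.le, sq_abs]
      have e1 : ∀ u : ℂ, ‖u‖ ^ 2 = u.re ^ 2 + u.im ^ 2 := by
        intro u; rw [← Complex.normSq_eq_norm_sq, Complex.normSq_apply]; ring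
      rw [mul_mul_mul_comm 2, ← sq ‖a - b‖, e1 (a - b), e1 (_ - _)]
      rw [e1] at h h'
      simp only [Complex.sub_re, Complex.sub_im, Complex.re_ofReal_mul, Complex.im_ofReal_mul, e1]
      field_simp
      ring

lemma sph_nonneg (z w : Sphere) : 0 ≤ sphDist z w := by rw [sph_eq_dist]; exact dist_nonneg
lemma sph_comm (z w : Sphere) : sphDist z w = sphDist w z := by simp [sph_eq_dist, dist_comm]
lemma sph_tri (a b c : Sphere) : sphDist a c ≤ sphDist a b + sphDist b c := by
  simp only [sph_eq_dist]; exact dist_triangle _ _ _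
lemma sph_self (z : Sphere) : sphDist z z = 0 := by simp [sph_eq_dist]

lemma sph_eq_zero {z w : Sphere} : sphDist z w = 0 ↔ z = w := by
  refine ⟨fun h => ?_, fun h => h ▸ sph_self z⟩
  induction z using OnePoint.rec with
  | infty =>
    induction w using OnePoint.rec with
    | infty => rfl
    | coe b => exfalso; rw [sph_ic] at h; have := one_add_sq_pos b; have : 0 < 2 / Real.sqrt (1 + ‖b‖ ^ 2) := by positivity
               linarith
  | coe a =>
    induction w using OnePoint.rec with
    | infty => exfalso; rw [sph_ci] at h; have := one_add_sq_pos a; have : 0 < 2 / Real.sqrt (1 + ‖a‖ ^ 2) := by positivity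
               linarith
    | coe b =>
      rw [sph_cc] at h
      have ha := one_add_sq_pos a
      have hb := one_add_sq_pos b
      have h1 : Real.sqrt (1 + ‖a‖ ^ 2) ≠ 0 := by positivity
      have h2 : Real.sqrt (1 + ‖b‖ ^ 2) ≠ 0 := by positivity
      have : dist a b = 0 := by
        rcases div_eq_zero_iff.1 h with h | h
        · linarith
        · exact absurd h (mul_ne_zero h1 h2)
      rw [dist_eq_zero] at this
      rw [this]

lemma sph_pos {z w : Sphere} (h : z ≠ w) : 0 < sphDist z w :=
  lt_of_le_of_ne (sph_nonneg _ _) fun h' => h (sph_eq_zero.1 h'.symm)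

lemma stE_norm (z : Sphere) : ‖stE z‖ = 1 := by
  rw [WithLp.prod_norm_eq_of_L2, Real.sqrt_eq_one]
  induction z using OnePoint.rec with
  | infty => simp [stE_i]
  | coe a =>
    have h := one_add_sq_pos a
    simp only [stE_c_fst, stE_c_snd, norm_mul, Complex.norm_real, Real.norm_eq_abs, sq_abs, mul_pow]
    field_simp
    ring

lemma sph_le_two (z w : Sphere) : sphDist z w ≤ 2 := by
  rw [sph_eq_dist, dist_eq_norm]
  refine (norm_sub_le _ _).trans ?_
  rw [stE_norm, stE_norm]; norm_num

lemma stE_cont : Continuous stE := by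
  have hc : Continuous (fun a : ℂ => stE (a : Sphere)) := by
    simp only [stE_c]
    refine (WithLp.prod_continuous_toLp 2 ℂ ℝ).comp ?_
    have : ∀ a : ℂ, 1 + ‖a‖ ^ 2 ≠ 0 := fun a => (one_add_sq_pos a).ne'
    fun_prop (disch := assumption)
  rw [continuous_iff_continuousAt]
  intro z
  induction z using OnePoint.rec with
  | infty =>
    rw [OnePoint.continuousAt_infty', tendsto_iff_dist_tendsto_zero, Filter.coclosedCompact_eq_cocompact]
    simp only [Function.comp_def, ← sph_eq_dist, sph_ci]
    refine Tendsto.div_atTop tendsto_const_nhds ?_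
    refine Real.tendsto_sqrt_atTop.comp (tendsto_atTop_add_const_left _ _ ?_)
    exact (tendsto_pow_atTop (by norm_num)).comp (tendsto_norm_cocompact_atTop (E := ℂ))
  | coe a =>
    rw [OnePoint.continuousAt_coe]
    exact hc.continuousAt

lemma stE_inj : Function.Injective stE := by
  intro z w h
  rw [← sph_eq_zero, sph_eq_dist, h, dist_self]

lemma stE_emb : IsClosedEmbedding stE := stE_cont.isClosedEmbedding stE_inj

lemma sph_cont : Continuous (fun x : Sphere × Sphere => sphDist x.1 x.2) := by
  simp only [sph_eq_dist]
  exact (stE_cont.comp continuous_fst).dist (stE_cont.comp continuous_snd)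

lemma sph_tendsto {ι : Type*} {F : Filter ι} {u : ι → Sphere} {z : Sphere} :
    Tendsto u F (𝓝 z) ↔ Tendsto (fun i => sphDist (u i) z) F (𝓝 0) := by
  rw [stE_emb.tendsto_nhds_iff, tendsto_iff_dist_tendsto_zero]
  simp only [Function.comp_def, sph_eq_dist]

/-- norm of the representing vector -/
def nrm (z : Sphere) : ℝ := OnePoint.elim z 1 (fun a => Real.sqrt (1 + ‖a‖ ^ 2))
lemma nrm_i : nrm (OnePoint.infty : Sphere) = 1 := rfl
lemma nrm_c (a : ℂ) : nrm (a : Sphere) = Real.sqrt (1 + ‖a‖ ^ 2) := rfl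
lemma nrm_pos (z : Sphere) : 0 < nrm z := by
  induction z using OnePoint.rec with
  | infty => simp [nrm_i]
  | coe a => rw [nrm_c]; have := one_add_sq_pos a; positivity

/-! ## Part B : one rational map -/

/-- homogeneous evaluation -/
def hev (d : ℕ) (F : ℂ[X]) (y : Sphere) : ℂ := OnePoint.elim y (F.coeff d) (fun a => F.eval a)
lemma hev_i (d : ℕ) (F : ℂ[X]) : hev d F (OnePoint.infty : Sphere) = F.coeff d := rfl
lemma hev_c (d : ℕ) (F : ℂ[X]) (a : ℂ) : hev d F (a : Sphere) = F.eval a := rfl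

lemma rat_i (P Q : ℂ[X]) : ratEval P Q (OnePoint.infty : Sphere) =
    (if Q.natDegree < P.natDegree then (OnePoint.infty : Sphere)
     else if P.natDegree < Q.natDegree then ((0 : ℂ) : Sphere)
     else ((P.leadingCoeff / Q.leadingCoeff : ℂ) : Sphere)) := rfl
lemma rat_c (P Q : ℂ[X]) (a : ℂ) : ratEval P Q (a : Sphere) =
    if Q.eval a = 0 then (OnePoint.infty : Sphere) else ((P.eval a / Q.eval a : ℂ) : Sphere) := rfl

lemma rat_hev (P Q : ℂ[X]) (d : ℕ) (hd : d = max P.natDegree Q.natDegree) (h1 : 1 ≤ d) (y : Sphere) :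
    ratEval P Q y = if hev d Q y = 0 then (OnePoint.infty : Sphere)
      else ((hev d P y / hev d Q y : ℂ) : Sphere) := by
  induction y using OnePoint.rec with
  | coe a => rw [rat_c, hev_c, hev_c]
  | infty =>
    rw [rat_i, hev_i, hev_i]
    rcases lt_trichotomy P.natDegree Q.natDegree with h | h | h
    · have e : d = Q.natDegree := by omega
      have h0 : P.coeff d = 0 := Polynomial.coeff_eq_zero_of_natDegree_lt (by omega)
      have h2 : Q.coeff d ≠ 0 := by
        rw [e]
        have : Q ≠ 0 := by rintro rfl; simp at h
        simpa using this
      rw [if_neg (by omega), if_pos h, if_neg h2, h0, zero_div]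
    · have e : d = Q.natDegree := by omega
      have e' : d = P.natDegree := by omega
      have h2 : Q.coeff d ≠ 0 := by
        rw [e]
        have : Q ≠ 0 := by rintro rfl; simp at e; omega
        simpa using this
      rw [if_neg (by omega), if_neg (by omega), if_neg h2]
      simp only [Polynomial.leadingCoeff, ← e, ← e']
    · have h0 : Q.coeff d = 0 := Polynomial.coeff_eq_zero_of_natDegree_lt (by omega)
      rw [if_pos h, if_pos h0]

lemma hev_ne (P Q : ℂ[X]) (hc : IsCoprime P Q) (d : ℕ) (hd : d = max P.natDegree Q.natDegree)
    (h1 : 1 ≤ d) (y : Sphere) : hev d P y ≠ 0 ∨ hev d Q y ≠ 0 := by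
  induction y using OnePoint.rec with
  | coe a =>
    rw [hev_c, hev_c]
    by_contra! h
    obtain ⟨u, v, huv⟩ := hc
    have := congrArg (Polynomial.eval a) huv
    simp [h.1, h.2] at this
  | infty =>
    rw [hev_i, hev_i]
    rcases le_total P.natDegree Q.natDegree with h | h
    · right
      have e : d = Q.natDegree := by omega
      have : Q ≠ 0 := by rintro rfl; simp at e; omega
      rw [e]; simpa using this
    · left
      have e : d = P.natDegree := by omega
      have : P ≠ 0 := by rintro rfl; simp at e; omega
      rw [e]; simpa using this

/-- norm of the homogeneous value -/
def hN (P Q : ℂ[X]) (d : ℕ) (y : Sphere) : ℝ := Real.sqrt (‖hev d P y‖ ^ 2 + ‖hev d Q y‖ ^ 2)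

lemma hN_pos (P Q : ℂ[X]) (hc : IsCoprime P Q) (d : ℕ) (hd : d = max P.natDegree Q.natDegree)
    (h1 : 1 ≤ d) (y : Sphere) : 0 < hN P Q d y := by
  rw [hN, Real.sqrt_pos]
  rcases hev_ne P Q hc d hd h1 y with h | h
  · have := norm_pos_iff.2 h; positivity
  · have := norm_pos_iff.2 h; positivity

/-- the polynomial whose roots are the fiber -/
def Fb (P Q : ℂ[X]) (b : Sphere) : ℂ[X] := OnePoint.elim b Q (fun b => P - Polynomial.C b * Q)
lemma Fb_i (P Q : ℂ[X]) : Fb P Q (OnePoint.infty : Sphere) = Q := rfl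
lemma Fb_c (P Q : ℂ[X]) (b : ℂ) : Fb P Q (b : Sphere) = P - Polynomial.C b * Q := rfl

lemma fiber_Fb (P Q : ℂ[X]) (b : Sphere) : fiber P Q b = ((Fb P Q b).roots.map fun z : ℂ => (z : Sphere)) +
      Multiset.replicate (max P.natDegree Q.natDegree - (Fb P Q b).natDegree) (OnePoint.infty : Sphere) := by
  induction b using OnePoint.rec with
  | coe a =>
    simp only [fiber, Fb, OnePoint.elim_some]
    congr 1
    simp [Multiset.bind_def, Multiset.pure_def, Multiset.bind_singleton]
  | infty =>
    simp only [fiber, Fb, OnePoint.elim_infty]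
    congr 1
    simp [Multiset.bind_def, Multiset.pure_def, Multiset.bind_singleton]

lemma Fb_deg (P Q : ℂ[X]) (b : Sphere) : (Fb P Q b).natDegree ≤ max P.natDegree Q.natDegree := by
  induction b using OnePoint.rec with
  | coe a =>
    rw [Fb_c]
    refine (Polynomial.natDegree_sub_le _ _).trans (max_le_max le_rfl (Polynomial.natDegree_C_mul_le _ _))
  | infty => exact le_max_right _ _

lemma Fb_ne (P Q : ℂ[X]) (hc : IsCoprime P Q) (h1 : 1 ≤ max P.natDegree Q.natDegree) (b : Sphere) :
    Fb P Q b ≠ 0 := by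
  induction b using OnePoint.rec with
  | coe a =>
    rw [Fb_c]
    intro h
    have hP : P = Polynomial.C a * Q := sub_eq_zero.1 h
    have hu : IsUnit Q := by
      have : IsCoprime Q Q := by
        rw [hP] at hc; exact hc.of_mul_left_right
      exact isCoprime_self.1 this
    have hQ := Polynomial.natDegree_eq_zero_of_isUnit hu
    have : P.natDegree = 0 := by
      rw [hP]; exact Nat.le_zero.1 ((Polynomial.natDegree_C_mul_le _ _).trans hQ.le)
    omega
  | infty =>
    rw [Fb_i]; rintro rfl
    have hu : IsUnit P := isCoprime_zero_right.1 hc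
    have hQ := Polynomial.natDegree_eq_zero_of_isUnit hu
    simp at h1; omega

lemma sph_rat (P Q : ℂ[X]) (hc : IsCoprime P Q) (d : ℕ) (hd : d = max P.natDegree Q.natDegree)
    (h1 : 1 ≤ d) (y b : Sphere) :
    sphDist (ratEval P Q y) b * (hN P Q d y * nrm b) = 2 * ‖hev d (Fb P Q b) y‖ := by
  have hF : ∀ b : ℂ, hev d (Fb P Q (b : Sphere)) y = hev d P y - b * hev d Q y := by
    intro b
    induction y using OnePoint.rec with
    | coe a => simp [hev_c, Fb_c]
    | infty => simp [hev_i, Fb_c]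
  have hp := hN_pos P Q hc d hd h1 y
  have hn := nrm_pos b
  have hne := hev_ne P Q hc d hd h1 y
  rw [rat_hev P Q d hd h1]
  split_ifs with h
  · have hne : hev d P y ≠ 0 := by simpa [h] using hne
    have e : hN P Q d y = ‖hev d P y‖ := by simp [hN, h]
    induction b using OnePoint.rec with
    | coe b =>
      rw [sph_ic, nrm_c, hF, h, e]
      have := one_add_sq_pos b
      simp
      field_simp
    | infty => rw [Fb_i, sph_ii, h]; simp
  · have e : hN P Q d y = ‖hev d Q y‖ * Real.sqrt (1 + ‖hev d P y / hev d Q y‖ ^ 2) := by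
      rw [hN, Real.sqrt_eq_iff_mul_self_eq (by positivity) (by positivity), mul_mul_mul_comm,
        Real.mul_self_sqrt (by positivity), norm_div]
      have := norm_pos_iff.2 h
      field_simp
      ring
    have h5 := one_add_sq_pos (hev d P y / hev d Q y)
    have hq := norm_pos_iff.2 h
    induction b using OnePoint.rec with
    | coe b =>
      have h6 := one_add_sq_pos b
      rw [sph_cc, nrm_c, hF, e]
      have : hev d P y - b * hev d Q y = (hev d P y / hev d Q y - b) * hev d Q y := by field_simp
      rw [this, norm_mul, dist_eq_norm]
      field_simp
    | infty =>
      rw [sph_ci, nrm_i, e, Fb_i]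
      field_simp

lemma prod_formula (F : ℂ[X]) (hF : F ≠ 0) (d : ℕ) (hd : F.natDegree ≤ d) :
    ∃ c : ℝ, 0 < c ∧ ∀ y : Sphere, ‖hev d F y‖ = c * nrm y ^ d *
      (((F.roots.map fun z : ℂ => (z : Sphere)) + Multiset.replicate (d - F.natDegree) (OnePoint.infty : Sphere)).map
        (sphDist y)).prod := by
  have hsp : F.Splits := IsAlgClosed.splits F
  have hcard : F.roots.card = F.natDegree := hsp.natDegree_eq_card_roots.symm
  have hlc : 0 < ‖F.leadingCoeff‖ := norm_pos_iff.2 (Polynomial.leadingCoeff_ne_zero.2 hF)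
  refine ⟨‖F.leadingCoeff‖ * (F.roots.map fun r : ℂ => nrm (r : Sphere) / 2).prod * (1 / 2) ^ (d - F.natDegree), ?_, ?_⟩
  · refine mul_pos (mul_pos hlc ?_) (by positivity)
    refine Multiset.prod_pos ?_
    simp only [Multiset.mem_map]
    rintro _ ⟨r, _, rfl⟩
    have := nrm_pos (r : Sphere); positivity
  intro y
  simp only [Multiset.map_add, Multiset.map_map, Multiset.map_replicate, Multiset.prod_add, Multiset.prod_replicate]
  induction y using OnePoint.rec with
  | coe a =>
    have hn := nrm_pos (a : Sphere)
    have e1 : ‖hev d F (a : Sphere)‖ = ‖F.leadingCoeff‖ * (F.roots.map fun r => ‖a - r‖).prod := by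
      rw [hev_c]
      conv_lhs => rw [hsp.eq_prod_roots]
      simp only [Polynomial.eval_mul, Polynomial.eval_C, norm_mul, Polynomial.eval_multiset_prod, Multiset.map_map]
      congr 1
      have := map_multiset_prod (normHom : ℂ →*₀ ℝ) (Multiset.map (eval a ∘ fun x => X - C x) F.roots)
      refine Eq.trans this ?_
      simp [Function.comp_def]
    have e2 : ∀ r : ℂ, ‖a - r‖ = nrm (r : Sphere) / 2 * sphDist (a : Sphere) (r : Sphere) * nrm (a : Sphere) := by
      intro r
      have h2 := one_add_sq_pos r
      have h3 := one_add_sq_pos a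
      rw [sph_cc, nrm_c, nrm_c, dist_eq_norm]
      field_simp
    have e3 : sphDist (a : Sphere) OnePoint.infty = 2 / nrm (a : Sphere) := rfl
    rw [e1]
    simp only [e2, Multiset.prod_map_mul, Function.comp_def, Multiset.map_const', Multiset.prod_replicate, hcard, e3]
    obtain ⟨k, rfl⟩ := Nat.exists_eq_add_of_le hd
    simp only [Nat.add_sub_cancel_left, pow_add, div_pow, one_pow]
    field_simp
  | infty =>
    rw [hev_i, nrm_i, sph_ii]
    rcases eq_or_lt_of_le hd with h | h
    · rw [← h, Nat.sub_self, pow_zero, pow_zero, one_pow, mul_one, mul_one, mul_one, mul_assoc, ← Multiset.prod_map_mul]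
      have : ∀ r : ℂ, nrm (r : Sphere) / 2 * (sphDist OnePoint.infty ∘ fun z : ℂ => (z : Sphere)) r = 1 := by
        intro r
        have := one_add_sq_pos r
        simp only [Function.comp, sph_ic, nrm_c]
        field_simp
      rw [Multiset.map_congr rfl (fun r _ => this r)]
      simp
    · rw [Polynomial.coeff_eq_zero_of_natDegree_lt h, zero_pow (by omega)]
      simp

lemma fiber_card (P Q : ℂ[X]) (b : Sphere) :
    (fiber P Q b).card = max P.natDegree Q.natDegree := by
  have hsp : (Fb P Q b).Splits := IsAlgClosed.splits _
  have hcard : (Fb P Q b).roots.card = (Fb P Q b).natDegree := hsp.natDegree_eq_card_roots.symm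
  rw [fiber_Fb, Multiset.card_add, Multiset.card_map, Multiset.card_replicate, hcard]
  have := Fb_deg P Q b
  omega

lemma hN_bdd (P Q : ℂ[X]) (hc : IsCoprime P Q) (d : ℕ) (hd : d = max P.natDegree Q.natDegree)
    (h1 : 1 ≤ d) : ∃ h0 h1 : ℝ, 0 < h0 ∧ 0 < h1 ∧ ∀ y : Sphere, h0 * nrm y ^ d ≤ hN P Q d y ∧
      hN P Q d y ≤ h1 * nrm y ^ d := by
  -- first chart
  have cpt : IsCompact (Metric.closedBall (0 : ℂ) 1) := isCompact_closedBall 0 1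
  have hne : (Metric.closedBall (0 : ℂ) 1).Nonempty := ⟨0, by simp⟩
  have chart : ∀ A B : ℂ[X], (∀ a : ℂ, A.eval a ≠ 0 ∨ B.eval a ≠ 0) →
      ∃ l u : ℝ, 0 < l ∧ 0 < u ∧ ∀ a : ℂ, ‖a‖ ≤ 1 →
        l * Real.sqrt (1 + ‖a‖ ^ 2) ^ d ≤ Real.sqrt (‖A.eval a‖ ^ 2 + ‖B.eval a‖ ^ 2) ∧
        Real.sqrt (‖A.eval a‖ ^ 2 + ‖B.eval a‖ ^ 2) ≤ u * Real.sqrt (1 + ‖a‖ ^ 2) ^ d := by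
    intro A B hAB
    have hpos : ∀ a : ℂ, 0 < Real.sqrt (‖A.eval a‖ ^ 2 + ‖B.eval a‖ ^ 2) / Real.sqrt (1 + ‖a‖ ^ 2) ^ d := by
      intro a
      have h := one_add_sq_pos a
      have : 0 < ‖A.eval a‖ ^ 2 + ‖B.eval a‖ ^ 2 := by
        rcases hAB a with h | h
        · have := norm_pos_iff.2 h; positivity
        · have := norm_pos_iff.2 h; positivity
      positivity
    have hcont : Continuous fun a : ℂ => Real.sqrt (‖A.eval a‖ ^ 2 + ‖B.eval a‖ ^ 2) / Real.sqrt (1 + ‖a‖ ^ 2) ^ d := by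
      have : ∀ a : ℂ, Real.sqrt (1 + ‖a‖ ^ 2) ^ d ≠ 0 := fun a => by
        have h := one_add_sq_pos a
        positivity
      refine Continuous.div (by fun_prop) (by fun_prop) this
    obtain ⟨x, _, hx⟩ := cpt.exists_isMinOn hne hcont.continuousOn
    obtain ⟨x', _, hx'⟩ := cpt.exists_isMaxOn hne hcont.continuousOn
    refine ⟨_, _, hpos x, hpos x', fun a ha => ?_⟩
    have ha' : a ∈ Metric.closedBall (0 : ℂ) 1 := by simpa using ha
    have h := one_add_sq_pos a
    have hs : 0 < Real.sqrt (1 + ‖a‖ ^ 2) ^ d := by positivity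
    exact ⟨(le_div_iff₀ hs).1 (hx ha'), (div_le_iff₀ hs).1 (hx' ha')⟩
  obtain ⟨l, u, hl, hu, H⟩ := chart P Q fun a => by simpa [hev_c] using hev_ne P Q hc d hd h1 (a : Sphere)
  have hrefl : ∀ F : ℂ[X], F.natDegree ≤ d → ∀ a : ℂ, a ≠ 0 → (F.reflect d).eval a = a ^ d * F.eval a⁻¹ := by
    intro F hF a ha
    have : Invertible (a⁻¹) := invertibleOfNonzero (inv_ne_zero ha)
    have h := Polynomial.eval₂_reflect_mul_pow (RingHom.id ℂ) (a⁻¹) d F hF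
    rw [invOf_eq_inv, inv_inv] at h
    rw [Polynomial.eval, Polynomial.eval, ← h, inv_pow]
    have := pow_ne_zero d ha
    field_simp
  have hr0 : ∀ F : ℂ[X], (F.reflect d).eval 0 = F.coeff d := by
    intro F
    rw [← Polynomial.coeff_zero_eq_eval_zero, Polynomial.coeff_reflect]
    rw [Polynomial.revAt_le (Nat.zero_le d), Nat.sub_zero]
  obtain ⟨l', u', hl', hu', H'⟩ := chart (P.reflect d) (Q.reflect d) fun a => by
    by_cases ha : a = 0
    · subst ha
      rw [hr0, hr0]
      simpa [hev_i] using hev_ne P Q hc d hd h1 OnePoint.infty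
    · rw [hrefl P (by omega) a ha, hrefl Q (by omega) a ha]
      have := hev_ne P Q hc d hd h1 (a⁻¹ : ℂ)
      simpa [hev_c, ha] using this
  refine ⟨min l l', max u u', lt_min hl hl', lt_max_of_lt_left hu, fun y => ?_⟩
  have hn := pow_pos (nrm_pos y) d
  suffices (l * nrm y ^ d ≤ hN P Q d y ∧ hN P Q d y ≤ u * nrm y ^ d) ∨
      (l' * nrm y ^ d ≤ hN P Q d y ∧ hN P Q d y ≤ u' * nrm y ^ d) by
    rcases this with h | h
    · exact ⟨(mul_le_mul_of_nonneg_right (min_le_left _ _) hn.le).trans h.1,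
        h.2.trans (mul_le_mul_of_nonneg_right (le_max_left _ _) hn.le)⟩
    · exact ⟨(mul_le_mul_of_nonneg_right (min_le_right _ _) hn.le).trans h.1,
        h.2.trans (mul_le_mul_of_nonneg_right (le_max_right _ _) hn.le)⟩
  induction y using OnePoint.rec with
  | coe a =>
    by_cases ha : ‖a‖ ≤ 1
    · left
      exact H a ha
    · right
      push Not at ha
      have ha0 : a ≠ 0 := by rintro rfl; simp at ha; linarith
      have hb : ‖a⁻¹‖ ≤ 1 := by rw [norm_inv]; exact inv_le_one_of_one_le₀ ha.le
      have h := H' a⁻¹ hb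
      rw [hrefl P (by omega) _ (inv_ne_zero ha0), hrefl Q (by omega) _ (inv_ne_zero ha0), inv_inv] at h
      have hna : 0 < ‖a‖ := by linarith
      have e1 : Real.sqrt (‖a⁻¹ ^ d * P.eval a‖ ^ 2 + ‖a⁻¹ ^ d * Q.eval a‖ ^ 2) = (‖a‖⁻¹) ^ d * hN P Q d (a : Sphere) := by
        rw [hN, hev_c, hev_c, Real.sqrt_eq_iff_mul_self_eq (by positivity) (by positivity), mul_mul_mul_comm,
          Real.mul_self_sqrt (by positivity)]
        simp only [norm_mul, norm_pow, norm_inv]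
        ring
      have e2 : Real.sqrt (1 + ‖a⁻¹‖ ^ 2) = ‖a‖⁻¹ * nrm (a : Sphere) := by
        rw [nrm_c, Real.sqrt_eq_iff_mul_self_eq (by positivity) (by positivity), mul_mul_mul_comm,
          Real.mul_self_sqrt (by positivity), norm_inv]
        field_simp
        ring
      rw [e1, e2, mul_pow] at h
      have hi : 0 < (‖a‖⁻¹) ^ d := by positivity
      constructor
      · refine le_of_mul_le_mul_left ?_ hi
        linarith [h.1]
      · refine le_of_mul_le_mul_left ?_ hi
        linarith [h.2]
  | infty =>
    right
    have h := H' 0 (by simp)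
    rw [hr0, hr0] at h
    simpa [hN, hev_i, nrm_i] using h

/-- product of chordal distances to a multiset of points -/
def sprod (y : Sphere) (s : Multiset Sphere) : ℝ := (s.map (sphDist y)).prod

lemma sprod_nonneg (y : Sphere) (s : Multiset Sphere) : 0 ≤ sprod y s := by
  refine Multiset.prod_nonneg ?_
  simp only [Multiset.mem_map]
  rintro _ ⟨r, _, rfl⟩
  exact sph_nonneg _ _

lemma sprod_le (y : Sphere) (s : Multiset Sphere) : sprod y s ≤ 2 ^ s.card := by
  induction s using Multiset.induction_on with
  | empty => simp [sprod]
  | cons a s ih =>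
    have h0 := sprod_nonneg y s
    simp only [sprod, Multiset.map_cons, Multiset.prod_cons, Multiset.card_cons, pow_succ] at *
    rw [mul_comm]
    exact mul_le_mul ih (sph_le_two _ _) (sph_nonneg _ _) (by positivity)

lemma sprod_eq_zero {y : Sphere} {s : Multiset Sphere} : sprod y s = 0 ↔ y ∈ s := by
  simp only [sprod, Multiset.prod_eq_zero_iff, Multiset.mem_map, sph_eq_zero]
  constructor
  · rintro ⟨a, h, rfl⟩; exact h
  · intro h; exact ⟨y, h, rfl⟩

lemma sprod_ge (y : Sphere) (s : Multiset Sphere) (r : ℝ) (hr : 0 ≤ r) (h : ∀ η ∈ s, r ≤ sphDist y η) :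
    r ^ s.card ≤ sprod y s := by
  induction s using Multiset.induction_on with
  | empty => simp [sprod]
  | cons a s ih =>
    have h2 := ih (fun η hη => h η (Multiset.mem_cons_of_mem hη))
    simp only [sprod, Multiset.map_cons, Multiset.prod_cons, Multiset.card_cons, pow_succ] at *
    rw [mul_comm (sphDist y a)]
    exact mul_le_mul h2 (h a (Multiset.mem_cons_self _ _)) hr (Multiset.prod_nonneg (by
      simp only [Multiset.mem_map]
      rintro _ ⟨r, _, rfl⟩
      exact sph_nonneg _ _))

/-- a point far away from `d` given points -/
lemma exists_far (d : ℕ) : ∃ r : ℝ, 0 < r ∧ r ≤ 1 ∧ ∀ s : Multiset Sphere, s.card ≤ d →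
    ∃ y : Sphere, ∀ η ∈ s, r ≤ sphDist y η := by
  let pt : Fin (d + 1) → Sphere := fun i => ((i : ℕ) : ℂ)
  have hinj : Function.Injective pt := by
    intro i j h
    have h' : ((i : ℕ) : ℂ) = ((j : ℕ) : ℂ) := OnePoint.coe_injective h
    exact Fin.ext (by exact_mod_cast h')
  obtain ⟨r, hr, hr2⟩ : ∃ r : ℝ, 0 < r ∧ ∀ i j, i ≠ j → 2 * r ≤ sphDist (pt i) (pt j) := by
    let S : Finset ℝ := insert 2 ((Finset.univ.filter fun ij : Fin (d+1) × Fin (d+1) => ij.1 ≠ ij.2).image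
      fun ij => sphDist (pt ij.1) (pt ij.2))
    have hS : S.Nonempty := ⟨2, by simp [S]⟩
    have hpos : 0 < S.min' hS := by
      rw [Finset.lt_min'_iff]
      intro x hx
      simp only [S, Finset.mem_insert, Finset.mem_image, Finset.mem_filter] at hx
      rcases hx with rfl | ⟨ij, ⟨_, h⟩, rfl⟩
      · norm_num
      · exact sph_pos (fun h' => h (hinj h'))
    refine ⟨S.min' hS / 2, by positivity, fun i j hij => ?_⟩
    have : S.min' hS ≤ sphDist (pt i) (pt j) := by
      apply Finset.min'_le
      simp only [S, Finset.mem_insert, Finset.mem_image, Finset.mem_filter]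
      exact Or.inr ⟨(i, j), ⟨by simp, hij⟩, rfl⟩
    linarith
  refine ⟨min r 1, lt_min hr one_pos, min_le_right _ _, fun s hs => ?_⟩
  by_contra! hcon
  choose g hg hg' using fun i => hcon (pt i)
  have hgi : Function.Injective g := by
    intro i j hij
    by_contra hne
    have h1 := hr2 i j hne
    have h2 := sph_tri (pt i) (g i) (pt j)
    have h3 := hg' i
    have h4 := hg' j
    rw [← hij, sph_comm] at h4
    have := min_le_left r 1
    linarith
  have : Fintype.card (Fin (d+1)) ≤ s.toFinset.card := by
    rw [← Finset.card_univ]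
    exact Finset.card_le_card_of_injOn g (fun i _ => by simpa using hg i) hgi.injOn
  have h5 := Multiset.toFinset_card_le s
  simp at this
  omega

lemma key_pre (P Q : ℂ[X]) (hc : IsCoprime P Q) (h1 : 1 ≤ max P.natDegree Q.natDegree) :
    ∃ h0 h1 : ℝ, 0 < h0 ∧ 0 < h1 ∧ ∀ b : Sphere, ∃ C : ℝ, 0 < C ∧ ∀ y : Sphere,
      h0 * sphDist (ratEval P Q y) b ≤ C * sprod y (fiber P Q b) ∧
      C * sprod y (fiber P Q b) ≤ h1 * sphDist (ratEval P Q y) b := by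
  obtain ⟨l, u, hl, hu, H⟩ := hN_bdd P Q hc _ rfl h1
  refine ⟨l, u, hl, hu, fun b => ?_⟩
  obtain ⟨c, hc0, hcf⟩ := prod_formula (Fb P Q b) (Fb_ne P Q hc h1 b) _ (Fb_deg P Q b)
  rw [← fiber_Fb] at hcf
  have hnb := nrm_pos b
  refine ⟨2 * c / nrm b, by positivity, fun y => ?_⟩
  have h2 := sph_rat P Q hc _ rfl h1 y b
  rw [hcf] at h2
  obtain ⟨h3, h4⟩ := H y
  have hn := pow_pos (nrm_pos y) (max P.natDegree Q.natDegree)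
  have hs := sph_nonneg (ratEval P Q y) b
  have e : sphDist (ratEval P Q y) b * hN P Q (max P.natDegree Q.natDegree) y =
      (2 * c / nrm b * sprod y (fiber P Q b)) * nrm y ^ (max P.natDegree Q.natDegree) := by
    rw [sprod]
    field_simp
    linarith [h2]
  constructor
  · refine le_of_mul_le_mul_right ?_ hn
    rw [← e]
    nlinarith [mul_le_mul_of_nonneg_left h3 hs]
  · refine le_of_mul_le_mul_right ?_ hn
    rw [← e]
    nlinarith [mul_le_mul_of_nonneg_left h4 hs]

lemma mem_fiber (P Q : ℂ[X]) (hc : IsCoprime P Q) (h1 : 1 ≤ max P.natDegree Q.natDegree) (y b : Sphere) :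
    y ∈ fiber P Q b ↔ ratEval P Q y = b := by
  obtain ⟨l, u, hl, hu, H⟩ := key_pre P Q hc h1
  obtain ⟨C, hC, h⟩ := H b
  obtain ⟨h2, h3⟩ := h y
  rw [← sprod_eq_zero, ← sph_eq_zero]
  have e1 := sprod_nonneg y (fiber P Q b)
  have e2 := sph_nonneg (ratEval P Q y) b
  constructor
  · intro h; rw [h] at h2
    nlinarith
  · intro h; rw [h] at h3
    nlinarith

lemma exists_pre (P Q : ℂ[X]) (hc : IsCoprime P Q) (h1 : 1 ≤ max P.natDegree Q.natDegree) (b : Sphere) :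
    ∃ y, ratEval P Q y = b := by
  have : 0 < (fiber P Q b).card := by rw [fiber_card]; omega
  obtain ⟨y, hy⟩ := Multiset.card_pos_iff_exists_mem.1 this
  exact ⟨y, (mem_fiber P Q hc h1 y b).1 hy⟩

theorem key (P Q : ℂ[X]) (hc : IsCoprime P Q) (h1 : 1 ≤ max P.natDegree Q.natDegree) :
    ∃ A : ℝ, 1 ≤ A ∧ ∀ y b : Sphere, sprod y (fiber P Q b) ≤ A * sphDist (ratEval P Q y) b ∧
      sphDist (ratEval P Q y) b ≤ A * sprod y (fiber P Q b) := by
  obtain ⟨l, u, hl, hu, H⟩ := key_pre P Q hc h1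
  set d := max P.natDegree Q.natDegree
  obtain ⟨r, hr, _, hfar⟩ := exists_far d
  obtain ⟨y0, hy0⟩ := exists_pre P Q hc h1 ((0 : ℂ) : Sphere)
  obtain ⟨y1, hy1⟩ := exists_pre P Q hc h1 (OnePoint.infty : Sphere)
  have h01 : sphDist ((0 : ℂ) : Sphere) OnePoint.infty = 2 := by rw [sph_ci]; simp
  have Cu : ∀ b C, 0 < C → (∀ y : Sphere, C * sprod y (fiber P Q b) ≤ u * sphDist (ratEval P Q y) b) →
      C ≤ 2 * u / r ^ d := by
    intro b C hC h
    obtain ⟨y, hy⟩ := hfar (fiber P Q b) (fiber_card P Q b).le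
    have h2 := sprod_ge y _ r hr.le hy
    rw [fiber_card] at h2
    rw [le_div_iff₀ (by positivity)]
    have h3 := h y
    have h4 := sph_le_two (ratEval P Q y) b
    calc C * r ^ d ≤ C * sprod y (fiber P Q b) := by gcongr
      _ ≤ _ := h3
      _ ≤ 2 * u := by nlinarith
  have Cl : ∀ b C, 0 < C → (∀ y : Sphere, l * sphDist (ratEval P Q y) b ≤ C * sprod y (fiber P Q b)) →
      l / 2 ^ d ≤ C := by
    intro b C hC h
    obtain ⟨y, hy⟩ : ∃ y, 1 ≤ sphDist (ratEval P Q y) b := by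
      by_contra! hcon
      have e0 := hcon y0
      have e1 := hcon y1
      rw [hy0, sph_comm] at e0
      rw [hy1, sph_comm] at e1
      have := sph_tri ((0 : ℂ) : Sphere) b OnePoint.infty
      rw [sph_comm _ b] at this
      linarith
    have h2 := sprod_le y (fiber P Q b)
    rw [fiber_card] at h2
    rw [div_le_iff₀ (by positivity)]
    have h3 := h y
    calc l ≤ l * sphDist (ratEval P Q y) b := by nlinarith
      _ ≤ _ := h3
      _ ≤ C * 2 ^ d := by gcongr
  set c1 := 2 * u / r ^ d
  set c2 := l / 2 ^ d
  have hc1 : 0 < c1 := by positivity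
  have hc2 : 0 < c2 := by positivity
  refine ⟨max 1 (max (u / c2) (c1 / l)), le_max_left _ _, fun y b => ?_⟩
  obtain ⟨C, hC, h⟩ := H b
  have g1 := Cu b C hC fun y => (h y).2
  have g2 := Cl b C hC fun y => (h y).1
  have e1 := sprod_nonneg y (fiber P Q b)
  have e2 := sph_nonneg (ratEval P Q y) b
  obtain ⟨h2, h3⟩ := h y
  constructor
  · calc sprod y (fiber P Q b) ≤ u / c2 * sphDist (ratEval P Q y) b := by
          rw [div_mul_eq_mul_div, le_div_iff₀ hc2]; nlinarith
      _ ≤ _ := mul_le_mul_of_nonneg_right ((le_max_left _ _).trans (le_max_right _ _)) e2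
  · calc sphDist (ratEval P Q y) b ≤ c1 / l * sprod y (fiber P Q b) := by
          rw [div_mul_eq_mul_div, le_div_iff₀ hl]; nlinarith
      _ ≤ _ := mul_le_mul_of_nonneg_right ((le_max_right _ _).trans (le_max_right _ _)) e1

lemma sprod_cons (y a : Sphere) (s : Multiset Sphere) : sprod y (a ::ₘ s) = sphDist y a * sprod y s := by
  simp [sprod]

lemma sprod_cont (s : Multiset Sphere) : Continuous fun y => sprod y s := by
  induction s using Multiset.induction_on with
  | empty => simp [sprod]; exact continuous_const
  | cons a s ih =>
    simp only [sprod_cons]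
    exact (sph_cont.comp (continuous_id.prodMk continuous_const)).mul ih

lemma sphere_neBot (a : Sphere) : (𝓝[≠] a).NeBot := by
  induction a using OnePoint.rec with
  | infty => infer_instance
  | coe a => infer_instance

lemma sprod_inj (B : ℝ) (M1 M2 : Multiset Sphere) (h12 : ∀ y, sprod y M1 ≤ B * sprod y M2)
    (h21 : ∀ y, sprod y M2 ≤ B * sprod y M1) : M1 = M2 := by
  induction M1 using Multiset.induction_on generalizing M2 with
  | empty =>
    by_contra hne
    obtain ⟨a, ha⟩ := Multiset.exists_mem_of_ne_zero (Ne.symm hne)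
    have := h12 a
    rw [sprod_eq_zero.2 ha] at this
    simp [sprod] at this
    linarith
  | cons a s ih =>
    have ha : a ∈ M2 := by
      rw [← sprod_eq_zero]
      refine le_antisymm ?_ (sprod_nonneg _ _)
      have := h21 a
      rwa [sprod_cons, sph_self, zero_mul, mul_zero] at this
    obtain ⟨t, rfl⟩ := Multiset.exists_cons_of_mem ha
    have gen : ∀ s t : Multiset Sphere, (∀ y, sprod y (a ::ₘ s) ≤ B * sprod y (a ::ₘ t)) →
        ∀ y, sprod y s ≤ B * sprod y t := by
      intro s t h y
      have off : ∀ y, y ≠ a → sprod y s ≤ B * sprod y t := by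
        intro y hy
        have h2 := h y
        rw [sprod_cons, sprod_cons] at h2
        refine le_of_mul_le_mul_left ?_ (sph_pos hy)
        linarith
      by_cases hy : y = a
      · subst hy
        have := sphere_neBot y
        refine le_of_tendsto_of_tendsto (f := fun z => sprod z s) (g := fun z => B * sprod z t) (b := 𝓝[≠] y)
          (((sprod_cont s).tendsto y).mono_left nhdsWithin_le_nhds)
          (((continuous_const.mul (sprod_cont t)).tendsto y).mono_left nhdsWithin_le_nhds) ?_
        filter_upwards [self_mem_nhdsWithin] with z hz using off z hz
      · exact off y hy
    rw [ih t (gen s t h12) (gen t s h21)]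

/-- enumerations of fibers pass to the limit -/
lemma fiber_lim (P Q : ℂ[X]) (hc : IsCoprime P Q) (h1 : 1 ≤ max P.natDegree Q.natDegree)
    {ι κ : Type*} [Fintype κ] (F : Filter ι) [F.NeBot] (η : ι → κ → Sphere) (b : ι → Sphere)
    (η0 : κ → Sphere) (b0 : Sphere)
    (h : ∀ᶠ t in F, Finset.univ.val.map (η t) = fiber P Q (b t))
    (hb : Tendsto b F (𝓝 b0)) (hη : ∀ j, Tendsto (fun t => η t j) F (𝓝 (η0 j))) :
    Finset.univ.val.map η0 = fiber P Q b0 := by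
  obtain ⟨A, hA, H⟩ := key P Q hc h1
  have e : ∀ (η : κ → Sphere) y, sprod y (Finset.univ.val.map η) = ∏ j, sphDist y (η j) := by
    intro η y
    rw [sprod, Multiset.map_map]; rfl
  have lim1 : ∀ y, Tendsto (fun t => sprod y (Finset.univ.val.map (η t))) F
      (𝓝 (sprod y (Finset.univ.val.map η0))) := by
    intro y
    rw [e, funext fun t => e (η t) y]
    refine tendsto_finsetProd _ fun j _ => ?_
    exact ((sph_cont.comp (continuous_const.prodMk continuous_id)).tendsto (η0 j)).comp (hη j)
  have lim2 : ∀ y, Tendsto (fun t => sphDist (ratEval P Q y) (b t)) F (𝓝 (sphDist (ratEval P Q y) b0)) := by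
    intro y
    exact ((sph_cont.comp (continuous_const.prodMk continuous_id)).tendsto b0).comp hb
  have i1 : ∀ y, sprod y (Finset.univ.val.map η0) ≤ A * sphDist (ratEval P Q y) b0 := by
    intro y
    refine le_of_tendsto_of_tendsto (lim1 y) ((lim2 y).const_mul A) ?_
    filter_upwards [h] with t ht
    rw [ht]; exact (H y _).1
  have i2 : ∀ y, sphDist (ratEval P Q y) b0 ≤ A * sprod y (Finset.univ.val.map η0) := by
    intro y
    refine le_of_tendsto_of_tendsto (lim2 y) ((lim1 y).const_mul A) ?_
    filter_upwards [h] with t ht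
    rw [ht]; exact (H y _).2
  refine sprod_inj (A * A) _ _ (fun y => ?_) fun y => ?_
  · refine (i1 y).trans ?_
    rw [mul_assoc]
    exact mul_le_mul_of_nonneg_left (H y b0).2 (by linarith)
  · refine ((H y b0).1).trans ?_
    rw [mul_assoc]
    exact mul_le_mul_of_nonneg_left (i2 y) (by linarith)

lemma sprod_erase (y a : Sphere) (s : Multiset Sphere) (h : a ∈ s) :
    sprod y s = sphDist y a * sprod y (s.erase a) := by
  rw [← sprod_cons, Multiset.cons_erase h]

lemma rat_lip (P Q : ℂ[X]) (hc : IsCoprime P Q) (h1 : 1 ≤ max P.natDegree Q.natDegree) :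
    ∃ L : ℝ, 0 < L ∧ ∀ y z, sphDist (ratEval P Q y) (ratEval P Q z) ≤ L * sphDist y z := by
  obtain ⟨A, hA, H⟩ := key P Q hc h1
  refine ⟨A * 2 ^ (max P.natDegree Q.natDegree), by positivity, fun y z => ?_⟩
  refine (H y _).2.trans ?_
  have hz : z ∈ fiber P Q (ratEval P Q z) := (mem_fiber P Q hc h1 _ _).2 rfl
  rw [sprod_erase y z _ hz, mul_assoc, mul_comm (2 ^ _)]
  have h2 := sprod_le y ((fiber P Q (ratEval P Q z)).erase z)
  have h3 : (2 : ℝ) ^ ((fiber P Q (ratEval P Q z)).erase z).card ≤ 2 ^ (max P.natDegree Q.natDegree) := by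
    refine pow_le_pow_right₀ (by norm_num) ?_
    rw [← fiber_card P Q (ratEval P Q z)]
    exact Multiset.card_le_card (Multiset.erase_le _ _)
  have := sph_nonneg y z
  have h4 := h2.trans h3
  gcongr

lemma rat_cont (P Q : ℂ[X]) (hc : IsCoprime P Q) (h1 : 1 ≤ max P.natDegree Q.natDegree) :
    Continuous (ratEval P Q) := by
  obtain ⟨L, hL, H⟩ := rat_lip P Q hc h1
  rw [continuous_iff_continuousAt]
  intro z
  rw [ContinuousAt, sph_tendsto]
  refine squeeze_zero (fun y => sph_nonneg _ _) (fun y => H y z) ?_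
  have : Tendsto (fun y => sphDist y z) (𝓝 z) (𝓝 0) := sph_tendsto.1 tendsto_id
  simpa using this.const_mul L

lemma sph_nhds {z : Sphere} {U : Set Sphere} : U ∈ 𝓝 z ↔ ∃ r > 0, ∀ y, sphDist y z < r → y ∈ U := by
  have hb : (𝓝 z) = Filter.comap (fun y => sphDist y z) (𝓝 0) := by
    refine le_antisymm ?_ ?_
    · exact Filter.tendsto_iff_comap.1 (sph_tendsto.1 (tendsto_id (α := Sphere)))
    · exact (sph_tendsto (u := id) (F := Filter.comap (fun y => sphDist y z) (𝓝 0))).2 tendsto_comap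
  rw [hb, ((Metric.nhds_basis_ball (x := (0:ℝ))).comap _).mem_iff]
  constructor
  · rintro ⟨r, hr, h⟩
    refine ⟨r, hr, fun y hy => h ?_⟩
    simp only [Set.mem_preimage, Metric.mem_ball, dist_zero_right, Real.norm_eq_abs, abs_of_nonneg (sph_nonneg _ _)]
    exact hy
  · rintro ⟨r, hr, h⟩
    refine ⟨r, hr, fun y hy => h y ?_⟩
    simpa only [Set.mem_preimage, Metric.mem_ball, dist_zero_right, Real.norm_eq_abs, abs_of_nonneg (sph_nonneg _ _)] using hy

/-- openness: points near `R y` have preimages near `y` -/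
lemma rat_open (P Q : ℂ[X]) (hc : IsCoprime P Q) (h1 : 1 ≤ max P.natDegree Q.natDegree)
    (y : Sphere) (r : ℝ) (hr : 0 < r) : ∃ s > 0, ∀ b, sphDist (ratEval P Q y) b < s →
      ∃ η, ratEval P Q η = b ∧ sphDist y η < r := by
  obtain ⟨A, hA, H⟩ := key P Q hc h1
  have hA0 : 0 < A := by linarith
  refine ⟨r ^ (max P.natDegree Q.natDegree) / A, by positivity, fun b hb => ?_⟩
  by_contra! hcon
  have h2 := sprod_ge y (fiber P Q b) r hr.le fun η hη => hcon η ((mem_fiber P Q hc h1 _ _).1 hη)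
  rw [fiber_card] at h2
  have h3 := (H y b).1
  rw [lt_div_iff₀ hA0] at hb
  linarith

/-! ## Part C : backward invariance of the Julia set -/

lemma consW_zero {N : ℕ} (v : Fin N) (w : ℕ → Fin N) : consW v w 0 = v := rfl
lemma consW_succ {N : ℕ} (v : Fin N) (w : ℕ → Fin N) (n : ℕ) : consW v w (n + 1) = w n := rfl
lemma shiftW_consW {N : ℕ} (v : Fin N) (w : ℕ → Fin N) : shiftW (consW v w) = w := rfl
lemma consW_cont {N : ℕ} (v : Fin N) : Continuous (consW v) := by
  refine continuous_pi fun n => ?_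
  cases n with
  | zero => simp only [consW_zero]; exact continuous_const
  | succ n => simp only [consW_succ]; exact continuous_apply n

lemma itComp_consW {N : ℕ} (p q : Fin N → ℂ[X]) (v : Fin N) (w : ℕ → Fin N) (n : ℕ) :
    itComp p q (consW v w) (n + 1) = itComp p q w n ∘ ratEval (p v) (q v) := by
  induction n with
  | zero => rfl
  | succ n ih =>
    rw [itComp, ih, consW_succ]; rfl

lemma Good.cop {N : ℕ} {p q : Fin N → ℂ[X]} (hg : Good p q) (i : Fin N) : IsCoprime (p i) (q i) := hg.2.1 i
lemma Good.deg {N : ℕ} {p q : Fin N → ℂ[X]} (hg : Good p q) (i : Fin N) :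
    1 ≤ max (p i).natDegree (q i).natDegree := hg.2.2.1 i

lemma fatou_push {N : ℕ} (p q : Fin N → ℂ[X]) (hg : Good p q) (v : Fin N) (w : ℕ → Fin N) (z : Sphere)
    (h : z ∈ fatouW p q (consW v w)) : ratEval (p v) (q v) z ∈ fatouW p q w := by
  obtain ⟨U, hU, hzU, hN⟩ := h
  obtain ⟨r, hr, hball⟩ := sph_nhds.1 (hU.mem_nhds hzU)
  obtain ⟨s, hs, hop⟩ := rat_open (p v) (q v) (hg.cop v) (hg.deg v) z (r / 2) (by positivity)
  set R := ratEval (p v) (q v)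
  have hcz : ∀ a, Continuous fun b => sphDist a b := fun a => sph_cont.comp (continuous_const.prodMk continuous_id)
  refine ⟨{b | sphDist (R z) b < s}, isOpen_lt (hcz _) continuous_const, by simpa [sph_self] using hs, ?_⟩
  let K0 : Set Sphere := {η | sphDist z η ≤ r / 2}
  have hK0 : IsCompact K0 := (isClosed_le (hcz z) continuous_const).isCompact
  have hK0U : K0 ⊆ U := by
    intro η hη
    apply hball
    rw [sph_comm]
    have : sphDist z η ≤ r / 2 := hη
    linarith
  let e : Sphere → Sphere := fun b => if hb : sphDist (R z) b < s then (hop b hb).choose else b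
  intro S hS
  choose m hm1 hm2 using hS
  obtain ⟨φ, hφ, g, hgc⟩ := hN (fun n => itComp p q (consW v w) (m n + 1)) (fun n => ⟨m n + 1, by omega, rfl⟩)
  refine ⟨φ, hφ, fun b => g (e b), fun K hK hKc ε hε => ?_⟩
  filter_upwards [hgc K0 hK0U hK0 ε hε] with n hn b hb
  have hb' : sphDist (R z) b < s := hK hb
  have he : e b = (hop b hb').choose := dif_pos hb'
  have h1 : R (e b) = b := by rw [he]; exact (hop b hb').choose_spec.1
  have h2 : sphDist z (e b) < r / 2 := by rw [he]; exact (hop b hb').choose_spec.2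
  have h3 := hn (e b) h2.le
  rw [itComp_consW, Function.comp, show ratEval (p v) (q v) (e b) = b from h1] at h3
  rw [hm2]
  exact h3

lemma julia_closed {N : ℕ} (p q : Fin N → ℂ[X]) : IsClosed (juliaSet p q) := isClosed_closure

lemma mem_preimT {N : ℕ} (p q : Fin N → ℂ[X]) (hg : Good p q) (x y : SymX N) :
    y ∈ preimT p q x ↔ Tmap p q y = x := by
  simp only [preimT, Multiset.mem_sum, Multiset.mem_map, Finset.mem_univ, true_and]
  constructor
  · rintro ⟨v, z, hz, rfl⟩
    rw [mem_fiber _ _ (hg.cop v) (hg.deg v)] at hz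
    simp only [Tmap, consW_zero, shiftW_consW]
    rw [hz]
  · intro h
    refine ⟨y.1 0, y.2, ?_, ?_⟩
    · rw [mem_fiber _ _ (hg.cop _) (hg.deg _), ← h]; rfl
    · rw [← h]
      refine Prod.ext ?_ rfl
      funext n
      cases n <;> rfl

lemma julia_back {N : ℕ} (p q : Fin N → ℂ[X]) (hg : Good p q) (y : SymX N)
    (h : Tmap p q y ∈ juliaSet p q) : y ∈ juliaSet p q := by
  obtain ⟨w, z⟩ := y
  rw [juliaSet, mem_closure_iff_nhds]
  intro t ht
  rw [nhds_prod_eq, Filter.mem_prod_iff] at ht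
  obtain ⟨t1, ht1, t2, ht2, hsub⟩ := ht
  obtain ⟨r, hr, hball⟩ := sph_nhds.1 ht2
  set v := w 0 with hv
  have hw : consW v (shiftW w) = w := by funext n; cases n <;> rfl
  obtain ⟨s, hs, hop⟩ := rat_open (p v) (q v) (hg.cop v) (hg.deg v) z r hr
  have hT : Tmap p q (w, z) = (shiftW w, ratEval (p v) (q v) z) := rfl
  rw [hT, juliaSet, mem_closure_iff_nhds] at h
  have n1 : {x' : SymX N | consW v x'.1 ∈ t1 ∧ sphDist (ratEval (p v) (q v) z) x'.2 < s} ∈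
      𝓝 ((shiftW w, ratEval (p v) (q v) z) : SymX N) := by
    refine Filter.inter_mem ?_ ?_
    · have : Continuous fun x' : SymX N => consW v x'.1 := (consW_cont v).comp continuous_fst
      refine this.continuousAt.preimage_mem_nhds ?_
      simpa only [hw] using ht1
    · have : Continuous fun x' : SymX N => sphDist (ratEval (p v) (q v) z) x'.2 :=
        sph_cont.comp (continuous_const.prodMk continuous_snd)
      refine (isOpen_lt this continuous_const).mem_nhds ?_
      simpa [sph_self] using hs
  obtain ⟨⟨w', b⟩, ⟨hx1, hx2⟩, hx3⟩ := h _ n1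
  simp only [Set.mem_iUnion, Set.mem_prod, Set.mem_singleton_iff] at hx3
  obtain ⟨_, rfl, hb⟩ := hx3
  obtain ⟨η, hη, hη2⟩ := hop b hx2
  refine ⟨(consW v w', η), hsub ⟨hx1, hball η (by rw [sph_comm]; exact hη2)⟩, ?_⟩
  simp only [Set.mem_iUnion, Set.mem_prod, Set.mem_singleton_iff]
  refine ⟨_, rfl, fun hF => hb ?_⟩
  have := fatou_push p q hg v w' η hF
  rwa [hη] at this

lemma preimT_julia {N : ℕ} (p q : Fin N → ℂ[X]) (hg : Good p q) (x y : SymX N) (hx : x ∈ juliaSet p q)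
    (h : y ∈ preimT p q x) : y ∈ juliaSet p q :=
  julia_back p q hg y (by rwa [(mem_preimT p q hg x y).1 h])

/-! ## Part D : trees of preimages -/

/-- labels of inverse branches -/
abbrev IX {N : ℕ} (p q : Fin N → ℂ[X]) : Type := (i : Fin N) × Fin (degR p q i)

/-- lists of length `k` -/
def lev (α : Type) [Fintype α] : ℕ → Finset (List α)
  | 0 => {[]}
  | k + 1 => (lev α k).biUnion fun l => Finset.univ.image fun a => a :: l

lemma mem_lev {α : Type} [Fintype α] (k : ℕ) (l : List α) : l ∈ lev α k ↔ l.length = k := by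
  induction k generalizing l with
  | zero => simp [lev]
  | succ k ih =>
    simp only [lev, Finset.mem_biUnion, Finset.mem_image, Finset.mem_univ, true_and, ih]
    constructor
    · rintro ⟨l', rfl, a, rfl⟩; rfl
    · intro h
      cases l with
      | nil => simp at h
      | cons a l => exact ⟨l, by simpa using h, a, rfl⟩

lemma sum_lev_succ {α : Type} [Fintype α] {M : Type*} [AddCommMonoid M] (k : ℕ) (g : List α → M) :
    ∑ l ∈ lev α (k + 1), g l = ∑ l ∈ lev α k, ∑ a, g (a :: l) := by
  rw [lev, Finset.sum_biUnion]
  · refine Finset.sum_congr rfl fun l _ => ?_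
    rw [Finset.sum_image]
    intro a _ b _ h
    exact (List.cons.inj h).1
  · intro l _ l' _ hne
    rw [Function.onFun, Finset.disjoint_left]
    simp only [Finset.mem_image, Finset.mem_univ, true_and]
    rintro _ ⟨a, rfl⟩ ⟨b, hb⟩
    exact hne (List.cons.inj hb).2.symm

lemma sum_lev_zero {α : Type} [Fintype α] {M : Type*} [AddCommMonoid M] (g : List α → M) :
    ∑ l ∈ lev α 0, g l = g [] := by simp [lev]

lemma card_lev {α : Type} [Fintype α] (k : ℕ) : (lev α k).card = Fintype.card α ^ k := by
  induction k with
  | zero => simp [lev]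
  | succ k ih =>
    have h := sum_lev_succ (α := α) (M := ℕ) k fun _ => 1
    simp only [Finset.sum_const, smul_eq_mul, mul_one, ih, Finset.card_univ] at h
    rw [h, pow_succ]

/-- `y` enumerates all iterated preimages of `z` -/
def IsTree {N : ℕ} (p q : Fin N → ℂ[X]) (z : Sphere) (y : List (IX p q) → Sphere) : Prop :=
  y [] = z ∧ ∀ l i, (Finset.univ : Finset (Fin (degR p q i))).val.map (fun j => y (⟨i, j⟩ :: l)) =
    fiber (p i) (q i) (y l)

/-- word of a node -/
def wd {N : ℕ} {p q : Fin N → ℂ[X]} (w : ℕ → Fin N) : List (IX p q) → (ℕ → Fin N)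
  | [] => w
  | a :: l => consW a.1 (wd w l)

/-- the node -/
def nd {N : ℕ} {p q : Fin N → ℂ[X]} (w : ℕ → Fin N) (y : List (IX p q) → Sphere) (l : List (IX p q)) : SymX N :=
  (wd w l, y l)

lemma tree_rat {N : ℕ} {p q : Fin N → ℂ[X]} (hg : Good p q) {z : Sphere} {y : List (IX p q) → Sphere}
    (h : IsTree p q z y) (a : IX p q) (l : List (IX p q)) : ratEval (p a.1) (q a.1) (y (a :: l)) = y l := by
  rw [← mem_fiber _ _ (hg.cop _) (hg.deg _), ← h.2 l a.1, Multiset.mem_map]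
  exact ⟨a.2, Multiset.mem_coe.2 (List.mem_finRange _), rfl⟩

lemma nd_T {N : ℕ} {p q : Fin N → ℂ[X]} (hg : Good p q) {z : Sphere} {y : List (IX p q) → Sphere}
    (h : IsTree p q z y) (w : ℕ → Fin N) (a : IX p q) (l : List (IX p q)) :
    Tmap p q (nd w y (a :: l)) = nd w y l := by
  simp only [Tmap, nd, wd, consW_zero, shiftW_consW]
  rw [tree_rat hg h]

lemma nd_julia {N : ℕ} {p q : Fin N → ℂ[X]} (hg : Good p q) {x : SymX N} (hx : x ∈ juliaSet p q)
    {y : List (IX p q) → Sphere}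
    (h : IsTree p q x.2 y) (l : List (IX p q)) : nd x.1 y l ∈ juliaSet p q := by
  induction l with
  | nil => simp only [nd, wd, h.1]; exact hx
  | cons a l ih => exact julia_back p q hg _ (by rwa [nd_T hg h])

lemma preimT_sum {N : ℕ} {p q : Fin N → ℂ[X]} {z : Sphere} {y : List (IX p q) → Sphere}
    (h : IsTree p q z y) (w : ℕ → Fin N) (l : List (IX p q)) (g : SymX N → ℝ) :
    ((preimT p q (nd w y l)).map g).sum = ∑ a : IX p q, g (nd w y (a :: l)) := by
  rw [Fintype.sum_sigma, preimT, ← Multiset.coe_mapAddMonoidHom, map_sum, Multiset.sum_sum]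
  refine Finset.sum_congr rfl fun i _ => ?_
  simp only [nd]
  rw [← h.2 l i, Multiset.coe_mapAddMonoidHom, Multiset.map_map, Multiset.map_map]
  rfl

lemma preimT_card {N : ℕ} {p q : Fin N → ℂ[X]} (x : SymX N) : (preimT p q x).card = Dtot p q := by
  rw [preimT, Multiset.card_sum]
  simp only [Multiset.card_map, fiber_card]
  rfl

lemma preimTn_mem {N : ℕ} {p q : Fin N → ℂ[X]} (hg : Good p q) (n : ℕ) (x y : SymX N)
    (h : y ∈ preimTn p q n x) : (Tmap p q)^[n] y = x := by
  induction n generalizing x with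
  | zero => simpa [preimTn] using h
  | succ n ih =>
    simp only [preimTn, Multiset.mem_bind] at h
    obtain ⟨y1, h1, h2⟩ := h
    rw [Function.iterate_succ_apply', ih y1 h2]
    exact (mem_preimT p q hg _ _).1 h1

lemma julia_back_iter {N : ℕ} {p q : Fin N → ℂ[X]} (hg : Good p q) (n : ℕ) (y : SymX N)
    (h : (Tmap p q)^[n] y ∈ juliaSet p q) : y ∈ juliaSet p q := by
  induction n generalizing y with
  | zero => exact h
  | succ n ih => exact julia_back p q hg y (ih _ (by rwa [Function.iterate_succ_apply] at h))

lemma preimTn_orbit {N : ℕ} {p q : Fin N → ℂ[X]} (hg : Good p q) (n : ℕ) (x y : SymX N)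
    (hx : x ∈ juliaSet p q) (h : y ∈ preimTn p q n x) (k : ℕ) (hk : k ≤ n) :
    (Tmap p q)^[k] y ∈ juliaSet p q := by
  have h1 := preimTn_mem hg n x y h
  refine julia_back_iter hg (n - k) _ ?_
  rw [← Function.iterate_add_apply, Nat.sub_add_cancel hk, h1]
  exact hx

lemma birk_succ {N : ℕ} (p q : Fin N → ℂ[X]) (f : SymX N → ℝ) (n : ℕ) (y : SymX N) :
    birk p q f (n + 1) y = birk p q f n y + f ((Tmap p q)^[n] y) := by
  rw [birk, birk, Finset.sum_range_succ]

lemma LSum_zero {N : ℕ} (p q : Fin N → ℂ[X]) (f : SymX N → ℝ) (x : SymX N) : LSum p q f 0 x = 1 := by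
  simp [LSum, preimTn, birk]

lemma LSum_succ {N : ℕ} {p q : Fin N → ℂ[X]} (hg : Good p q) (f : SymX N → ℝ) (n : ℕ) (x : SymX N) :
    LSum p q f (n + 1) x = ((preimT p q x).map fun y => Real.exp (f y) * LSum p q f n y).sum := by
  rw [LSum, preimTn, Multiset.map_bind, Multiset.sum_bind]
  congr 1
  refine Multiset.map_congr rfl fun y _ => ?_
  rw [LSum, ← Multiset.sum_map_mul_left]
  congr 1
  refine Multiset.map_congr rfl fun y' hy' => ?_
  rw [birk_succ, preimTn_mem hg n y y' hy', Real.exp_add, mul_comm]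

lemma LSum_nd {N : ℕ} {p q : Fin N → ℂ[X]} (hg : Good p q) {z : Sphere} {y : List (IX p q) → Sphere}
    (h : IsTree p q z y) (w : ℕ → Fin N) (f : SymX N → ℝ) (n : ℕ) (l : List (IX p q)) :
    LSum p q f (n + 1) (nd w y l) =
      ∑ a : IX p q, Real.exp (f (nd w y (a :: l))) * LSum p q f n (nd w y (a :: l)) := by
  rw [LSum_succ hg, preimT_sum h]

lemma LSum_nonneg {N : ℕ} (p q : Fin N → ℂ[X]) (f : SymX N → ℝ) (n : ℕ) (x : SymX N) : 0 ≤ LSum p q f n x := by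
  refine Multiset.sum_nonneg ?_
  simp only [Multiset.mem_map]
  rintro _ ⟨y, _, rfl⟩
  positivity

lemma LSum_bounds {N : ℕ} {p q : Fin N → ℂ[X]} (hg : Good p q) (f : SymX N → ℝ) (a b : ℝ)
    (hf : ∀ x ∈ juliaSet p q, a ≤ f x ∧ f x ≤ b) (n : ℕ) (x : SymX N) (hx : x ∈ juliaSet p q) :
    (Dtot p q * Real.exp a) ^ n ≤ LSum p q f n x ∧ LSum p q f n x ≤ (Dtot p q * Real.exp b) ^ n := by
  induction n generalizing x with
  | zero => simp [LSum_zero]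
  | succ n ih =>
    rw [LSum_succ hg]
    have hmem : ∀ y ∈ preimT p q x, y ∈ juliaSet p q := fun y hy => preimT_julia p q hg x y hx hy
    constructor
    · have : ∀ t ∈ ((preimT p q x).map fun y => Real.exp (f y) * LSum p q f n y),
          Real.exp a * (Dtot p q * Real.exp a) ^ n ≤ t := by
        simp only [Multiset.mem_map]
        rintro _ ⟨y, hy, rfl⟩
        have h1 := hmem y hy
        have := (hf y h1).1
        exact mul_le_mul (Real.exp_le_exp.2 this) (ih y h1).1 (by positivity) (by positivity)
      have h2 := Multiset.card_nsmul_le_sum this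
      rw [Multiset.card_map, preimT_card, nsmul_eq_mul] at h2
      rw [pow_succ]; linarith
    · have : ∀ t ∈ ((preimT p q x).map fun y => Real.exp (f y) * LSum p q f n y),
          t ≤ Real.exp b * (Dtot p q * Real.exp b) ^ n := by
        simp only [Multiset.mem_map]
        rintro _ ⟨y, hy, rfl⟩
        have h1 := hmem y hy
        have := (hf y h1).2
        exact mul_le_mul (Real.exp_le_exp.2 this) (ih y h1).2 (LSum_nonneg _ _ _ _ _) (by positivity)
      have h2 := Multiset.sum_le_card_nsmul _ _ this
      rw [Multiset.card_map, preimT_card, nsmul_eq_mul] at h2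
      rw [pow_succ]; linarith

lemma Dtot_pos {N : ℕ} {p q : Fin N → ℂ[X]} (hg : Good p q) : 1 ≤ Dtot p q := by
  obtain ⟨h1, _, h3, _⟩ := hg
  have := Finset.single_le_sum (f := fun i => degR p q i) (s := Finset.univ) (fun i _ => Nat.zero_le _)
    (Finset.mem_univ (⟨0, h1⟩ : Fin N))
  exact (h3 _).trans this

lemma LSum_pos {N : ℕ} {p q : Fin N → ℂ[X]} (hg : Good p q) (f : SymX N → ℝ) (a b : ℝ)
    (hf : ∀ x ∈ juliaSet p q, a ≤ f x ∧ f x ≤ b) (n : ℕ) (x : SymX N) (hx : x ∈ juliaSet p q) :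
    0 < LSum p q f n x := by
  have h := (LSum_bounds hg f a b hf n x hx).1
  have := Dtot_pos hg
  have h2 : (0 : ℝ) < Dtot p q := by exact_mod_cast this
  exact lt_of_lt_of_le (by positivity) h

/-- every point has a tree -/
lemma exists_tree {N : ℕ} (p q : Fin N → ℂ[X]) (z : Sphere) : ∃ y, IsTree p q z y := by
  have hfib : ∀ (i : Fin N) (b : Sphere), ∃ e : Fin (degR p q i) → Sphere,
      (Finset.univ : Finset (Fin (degR p q i))).val.map e = fiber (p i) (q i) b := by
    intro i b
    have hc : (fiber (p i) (q i) b).toList.length = degR p q i := by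
      rw [Multiset.length_toList, fiber_card]; rfl
    refine ⟨fun j => (fiber (p i) (q i) b).toList.get (Fin.cast hc.symm j), ?_⟩
    conv_rhs => rw [← Multiset.coe_toList (fiber (p i) (q i) b)]
    have : (Finset.univ : Finset (Fin (degR p q i))).val = (List.finRange (degR p q i) : Multiset _) := rfl
    rw [this, Multiset.map_coe, Multiset.coe_eq_coe]
    refine List.Perm.of_eq ?_
    refine List.ext_get (by simp [hc]) fun n h1 h2 => ?_
    simp
  choose e he using hfib
  let y : List (IX p q) → Sphere := fun l => List.rec z (fun a _ r => e a.1 r a.2) l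
  exact ⟨y, rfl, fun l i => he i (y l)⟩

/-! ## Part E : critical points are rarely visited by backward orbits -/

/-- finite set containing the critical points -/
def critF {N : ℕ} (p q : Fin N → ℂ[X]) (i : Fin N) : Finset ℂ := (Polynomial.wronskian (p i) (q i)).roots.toFinset

lemma wronsk_ne (P Q : ℂ[X]) (hc : IsCoprime P Q) (h1 : 1 ≤ max P.natDegree Q.natDegree) :
    Polynomial.wronskian P Q ≠ 0 := by
  intro h
  rw [hc.wronskian_eq_zero_iff] at h
  have hP := Polynomial.natDegree_eq_zero_of_derivative_eq_zero h.1
  have hQ := Polynomial.natDegree_eq_zero_of_derivative_eq_zero h.2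
  omega

lemma crit_root (P Q : ℂ[X]) (hc : IsCoprime P Q) (h1 : 1 ≤ max P.natDegree Q.natDegree) (c : ℂ)
    (h : 2 ≤ (fiber P Q (ratEval P Q c)).count (c : Sphere)) :
    c ∈ (Polynomial.wronskian P Q).roots := by
  rw [Polynomial.mem_roots (wronsk_ne P Q hc h1), Polynomial.IsRoot, Polynomial.wronskian]
  have hF := Fb_ne P Q hc h1 (ratEval P Q c)
  rw [fiber_Fb, Multiset.count_add, Multiset.count_replicate, if_neg (by simp), add_zero,
    Multiset.count_map_eq_count' _ _ OnePoint.coe_injective, Polynomial.count_roots] at h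
  have hr : (Fb P Q (ratEval P Q c)).eval c = 0 := by
    have : (Fb P Q (ratEval P Q c)).IsRoot c := (Polynomial.rootMultiplicity_pos hF).1 (by omega)
    exact this
  have hd : (derivative (Fb P Q (ratEval P Q c))).eval c = 0 :=
    ((Polynomial.one_lt_rootMultiplicity_iff_isRoot hF).1 h).2
  rw [rat_c] at hr hd
  split_ifs at hr hd with h0
  · rw [Fb_i] at hd
    simp [h0, hd]
  · rw [Fb_c] at hd
    simp only [derivative_sub, derivative_mul, derivative_C, zero_mul, zero_add, eval_sub, eval_mul, eval_C] at hd ⊢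
    field_simp at hd
    linear_combination -hd

/-- the point is close to another point of its fibre -/
def NearCrit {N : ℕ} (p q : Fin N → ℂ[X]) (s : ℝ) (x : SymX N) : Prop :=
  ∃ η ∈ (fiber (p (x.1 0)) (q (x.1 0)) (ratEval (p (x.1 0)) (q (x.1 0)) x.2)).erase x.2, sphDist x.2 η < s

lemma T_iter {N : ℕ} (p q : Fin N → ℂ[X]) (n : ℕ) (x : SymX N) :
    (Tmap p q)^[n] x = (fun j => x.1 (j + n), itComp p q x.1 n x.2) := by
  induction n with
  | zero => rfl
  | succ n ih =>
    rw [Function.iterate_succ_apply', ih]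
    simp only [Tmap, itComp, Function.comp, zero_add]
    refine Prod.ext ?_ rfl
    funext j
    simp only [shiftW]
    congr 1; ring

lemma itComp_congr {N : ℕ} (p q : Fin N → ℂ[X]) (n : ℕ) (w w' : ℕ → Fin N) (h : ∀ j < n, w j = w' j) :
    itComp p q w n = itComp p q w' n := by
  induction n with
  | zero => rfl
  | succ n ih => rw [itComp, itComp, ih fun j hj => h j (by omega), h n (by omega)]

lemma Tmap_cont {N : ℕ} {p q : Fin N → ℂ[X]} (hg : Good p q) : Continuous (Tmap p q) := by
  have h : Continuous fun y : (Fin N) × Sphere => ratEval (p y.1) (q y.1) y.2 := by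
    rw [continuous_prod_of_discrete_left]
    exact fun i => rat_cont _ _ (hg.cop i) (hg.deg i)
  refine Continuous.prodMk (continuous_pi fun n => (continuous_apply (n+1)).comp continuous_fst) ?_
  have h2 : Continuous fun x : SymX N => ((x.1 0, x.2) : Fin N × Sphere) :=
    ((continuous_apply 0).comp continuous_fst).prodMk continuous_snd
  exact h.comp h2

/-- limits of nearly critical points are critical -/
lemma near_lim (P Q : ℂ[X]) (hc : IsCoprime P Q) (h1 : 1 ≤ max P.natDegree Q.natDegree)
    {ι : Type*} (F : Filter ι) [F.NeBot] (z : ι → Sphere) (s : ι → ℝ) (z0 : Sphere)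
    (hz : Tendsto z F (𝓝 z0)) (hs : Tendsto s F (𝓝 0))
    (h : ∀ᶠ t in F, ∃ η ∈ (fiber P Q (ratEval P Q (z t))).erase (z t), sphDist (z t) η < s t) :
    2 ≤ (fiber P Q (ratEval P Q z0)).count z0 := by
  obtain ⟨A, hA, H⟩ := key P Q hc h1
  set d := max P.natDegree Q.natDegree
  have hmem : ∀ z, z ∈ fiber P Q (ratEval P Q z) := fun z => (mem_fiber P Q hc h1 _ _).2 rfl
  have step : ∀ y, sphDist (ratEval P Q y) (ratEval P Q z0) ≤ A * (sphDist y z0 * (sphDist y z0 + 0) * 2 ^ d) := by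
    intro y
    have l1 : Tendsto (fun t => sphDist y (z t)) F (𝓝 (sphDist y z0)) :=
      ((sph_cont.comp (continuous_const.prodMk continuous_id)).tendsto z0).comp hz
    have l2 : Tendsto (fun t => sphDist (ratEval P Q y) (ratEval P Q (z t))) F
        (𝓝 (sphDist (ratEval P Q y) (ratEval P Q z0))) :=
      ((sph_cont.comp (continuous_const.prodMk (rat_cont P Q hc h1))).tendsto z0).comp hz
    refine le_of_tendsto_of_tendsto l2 (((l1.mul (l1.add hs)).mul_const (2 ^ d)).const_mul A) ?_
    filter_upwards [h] with t ⟨η, hη, hlt⟩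
    refine (H y _).2.trans (mul_le_mul_of_nonneg_left ?_ (by linarith))
    rw [sprod_erase y _ _ (hmem (z t)), sprod_erase y _ _ hη, ← mul_assoc]
    have e1 := sprod_le y (((fiber P Q (ratEval P Q (z t))).erase (z t)).erase η)
    have e2 : (2 : ℝ) ^ (((fiber P Q (ratEval P Q (z t))).erase (z t)).erase η).card ≤ 2 ^ d := by
      refine pow_le_pow_right₀ (by norm_num) ?_
      rw [show d = _ from (fiber_card P Q (ratEval P Q (z t))).symm]
      exact Multiset.card_le_card ((Multiset.erase_le _ _).trans (Multiset.erase_le _ _))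
    have e3 := sph_tri y (z t) η
    have e4 := sph_nonneg y (z t)
    have e5 := sph_nonneg y η
    have e6 := sprod_nonneg y (((fiber P Q (ratEval P Q (z t))).erase (z t)).erase η)
    have e7 : sphDist y η ≤ sphDist y (z t) + s t := by linarith
    refine mul_le_mul (mul_le_mul_of_nonneg_left e7 e4) (e1.trans e2) e6 (mul_nonneg e4 (by linarith))
  suffices z0 ∈ (fiber P Q (ratEval P Q z0)).erase z0 by
    rw [← Multiset.count_pos, Multiset.count_erase_self] at this
    omega
  rw [← sprod_eq_zero]
  refine le_antisymm ?_ (sprod_nonneg _ _)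
  have := sphere_neBot z0
  have l0 : Tendsto (fun y => sphDist y z0) (𝓝[≠] z0) (𝓝 0) :=
    (sph_tendsto.1 tendsto_id).mono_left nhdsWithin_le_nhds
  have l3 := (l0.const_mul (A * A * 2 ^ d))
  rw [mul_zero] at l3
  refine le_of_tendsto_of_tendsto (((sprod_cont _).tendsto z0).mono_left nhdsWithin_le_nhds) l3 ?_
  filter_upwards [self_mem_nhdsWithin] with y hy
  have hp := sph_pos hy
  have g1 := (H y (ratEval P Q z0)).1
  rw [sprod_erase y _ _ (hmem z0)] at g1
  refine le_of_mul_le_mul_left (g1.trans ?_) hp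
  refine (mul_le_mul_of_nonneg_left (step y) (by linarith)).trans (le_of_eq ?_)
  ring

/-- finitely many critical pairs -/
def critPairs {N : ℕ} (p q : Fin N → ℂ[X]) : Finset (Fin N × Sphere) :=
  Finset.univ.biUnion fun i => (insert OnePoint.infty ((critF p q i).image fun c : ℂ => (c : Sphere))).image fun c => (i, c)

lemma mem_critPairs {N : ℕ} {p q : Fin N → ℂ[X]} (hg : Good p q) (i : Fin N) (c : Sphere)
    (h : 2 ≤ (fiber (p i) (q i) (ratEval (p i) (q i) c)).count c) : (i, c) ∈ critPairs p q := by
  simp only [critPairs, Finset.mem_biUnion, Finset.mem_image, Finset.mem_insert, Finset.mem_univ, true_and]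
  refine ⟨i, c, ?_, rfl⟩
  induction c using OnePoint.rec with
  | infty => exact Or.inl rfl
  | coe c =>
    right
    refine ⟨c, ?_, rfl⟩
    rw [critF, Multiset.mem_toFinset]
    exact crit_root _ _ (hg.cop i) (hg.deg i) c h

/-- a critical point cannot return to itself along an orbit in the Julia set -/
lemma no_return {N : ℕ} {p q : Fin N → ℂ[X]} (hg : Good p q) (hA : NoSuperAttract p q) (x : SymX N) (hx : x ∈ juliaSet p q)
    (hcr : x ∈ critSet p q) (m : ℕ) (hm : 1 ≤ m) (hret : itComp p q x.1 m x.2 = x.2) : False := by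
  obtain ⟨w, c⟩ := x
  simp only at hret
  let om : ℕ → ℕ → Fin N := fun j n => if n < j * m then w (n % m) else w (n - j * m)
  have hom : ∀ j, (om j, c) ∈ juliaSet p q := by
    intro j
    induction j with
    | zero => simpa [om] using hx
    | succ j ih =>
      refine julia_back_iter hg m _ ?_
      rw [T_iter]
      have e1 : (fun n => om (j + 1) (n + m)) = om j := by
        funext n
        simp only [om, add_mul, one_mul, Nat.add_lt_add_iff_right, Nat.add_mod_right, Nat.add_sub_add_right]
      have e2 : itComp p q (om (j + 1)) m = itComp p q w m := by
        refine itComp_congr p q m _ _ fun n hn => ?_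
        simp only [om]
        rw [if_pos (by nlinarith), Nat.mod_eq_of_lt hn]
      simp only [e1, e2, hret]
      exact ih
  let per : ℕ → Fin N := fun n => w (n % m)
  have hlim : Tendsto (fun j => ((om j, c) : SymX N)) atTop (𝓝 (per, c)) := by
    refine Tendsto.prodMk_nhds ?_ tendsto_const_nhds
    rw [tendsto_pi_nhds]
    intro n
    refine tendsto_const_nhds.congr' ?_
    filter_upwards [eventually_gt_atTop n] with j hj
    simp only [om, per]
    rw [if_pos (by nlinarith)]
  have hper : (per, c) ∈ juliaSet p q := (julia_closed p q).mem_of_tendsto hlim (Eventually.of_forall hom)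
  refine hA (per, c) hper m hm ?_ 0 (by omega) ?_
  · rw [T_iter]
    refine Prod.ext ?_ ?_
    · funext n; simp [per]
    · simp only
      rw [itComp_congr p q m per w fun n hn => by simp [per, Nat.mod_eq_of_lt hn], hret]
  · have : per 0 = w 0 := by simp [per]
    simp only [Function.iterate_zero, id, critSet, Set.mem_setOf_eq, this] at hcr ⊢
    exact hcr

lemma near_block {N : ℕ} {p q : Fin N → ℂ[X]} (hg : Good p q) (hA : NoSuperAttract p q) (m : ℕ) :
    ∃ s > 0, ∀ x : SymX N, (Tmap p q)^[m] x ∈ juliaSet p q →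
      ((Finset.range m).filter fun k => NearCrit p q s ((Tmap p q)^[k] x)).card ≤ (critPairs p q).card := by
  by_contra! hcon
  choose x hxJ hxc using fun j : ℕ => hcon (1 / ((j : ℝ) + 1)) (by positivity)
  let U := hyperfilter ℕ
  obtain ⟨x0, -, hx0⟩ := (isCompact_univ (X := SymX N)).ultrafilter_le_nhds (U.map x) (by simp)
  have hlim : Tendsto x U (𝓝 x0) := hx0
  have hUat : (U : Filter ℕ) ≤ atTop := by rw [← Nat.cofinite_eq_atTop]; exact hyperfilter_le_cofinite
  have hTc : ∀ k, Continuous (Tmap p q)^[k] := fun k => (Tmap_cont hg).iterate k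
  have hm0 : (Tmap p q)^[m] x0 ∈ juliaSet p q :=
    (julia_closed p q).mem_of_tendsto (((hTc m).tendsto x0).comp hlim) (Eventually.of_forall hxJ)
  let S : Finset ℕ := (Finset.range m).filter fun k => ∀ᶠ j : ℕ in (U : Filter ℕ), NearCrit p q (1 / ((j : ℝ) + 1)) ((Tmap p q)^[k] (x j))
  have hS : (critPairs p q).card < S.card := by
    have : ∀ᶠ j : ℕ in (U : Filter ℕ), ∀ k ∈ Finset.range m, (NearCrit p q (1 / ((j : ℝ) + 1)) ((Tmap p q)^[k] (x j)) → k ∈ S) := by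
      rw [Filter.eventually_all_finset]
      intro k hk
      by_cases hh : ∀ᶠ j : ℕ in (U : Filter ℕ), NearCrit p q (1 / ((j : ℝ) + 1)) ((Tmap p q)^[k] (x j))
      · exact Eventually.of_forall fun j _ => Finset.mem_filter.2 ⟨hk, hh⟩
      · filter_upwards [Ultrafilter.eventually_not.2 hh] with j hj h
        exact absurd h hj
    obtain ⟨j, hj⟩ := this.exists
    refine (hxc j).trans_le (Finset.card_le_card fun k hk => ?_)
    rw [Finset.mem_filter] at hk
    exact hj k hk.1 hk.2
  have hcrit : ∀ k ∈ S, (Tmap p q)^[k] x0 ∈ critSet p q := by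
    intro k hk
    have hk2 := (Finset.mem_filter.1 hk).2
    have hl : Tendsto (fun j => (Tmap p q)^[k] (x j)) U (𝓝 ((Tmap p q)^[k] x0)) := ((hTc k).tendsto x0).comp hlim
    set y := fun j => (Tmap p q)^[k] (x j)
    set y0 := (Tmap p q)^[k] x0
    have hlet : ∀ᶠ j : ℕ in (U : Filter ℕ), (y j).1 0 = y0.1 0 := by
      have : Tendsto (fun j => (y j).1 0) U (𝓝 (y0.1 0)) :=
        (((continuous_apply 0).comp continuous_fst).tendsto y0).comp hl
      rw [nhds_discrete, tendsto_pure] at this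
      exact this
    refine near_lim (p (y0.1 0)) (q (y0.1 0)) (hg.cop _) (hg.deg _) (U : Filter ℕ) (fun j => (y j).2)
      (fun j => 1 / ((j : ℝ) + 1)) y0.2 ((continuous_snd.tendsto y0).comp hl)
      (tendsto_one_div_add_atTop_nhds_zero_nat.mono_left hUat) ?_
    filter_upwards [hlet, hk2] with j h1 h2
    rw [← h1]
    exact h2
  obtain ⟨k1, hk1, k2, hk2, hne, heq⟩ := Finset.exists_ne_map_eq_of_card_lt_of_maps_to hS
    (f := fun k => (((Tmap p q)^[k] x0).1 0, ((Tmap p q)^[k] x0).2))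
    fun k hk => mem_critPairs hg _ _ (hcrit k hk)
  wlog hlt : k1 < k2 generalizing k1 k2
  · exact this k2 hk2 k1 hk1 hne.symm heq.symm (by omega)
  have hk2m : k2 < m := Finset.mem_range.1 (Finset.mem_filter.1 hk2).1
  refine no_return hg hA ((Tmap p q)^[k1] x0) ?_ (hcrit k1 hk1) (k2 - k1) (by omega) ?_
  · refine julia_back_iter hg (m - k1) _ ?_
    rw [← Function.iterate_add_apply, Nat.sub_add_cancel (by omega)]
    exact hm0
  · have e := T_iter p q (k2 - k1) ((Tmap p q)^[k1] x0)
    rw [← Function.iterate_add_apply, Nat.sub_add_cancel (by omega)] at e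
    have h2 := (Prod.ext_iff.1 heq).2
    simp only at h2
    exact (congrArg Prod.snd e).symm.trans h2.symm

lemma near_count {N : ℕ} {p q : Fin N → ℂ[X]} (hg : Good p q) (hA : NoSuperAttract p q) (m : ℕ) (hm : 1 ≤ m) :
    ∃ s > 0, ∀ n : ℕ, ∀ x : SymX N, (Tmap p q)^[n] x ∈ juliaSet p q →
      ((Finset.range n).filter fun k => NearCrit p q s ((Tmap p q)^[k] x)).card ≤
        (critPairs p q).card * (n / m) + m := by
  obtain ⟨s, hs, H⟩ := near_block hg hA m
  refine ⟨s, hs, fun n => ?_⟩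
  induction n using Nat.strong_induction_on with
  | _ n ih =>
    intro x hx
    by_cases hn : n < m
    · refine (Finset.card_filter_le _ _).trans ?_
      rw [Finset.card_range]; omega
    · push Not at hn
      have hx' : (Tmap p q)^[n - m] ((Tmap p q)^[m] x) ∈ juliaSet p q := by
        rwa [← Function.iterate_add_apply, Nat.sub_add_cancel hn]
      have h1 := ih (n - m) (by omega) ((Tmap p q)^[m] x) hx'
      have h2 := H x (julia_back_iter hg (n - m) _ hx')
      have h3 : ((Finset.range n).filter fun k => NearCrit p q s ((Tmap p q)^[k] x)) ⊆
          ((Finset.range m).filter fun k => NearCrit p q s ((Tmap p q)^[k] x)) ∪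
          (((Finset.range (n - m)).filter fun k => NearCrit p q s ((Tmap p q)^[k] ((Tmap p q)^[m] x))).image fun k => k + m) := by
        intro k hk
        simp only [Finset.mem_union, Finset.mem_filter, Finset.mem_range, Finset.mem_image] at hk ⊢
        by_cases hkm : k < m
        · exact Or.inl ⟨hkm, hk.2⟩
        · right
          refine ⟨k - m, ⟨by omega, ?_⟩, by omega⟩
          rw [← Function.iterate_add_apply, Nat.sub_add_cancel (by omega)]
          exact hk.2
      have h4 := (Finset.card_le_card h3).trans (Finset.card_union_le _ _)
      have h5 := Finset.card_image_le (s := ((Finset.range (n - m)).filter fun k => NearCrit p q s ((Tmap p q)^[k] ((Tmap p q)^[m] x))))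
        (f := fun k => k + m)
      have h6 : n / m = (n - m) / m + 1 := by
        rw [Nat.div_eq_sub_div (by omega) hn]
      rw [h6]
      nlinarith

def GoodVal (P Q : ℂ[X]) (b : Sphere) : Prop :=
  b ≠ OnePoint.infty ∧ ratEval P Q OnePoint.infty ≠ b ∧
    ∀ c ∈ (Polynomial.wronskian P Q).roots, ratEval P Q (c : Sphere) ≠ b

lemma good_pre (P Q : ℂ[X]) (hc : IsCoprime P Q) (h1 : 1 ≤ max P.natDegree Q.natDegree)
    (y : Sphere) (h : GoodVal P Q (ratEval P Q y)) :
    ∃ a : ℂ, y = (a : Sphere) ∧ Q.eval a ≠ 0 ∧ (Polynomial.wronskian P Q).eval a ≠ 0 := by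
  obtain ⟨ha, hb, hcc⟩ := h
  induction y using OnePoint.rec with
  | infty => exact absurd rfl hb
  | coe a =>
    refine ⟨a, rfl, ?_, ?_⟩
    · intro h0; rw [rat_c, if_pos h0] at ha; exact ha rfl
    · intro h0
      exact hcc a ((mem_roots (wronsk_ne P Q hc h1)).2 h0) rfl

lemma rat_sd (P Q : ℂ[X]) (a : ℂ) (hQ : Q.eval a ≠ 0) (hW : (Polynomial.wronskian P Q).eval a ≠ 0) :
    ∃ f' : ℂ, f' ≠ 0 ∧ HasStrictDerivAt (fun z => P.eval z / Q.eval z) f' a := by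
  refine ⟨_, ?_, (P.hasStrictDerivAt a).div (Q.hasStrictDerivAt a) hQ⟩
  refine div_ne_zero ?_ (pow_ne_zero _ hQ)
  intro h
  apply hW
  simp only [Polynomial.wronskian, eval_sub, eval_mul]
  linear_combination -h

lemma rat_cover (P Q : ℂ[X]) (hc : IsCoprime P Q) (h1 : 1 ≤ max P.natDegree Q.natDegree) :
    IsCoveringMapOn (ratEval P Q) {b | GoodVal P Q b} := by
  apply IsCoveringMapOn.of_isLocalHomeomorphOn (rat_cont P Q hc h1)
  apply IsLocalHomeomorphOn.mk
  intro y hy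
  obtain ⟨a, rfl, hQ, hW⟩ := good_pre P Q hc h1 y hy
  obtain ⟨f', hf', hd⟩ := rat_sd P Q a hQ hW
  have hfd := hd.hasStrictFDerivAt_equiv hf'
  have hU : IsOpen {z : ℂ | Q.eval z ≠ 0} := isOpen_ne_fun (Q.continuous) continuous_const
  let c := (OnePoint.isOpenEmbedding_coe (X := ℂ)).toOpenPartialHomeomorph
  let e0 := (hfd.toOpenPartialHomeomorph).restrOpen _ hU
  have hcs : ∀ z : ℂ, c.symm (z : Sphere) = z := fun z =>
    (OnePoint.isOpenEmbedding_coe (X := ℂ)).toOpenPartialHomeomorph_left_inv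
  refine ⟨(c.symm.trans e0).trans c, ?_, ?_⟩
  · have : a ∈ e0.source := by
      refine ⟨hfd.mem_toOpenPartialHomeomorph_source, hQ⟩
    simp only [OpenPartialHomeomorph.trans_source, OpenPartialHomeomorph.symm_source, Set.mem_inter_iff, Set.mem_preimage, hcs, OpenPartialHomeomorph.coe_trans, Function.comp_apply]
    refine ⟨⟨?_, this⟩, ?_⟩
    · simp [c]
    · simp [c]
  · intro z hz
    simp only [OpenPartialHomeomorph.trans_source, OpenPartialHomeomorph.symm_source, Set.mem_inter_iff, Set.mem_preimage, OpenPartialHomeomorph.coe_trans, Function.comp_apply] at hz ⊢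
    obtain ⟨⟨h2, h3⟩, -⟩ := hz
    have : ∃ b : ℂ, z = (b : Sphere) := by
      simp only [c, Topology.IsOpenEmbedding.toOpenPartialHomeomorph_target] at h2
      obtain ⟨b, rfl⟩ := h2; exact ⟨b, rfl⟩
    obtain ⟨b, rfl⟩ := this
    rw [hcs] at h3 ⊢
    have h4 : Q.eval b ≠ 0 := h3.2
    rw [rat_c, if_neg h4]
    simp [c, e0]

lemma good_nodup (P Q : ℂ[X]) (hc : IsCoprime P Q) (h1 : 1 ≤ max P.natDegree Q.natDegree)
    (b : Sphere) (h : GoodVal P Q b) : (fiber P Q b).Nodup := by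
  rw [Multiset.nodup_iff_count_le_one]
  intro y
  by_contra h2
  have hm : y ∈ fiber P Q b := Multiset.count_pos.1 (by omega)
  have hR := (mem_fiber P Q hc h1 y b).1 hm
  rw [← hR] at h
  obtain ⟨a, rfl, hQ, hW⟩ := good_pre P Q hc h1 y h
  have := crit_root P Q hc h1 a (by rw [hR]; omega)
  exact hW ((mem_roots (wronsk_ne P Q hc h1)).1 this)

lemma lift_one (P Q : ℂ[X]) (hc : IsCoprime P Q) (h1 : 1 ≤ max P.natDegree Q.natDegree)
    (S : Set ℂ) (hS : IsOpen S) (hcv : Convex ℝ S) (hne : S.Nonempty) (g : ℂ → ℂ)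
    (hgd : DifferentiableOn ℂ g S) (hgood : ∀ ζ ∈ S, GoodVal P Q (g ζ : Sphere)) :
    ∃ Y : Fin (max P.natDegree Q.natDegree) → ℂ → ℂ,
      (∀ j, DifferentiableOn ℂ (Y j) S) ∧
      (∀ ζ ∈ S, Finset.univ.val.map (fun j => (Y j ζ : Sphere)) = fiber P Q (g ζ)) ∧
      (∀ ζ ∈ S, Function.Injective fun j => Y j ζ) := by
  classical
  have hcov := rat_cover P Q hc h1
  haveI : ContractibleSpace S := hcv.contractibleSpace hne
  haveI : LocallyPathConnectedSpace S := hS.locallyPathConnectedSpace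
  let G : C(S, Sphere) := ⟨fun ζ => (g ζ : Sphere), by
    have h := hgd.continuousOn.restrict
    exact OnePoint.continuous_coe.comp h⟩
  obtain ⟨a0, ha0⟩ := hne
  let A0 : S := ⟨a0, ha0⟩
  -- enumerate the fibre over a0
  have hnd := good_nodup P Q hc h1 _ (hgood a0 ha0)
  obtain ⟨e, he⟩ : ∃ e : Fin (max P.natDegree Q.natDegree) → Sphere,
      Finset.univ.val.map e = fiber P Q (g a0) := by
    have hcard := fiber_card P Q (g a0)
    rw [← hcard]
    obtain ⟨l, hl⟩ := Quot.exists_rep (fiber P Q (g a0))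
    change (l : Multiset Sphere) = _ at hl
    rw [← hl]
    refine ⟨fun j => l.get (j.cast (by simp)), ?_⟩
    simp only [Fin.univ_val_map, Multiset.coe_eq_coe]
    apply List.Perm.of_eq
    apply List.ext_get
    · simp
    · intro n h2 h3; simp
  have heinj : Function.Injective e := by
    rw [← he] at hnd
    intro i j hij
    exact Multiset.inj_on_of_nodup_map hnd i (Finset.mem_univ_val _) j (Finset.mem_univ_val _) hij
  have hemem : ∀ j, ratEval P Q (e j) = g a0 := by
    intro j
    apply (mem_fiber P Q hc h1 _ _).1
    rw [← he]
    exact Multiset.mem_map_of_mem _ (Finset.mem_univ_val _)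
  have hGs : ∀ a, G a ∈ {b | GoodVal P Q b} := fun a => hgood a a.2
  have hF : ∀ j, ∃ F : C(S, Sphere), F A0 = e j ∧ ratEval P Q ∘ F = G := fun j =>
    (hcov.existsUnique_continuousMap_lifts G (a₀ := A0) (e₀ := e j) (hemem j) hGs).exists
  choose F hF0 hFG using hF
  have hFG' : ∀ j (ζ : S), ratEval P Q (F j ζ) = (g ζ : Sphere) := fun j ζ => congr_fun (hFG j) ζ
  have hFinj : ∀ ζ : S, Function.Injective fun j => F j ζ := by
    intro ζ i j hij
    have hu := (hcov.existsUnique_continuousMap_lifts G (a₀ := ζ) (e₀ := F i ζ) (hFG' i ζ) hGs)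
    have : F i = F j := hu.unique ⟨rfl, hFG i⟩ ⟨hij.symm, hFG j⟩
    apply heinj
    rw [← hF0, ← hF0, this]
  have hpre : ∀ j (ζ : S), ∃ a : ℂ, F j ζ = (a : Sphere) ∧ Q.eval a ≠ 0 ∧ (Polynomial.wronskian P Q).eval a ≠ 0 := by
    intro j ζ
    apply good_pre P Q hc h1
    rw [hFG']; exact hgood ζ ζ.2
  choose y hy hQy hWy using hpre
  have hycont : ∀ j, Continuous (y j) := by
    intro j
    have h := (F j).continuous
    have h2 : (F j : S → Sphere) = (fun z : ℂ => (z : Sphere)) ∘ y j := funext (hy j)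
    rw [h2] at h
    exact (OnePoint.isOpenEmbedding_coe (X := ℂ)).isEmbedding.continuous_iff.2 h
  have hyg : ∀ j (ζ : S), P.eval (y j ζ) / Q.eval (y j ζ) = g ζ := by
    intro j ζ
    have h := hFG' j ζ
    rw [hy, rat_c, if_neg (hQy j ζ)] at h
    exact OnePoint.coe_injective h
  refine ⟨fun j ζ => if h : ζ ∈ S then y j ⟨ζ, h⟩ else 0, ?_, ?_, ?_⟩
  · intro j ζ hζ
    obtain ⟨f', hf', hd⟩ := rat_sd P Q _ (hQy j ⟨ζ, hζ⟩) (hWy j ⟨ζ, hζ⟩)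
    have hinv := (hd.to_localInverse hf').hasDerivAt
    have hev := hd.eventually_left_inverse hf'
    apply DifferentiableAt.differentiableWithinAt
    have hgat : DifferentiableAt ℂ g ζ := hgd.differentiableAt (hS.mem_nhds hζ)
    have h2 : DifferentiableAt ℂ (fun ζ' => HasStrictDerivAt.localInverse _ f' _ hd hf' (g ζ')) ζ := by
      apply DifferentiableAt.comp ζ (g := HasStrictDerivAt.localInverse _ f' _ hd hf') _ hgat
      have := hyg j ⟨ζ, hζ⟩
      simp only at this
      rw [this] at hinv
      exact hinv.differentiableAt
    refine h2.congr_of_eventuallyEq ?_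
    have hT : Tendsto (y j) (𝓝 ⟨ζ, hζ⟩) (𝓝 (y j ⟨ζ, hζ⟩)) := (hycont j).tendsto _
    have h3 := hT.eventually hev
    rw [nhds_subtype_eq_comap, eventually_comap] at h3
    filter_upwards [h3, hS.mem_nhds hζ] with ζ' h4 h5
    rw [dif_pos h5]
    have := h4 ⟨ζ', h5⟩ rfl
    rw [hyg] at this
    exact this.symm
  · intro ζ hζ
    simp only [dif_pos hζ]
    have hsub : Finset.univ.val.map (fun j => (y j ⟨ζ, hζ⟩ : Sphere)) ≤ fiber P Q (g ζ) := by
      rw [Multiset.le_iff_subset]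
      · intro z hz
        obtain ⟨j, -, rfl⟩ := Multiset.mem_map.1 hz
        rw [mem_fiber P Q hc h1, ← hy, hFG']
      · apply Multiset.Nodup.map _ Finset.univ.nodup
        intro i j hij
        apply hFinj ⟨ζ, hζ⟩
        simp only [hy]; exact hij
    apply Multiset.eq_of_le_of_card_le hsub
    rw [fiber_card]; simp
  · intro ζ hζ i j hij
    simp only [dif_pos hζ] at hij
    apply hFinj ⟨ζ, hζ⟩
    simp only [hy, hij]

lemma lift_glue (P Q : ℂ[X]) (hc : IsCoprime P Q) (h1 : 1 ≤ max P.natDegree Q.natDegree)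
    (Θ : Set ℝ) (hΘ : IsOpen Θ) (g : ℂ → ℂ)
    (hgd : DifferentiableOn ℂ g {ζ | ζ.im ∈ Θ}) (hgood : ∀ ζ : ℂ, ζ.im ∈ Θ → GoodVal P Q (g ζ : Sphere)) :
    ∃ Y : Fin (max P.natDegree Q.natDegree) → ℂ → ℂ,
      (∀ j, DifferentiableOn ℂ (Y j) {ζ | ζ.im ∈ Θ}) ∧
      (∀ ζ : ℂ, ζ.im ∈ Θ → Finset.univ.val.map (fun j => (Y j ζ : Sphere)) = fiber P Q (g ζ)) ∧
      (∀ ζ : ℂ, ζ.im ∈ Θ → Function.Injective fun j => Y j ζ) := by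
  classical
  have hmem : ∀ c a, a ∈ Θ.ordConnectedComponent c → Θ.ordConnectedComponent c = Θ.ordConnectedComponent a := by
    intro c a h
    exact Set.ordConnectedComponent_eq h
  have hop : ∀ c, IsOpen (Θ.ordConnectedComponent c) := by
    intro c
    rw [isOpen_iff_mem_nhds]
    intro a ha
    rw [hmem c a ha]
    exact Set.ordConnectedComponent_mem_nhds.2 (hΘ.mem_nhds (Set.ordConnectedComponent_subset ha))
  have hex : ∀ c : Θ, ∃ Y : Fin (max P.natDegree Q.natDegree) → ℂ → ℂ,
      (∀ j, DifferentiableOn ℂ (Y j) {ζ | ζ.im ∈ Θ.ordConnectedComponent c}) ∧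
      (∀ ζ ∈ {ζ : ℂ | ζ.im ∈ Θ.ordConnectedComponent c}, Finset.univ.val.map (fun j => (Y j ζ : Sphere)) = fiber P Q (g ζ)) ∧
      (∀ ζ ∈ {ζ : ℂ | ζ.im ∈ Θ.ordConnectedComponent c}, Function.Injective fun j => Y j ζ) := by
    intro c
    apply lift_one P Q hc h1
    · exact (hop c).preimage Complex.continuous_im
    · have : Convex ℝ (Θ.ordConnectedComponent (c : ℝ)) := by
        apply Set.OrdConnected.convex
        rw [Set.ordConnected_def]
        intro a ha b hb x hx
        rw [hmem _ a ha] at hb ⊢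
        rw [Set.mem_ordConnectedComponent] at hb ⊢
        refine subset_trans ?_ hb
        apply Set.uIcc_subset_uIcc_left
        exact Set.Icc_subset_uIcc hx
      exact this.is_linear_preimage (f := Complex.im) ⟨Complex.add_im, fun c x => by simp⟩
    · exact ⟨⟨0, c⟩, Set.self_mem_ordConnectedComponent.2 c.2⟩
    · exact hgd.mono fun ζ h => (Set.ordConnectedComponent_subset (show ζ.im ∈ Θ.ordConnectedComponent (c:ℝ) from h) : ζ.im ∈ Θ)
    · intro ζ h; exact hgood ζ (Set.ordConnectedComponent_subset h)
  choose Y hY1 hY2 hY3 using hex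
  have hpm : ∀ a : Θ, Θ.ordConnectedProj a ∈ Θ := fun a =>
    Set.ordConnectedComponent_subset (Set.ordConnectedProj_mem_ordConnectedComponent Θ a)
  refine ⟨fun j ζ => if h : ζ.im ∈ Θ then Y ⟨_, hpm ⟨ζ.im, h⟩⟩ j ζ else 0, ?_, ?_, ?_⟩
  · intro j ζ hζ
    apply DifferentiableAt.differentiableWithinAt
    have hζ' : ζ.im ∈ Θ := hζ
    have hin : ζ.im ∈ Θ.ordConnectedComponent (Θ.ordConnectedProj ⟨ζ.im, hζ'⟩) :=
      Set.mem_ordConnectedComponent_ordConnectedProj Θ ⟨ζ.im, hζ'⟩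
    have hnh : {ξ : ℂ | ξ.im ∈ Θ.ordConnectedComponent (Θ.ordConnectedProj ⟨ζ.im, hζ'⟩)} ∈ 𝓝 ζ :=
      ((hop _).preimage Complex.continuous_im).mem_nhds hin
    have hd := (hY1 ⟨_, hpm ⟨ζ.im, hζ'⟩⟩ j).differentiableAt hnh
    refine hd.congr_of_eventuallyEq ?_
    filter_upwards [hnh] with ζ' h'
    have h2 : ζ'.im ∈ Θ := Set.ordConnectedComponent_subset h'
    rw [dif_pos h2]
    have : Θ.ordConnectedProj ⟨ζ'.im, h2⟩ = Θ.ordConnectedProj ⟨ζ.im, hζ'⟩ := by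
      rw [Set.ordConnectedProj_eq]
      rw [Set.ordConnectedComponent_ordConnectedProj, Set.mem_ordConnectedComponent] at h'
      rwa [Set.uIcc_comm]
    simp only [this]
  · intro ζ hζ
    simp only [dif_pos hζ]
    exact hY2 ⟨_, hpm ⟨ζ.im, hζ⟩⟩ ζ (Set.mem_ordConnectedComponent_ordConnectedProj Θ ⟨ζ.im, hζ⟩)
  · intro ζ hζ
    simp only [dif_pos hζ]
    exact hY3 ⟨_, hpm ⟨ζ.im, hζ⟩⟩ ζ (Set.mem_ordConnectedComponent_ordConnectedProj Θ ⟨ζ.im, hζ⟩)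

def Bad {N : ℕ} (p q : Fin N → ℂ[X]) : ℕ → Set Sphere
  | 0 => {OnePoint.infty}
  | m + 1 => {OnePoint.infty} ∪ ⋃ i, ratEval (p i) (q i) ''
      ({OnePoint.infty} ∪ (fun c : ℂ => (c : Sphere)) '' (critF p q i : Set ℂ) ∪ Bad p q m)

lemma bad_finite {N : ℕ} (p q : Fin N → ℂ[X]) (m : ℕ) : (Bad p q m).Finite := by
  induction m with
  | zero => exact Set.finite_singleton _
  | succ m ih =>
    refine (Set.finite_singleton _).union (Set.finite_iUnion fun i => Set.Finite.image _ ?_)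
    exact ((Set.finite_singleton _).union ((Finset.finite_toSet _).image _)).union ih

lemma bad_infty {N : ℕ} (p q : Fin N → ℂ[X]) (m : ℕ) : OnePoint.infty ∈ Bad p q m := by
  cases m with
  | zero => exact rfl
  | succ m => exact Or.inl rfl

lemma bad_good {N : ℕ} (p q : Fin N → ℂ[X]) (m : ℕ) (b : Sphere) (hb : b ∉ Bad p q (m+1)) (i : Fin N) :
    GoodVal (p i) (q i) b := by
  simp only [Bad, Set.mem_union, not_or, Set.mem_iUnion, not_exists] at hb
  obtain ⟨h1, h2⟩ := hb
  refine ⟨h1, ?_, ?_⟩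
  · intro h; exact h2 i ⟨_, Or.inl (Or.inl rfl), h⟩
  · intro c hc h
    refine h2 i ⟨_, Or.inl (Or.inr ⟨c, ?_, rfl⟩), h⟩
    simpa [critF] using hc

lemma bad_pre {N : ℕ} (p q : Fin N → ℂ[X]) (m : ℕ) (b y : Sphere) (hb : b ∉ Bad p q (m+1)) (i : Fin N)
    (h : ratEval (p i) (q i) y = b) : y ∉ Bad p q m := by
  intro hy
  apply hb
  right
  rw [Set.mem_iUnion]
  exact ⟨i, y, Or.inr hy, h⟩

lemma tree_lift {N : ℕ} {p q : Fin N → ℂ[X]} (hg : Good p q) (n : ℕ) (Θ : Set ℝ) (hΘ : IsOpen Θ) (Φ : ℂ → ℂ)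
    (hd : DifferentiableOn ℂ Φ {ζ | ζ.im ∈ Θ}) (hb : ∀ ζ : ℂ, ζ.im ∈ Θ → (Φ ζ : Sphere) ∉ Bad p q n) :
    ∃ Y : List (IX p q) → ℂ → ℂ, Y [] = Φ ∧
      (∀ l, l.length ≤ n → DifferentiableOn ℂ (Y l) {ζ | ζ.im ∈ Θ}) ∧
      (∀ l, l.length < n → ∀ i, ∀ ζ : ℂ, ζ.im ∈ Θ →
        Finset.univ.val.map (fun j => (Y (⟨i, j⟩ :: l) ζ : Sphere)) = fiber (p i) (q i) (Y l ζ) ∧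
        Function.Injective fun j => Y (⟨i, j⟩ :: l) ζ) := by
  classical
  have hex : ∀ (i : Fin N) (g : ℂ → ℂ), ∃ Z : Fin (degR p q i) → ℂ → ℂ,
      (DifferentiableOn ℂ g {ζ | ζ.im ∈ Θ} ∧ ∀ ζ : ℂ, ζ.im ∈ Θ → GoodVal (p i) (q i) (g ζ : Sphere)) →
      (∀ j, DifferentiableOn ℂ (Z j) {ζ | ζ.im ∈ Θ}) ∧
      (∀ ζ : ℂ, ζ.im ∈ Θ → Finset.univ.val.map (fun j => (Z j ζ : Sphere)) = fiber (p i) (q i) (g ζ)) ∧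
      (∀ ζ : ℂ, ζ.im ∈ Θ → Function.Injective fun j => Z j ζ) := by
    intro i g
    by_cases h : (DifferentiableOn ℂ g {ζ | ζ.im ∈ Θ} ∧ ∀ ζ : ℂ, ζ.im ∈ Θ → GoodVal (p i) (q i) (g ζ : Sphere))
    · obtain ⟨Z, hZ⟩ := lift_glue (p i) (q i) (hg.cop i) (hg.deg i) Θ hΘ g h.1 h.2
      exact ⟨Z, fun _ => hZ⟩
    · exact ⟨fun _ _ => 0, fun h' => absurd h' h⟩
  choose Z hZ using hex
  obtain ⟨Y, hY0, hY⟩ : ∃ Y : List (IX p q) → ℂ → ℂ, Y [] = Φ ∧ ∀ a l, Y (a :: l) = Z a.1 (Y l) a.2 :=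
    ⟨fun l => List.rec Φ (fun a _ y => Z a.1 y a.2) l, rfl, fun a l => rfl⟩
  have inv : ∀ l : List (IX p q), l.length ≤ n → DifferentiableOn ℂ (Y l) {ζ | ζ.im ∈ Θ} ∧
      ∀ ζ : ℂ, ζ.im ∈ Θ → OnePoint.some (Y l ζ) ∉ Bad p q (n - l.length) := by
    intro l
    induction l with
    | nil => intro _; rw [hY0]; exact ⟨hd, hb⟩
    | cons a l ih =>
      intro hl
      rw [List.length_cons] at hl
      obtain ⟨i1, i2⟩ := ih (by omega)
      have e : n - l.length = (n - (l.length + 1)) + 1 := by omega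
      rw [e] at i2
      obtain ⟨z1, z2, z3⟩ := hZ a.1 (Y l) ⟨i1, fun ζ h => bad_good p q _ _ (i2 ζ h) _⟩
      rw [hY, List.length_cons]
      refine ⟨z1 _, fun ζ h => bad_pre p q _ (OnePoint.some (Y l ζ)) _ (i2 ζ h) a.1 ?_⟩
      apply (mem_fiber _ _ (hg.cop _) (hg.deg _) _ _).1
      rw [← z2 ζ h]
      exact Multiset.mem_map_of_mem (fun j => (Z a.1 (Y l) j ζ : Sphere)) (Finset.mem_univ_val a.2)
  refine ⟨Y, hY0, fun l hl => (inv l hl).1, fun l hl i ζ h => ?_⟩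
  obtain ⟨i1, i2⟩ := inv l hl.le
  have e : n - l.length = (n - (l.length + 1)) + 1 := by omega
  rw [e] at i2
  obtain ⟨z1, z2, z3⟩ := hZ i (Y l) ⟨i1, fun ζ h => bad_good p q _ _ (i2 ζ h) _⟩
  simp only [hY]
  exact ⟨z2 ζ h, z3 ζ h⟩

def spd (Y : ℂ → ℂ) (ζ : ℂ) : ℝ := 2 * ‖deriv Y ζ‖ / (1 + ‖Y ζ‖ ^ 2)

def rhoS (y : ℂ) : ℝ≥0∞ := ENNReal.ofReal (4 / (1 + ‖y‖ ^ 2) ^ 2)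

lemma rhoS_int : ∃ C : ℝ, 0 ≤ C ∧ ∫⁻ y : ℂ, rhoS y ≤ ENNReal.ofReal C := by
  have h := (integrable_rpow_neg_one_add_norm_sq (E := ℂ) (μ := volume) (r := 4) (by simp; norm_num)).const_mul 4
  refine ⟨∫ y : ℂ, 4 * (1 + ‖y‖ ^ 2) ^ (-(4:ℝ) / 2), integral_nonneg fun y => by positivity, ?_⟩
  rw [ofReal_integral_eq_lintegral_ofReal h (Eventually.of_forall fun y => by positivity)]
  apply lintegral_mono
  intro y
  unfold rhoS
  apply ENNReal.ofReal_le_ofReal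
  apply le_of_eq
  have : (-(4:ℝ) / 2) = -((2:ℕ):ℝ) := by norm_num
  rw [this, Real.rpow_neg (by positivity), Real.rpow_natCast]
  field_simp

lemma abs_det_cx (c : ℂ) : |((ContinuousLinearMap.toSpanSingleton ℂ c).restrictScalars ℝ : ℂ →L[ℝ] ℂ).det| = ‖c‖ ^ 2 := by
  simp [ContinuousLinearMap.det, LinearMap.det_restrictScalars, Algebra.norm_complex_eq, Complex.normSq_eq_norm_sq]

lemma area_one (O : Set ℂ) (hO : IsOpen O) (Y : ℂ → ℂ) (hd : DifferentiableOn ℂ Y O) (hi : Set.InjOn Y O) :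
    MeasurableSet (Y '' O) ∧ ∫⁻ ζ in O, ENNReal.ofReal (spd Y ζ ^ 2) = ∫⁻ y in Y '' O, rhoS y := by
  have hder : ∀ x ∈ O, HasFDerivWithinAt Y ((ContinuousLinearMap.toSpanSingleton ℂ (deriv Y x)).restrictScalars ℝ : ℂ →L[ℝ] ℂ) O x := by
    intro x hx
    have h := (hd.differentiableAt (hO.mem_nhds hx)).hasDerivAt.hasFDerivAt
    exact (h.restrictScalars ℝ).hasFDerivWithinAt
  refine ⟨measurable_image_of_fderivWithin hO.measurableSet hder hi, ?_⟩
  rw [lintegral_image_eq_lintegral_abs_det_fderiv_mul volume hO.measurableSet hder hi]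
  apply lintegral_congr
  intro x
  rw [abs_det_cx, rhoS, ← ENNReal.ofReal_mul (by positivity)]
  congr 1
  unfold spd
  have : (1 + ‖Y x‖^2) ≠ 0 := by positivity
  field_simp
  ring

lemma tree_inj {N : ℕ} {p q : Fin N → ℂ[X]} (hg : Good p q) (n : ℕ) (O : Set ℂ) 
    (Y : List (IX p q) → ℂ → ℂ) (h0 : Set.InjOn (Y []) O)
    (h2 : ∀ l, l.length < n → ∀ i, ∀ ζ ∈ O,
        Finset.univ.val.map (fun j => (Y (⟨i, j⟩ :: l) ζ : Sphere)) = fiber (p i) (q i) (Y l ζ) ∧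
        Function.Injective fun j => Y (⟨i, j⟩ :: l) ζ) :
    ∀ (l l' : List (IX p q)), l.length ≤ n → l.map Sigma.fst = l'.map Sigma.fst → ∀ ζ ∈ O, ∀ ζ' ∈ O,
      Y l ζ = Y l' ζ' → l = l' ∧ ζ = ζ' := by
  intro l
  induction l with
  | nil =>
    intro l' _ hw ζ hζ ζ' hζ' h
    have : l' = [] := by simpa using hw.symm
    subst this
    exact ⟨rfl, h0 hζ hζ' h⟩
  | cons a l ih =>
    intro l' hl hw ζ hζ ζ' hζ' h
    cases l' with
    | nil => simp at hw
    | cons a' l' =>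
      obtain ⟨i, j⟩ := a
      obtain ⟨i', j'⟩ := a'
      simp only [List.map_cons, List.cons.injEq] at hw
      obtain ⟨rfl, hw⟩ := hw
      rw [List.length_cons] at hl
      have hlen : l'.length = l.length := by
        have := congrArg List.length hw
        simpa using this.symm
      have hR : ∀ (l : List (IX p q)) j, l.length < n → ∀ ζ ∈ O, ratEval (p i) (q i) (Y (⟨i, j⟩ :: l) ζ : Sphere) = (Y l ζ : Sphere) := by
        intro l j hl ζ hζ
        apply (mem_fiber _ _ (hg.cop _) (hg.deg _) _ _).1
        rw [← (h2 l hl i ζ hζ).1]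
        exact Multiset.mem_map_of_mem (fun j => (Y (⟨i, j⟩ :: l) ζ : Sphere)) (Finset.mem_univ_val j)
      have e1 := hR l j (by omega) ζ hζ
      have e2 := hR l' j' (by omega) ζ' hζ'
      rw [h, e2] at e1
      obtain ⟨rfl, rfl⟩ := ih l' (by omega) hw ζ hζ ζ' hζ' (OnePoint.coe_injective e1.symm)
      have := (h2 l (by omega) i ζ hζ).2 h
      rw [this]
      exact ⟨rfl, rfl⟩

lemma area_sum {N : ℕ} {p q : Fin N → ℂ[X]} (hg : Good p q) (n : ℕ) (O : Set ℂ) (hO : IsOpen O) 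
    (Y : List (IX p q) → ℂ → ℂ) (h0 : Set.InjOn (Y []) O)
    (h1 : ∀ l, l.length ≤ n → DifferentiableOn ℂ (Y l) O)
    (h2 : ∀ l, l.length < n → ∀ i, ∀ ζ ∈ O,
        Finset.univ.val.map (fun j => (Y (⟨i, j⟩ :: l) ζ : Sphere)) = fiber (p i) (q i) (Y l ζ) ∧
        Function.Injective fun j => Y (⟨i, j⟩ :: l) ζ) (k : ℕ) (hk : k ≤ n) :
    ∑ l ∈ lev (IX p q) k, ∫⁻ ζ in O, ENNReal.ofReal (spd (Y l) ζ ^ 2) ≤ N ^ k * ∫⁻ y : ℂ, rhoS y := by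
  classical
  have hinj := tree_inj hg n O Y h0 h2
  have hmaps : ∀ l ∈ lev (IX p q) k, l.map Sigma.fst ∈ lev (Fin N) k := by
    intro l hl; rw [mem_lev] at hl ⊢; simpa using hl
  rw [← Finset.sum_fiberwise_of_maps_to hmaps]
  calc _ ≤ ∑ w ∈ lev (Fin N) k, ∫⁻ y : ℂ, rhoS y := by
        apply Finset.sum_le_sum
        intro w hw
        have hA : ∀ l ∈ (lev (IX p q) k).filter (fun l => l.map Sigma.fst = w),
            MeasurableSet (Y l '' O) ∧ ∫⁻ ζ in O, ENNReal.ofReal (spd (Y l) ζ ^ 2) = ∫⁻ y in Y l '' O, rhoS y := by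
          intro l hl
          rw [Finset.mem_filter, mem_lev] at hl
          apply area_one O hO _ (h1 l (by omega))
          intro ζ hζ ζ' hζ' h
          exact (hinj l l (by omega) rfl ζ hζ ζ' hζ' h).2
        rw [Finset.sum_congr rfl fun l hl => (hA l hl).2]
        rw [← lintegral_biUnion_finset]
        · exact setLIntegral_le_lintegral _ _
        · intro l hl l' hl' hne
          simp only [Finset.coe_filter, Set.mem_ofPred_eq, mem_lev] at hl hl'
          rw [Function.onFun, Set.disjoint_left]
          rintro _ ⟨ζ, hζ, rfl⟩ ⟨ζ', hζ', h⟩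
          exact hne (hinj l l' (by omega) (hl.2.trans hl'.2.symm) ζ hζ ζ' hζ' h.symm).1
        · intro l hl; exact (hA l hl).1
    _ = _ := by simp [card_lev]

lemma slice (Θ : Set ℝ) (hΘ : MeasurableSet Θ) (hv : 1 ≤ volume Θ) (hv' : volume Θ ≠ ⊤) (G : ℂ → ℝ≥0∞) (C : ℝ≥0∞)
    (hG : AEMeasurable G (volume.restrict {ζ | ζ.im ∈ Θ})) (hC : ∫⁻ ζ in {ζ | ζ.im ∈ Θ}, G ζ ≤ C) :
    ∃ θ ∈ Θ, ∫⁻ t : ℝ, G ⟨t, θ⟩ ≤ C := by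
  have hO : MeasurableSet {ζ : ℂ | ζ.im ∈ Θ} := Complex.measurable_im hΘ
  let h : ℂ → ℝ≥0∞ := Set.indicator {ζ : ℂ | ζ.im ∈ Θ} G
  have hh : AEMeasurable h volume := (aemeasurable_indicator_iff hO).2 hG
  have hI : ∫⁻ ζ, h ζ ≤ C := by rw [lintegral_indicator hO]; exact hC
  have mp := Complex.volume_preserving_equiv_real_prod.symm
  rw [← mp.lintegral_comp_emb (MeasurableEquiv.measurableEmbedding _) h] at hI
  have hm : AEMeasurable (fun a => h (Complex.measurableEquivRealProd.symm a)) ((volume : Measure ℝ).prod volume) :=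
    hh.comp_quasiMeasurePreserving mp.quasiMeasurePreserving
  rw [Measure.volume_eq_prod, lintegral_prod_symm _ hm] at hI
  simp only [Complex.measurableEquivRealProd_symm_apply] at hI
  have hmy : AEMeasurable (fun y : ℝ => ∫⁻ x : ℝ, h ⟨x, y⟩) volume := by
    have := hm.lintegral_prod_left'
    simpa only [Complex.measurableEquivRealProd_symm_apply] using this
  obtain ⟨θ, hθ, hle⟩ := exists_le_setLAverage (μ := volume) (s := Θ) (f := fun y : ℝ => ∫⁻ x : ℝ, h ⟨x, y⟩)
    (by intro h0; rw [h0] at hv; simp at hv) hv' hmy.restrict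
  refine ⟨θ, hθ, ?_⟩
  have e : ∀ t : ℝ, h ⟨t, θ⟩ = G ⟨t, θ⟩ := fun t => Set.indicator_of_mem (s := {ζ : ℂ | ζ.im ∈ Θ}) hθ G
  simp only [e] at hle
  refine hle.trans ?_
  rw [setLAverage_eq]
  calc _ ≤ (∫⁻ y in Θ, ∫⁻ x : ℝ, h ⟨x, y⟩) / 1 := ENNReal.div_le_div_left hv _
    _ ≤ _ := by rw [div_one]; exact (setLIntegral_le_lintegral _ _).trans hI

lemma path_len (y v : ℝ → ℂ) (a b : ℝ) (hab : a ≤ b) (hy : ∀ t, HasDerivAt y (v t) t) (hv : Continuous v) :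
    sphDist (y a) (y b) ≤ ∫ t in a..b, 2 * ‖v t‖ / (1 + ‖y t‖ ^ 2) := by
  have hyc : Continuous y := continuous_iff_continuousAt.2 fun t => (hy t).continuousAt
  have hs : Continuous fun t => 2 * ‖v t‖ / (1 + ‖y t‖ ^ 2) := by
    refine Continuous.div (by fun_prop) (by fun_prop) fun t => by positivity
  have hysc : Continuous fun t => (y t : Sphere) := OnePoint.continuous_coe.comp hyc
  have hfc : Continuous fun t => sphDist (y a) (y t) := sph_cont.comp (continuous_const.prodMk hysc)
  have key : ∀ ε : ℝ, 0 < ε → sphDist (y a) (y b) ≤ (∫ t in a..b, 2 * ‖v t‖ / (1 + ‖y t‖ ^ 2)) + ε * (b - a) := by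
    intro ε hε
    have := image_le_of_liminf_slope_right_lt_deriv_boundary' (f := fun t => sphDist (y a) (y t))
      (f' := fun t => 2 * ‖v t‖ / (1 + ‖y t‖ ^ 2)) (a := a) (b := b)
      (B := fun x => (∫ t in a..x, 2 * ‖v t‖ / (1 + ‖y t‖ ^ 2)) + ε * (x - a))
      (B' := fun t => 2 * ‖v t‖ / (1 + ‖y t‖ ^ 2) + ε * 1) hfc.continuousOn ?_ ?_ ?_ ?_ ?_ (x := b) ⟨hab, le_rfl⟩
    · exact this
    · intro x _ r hr
      have hT : Tendsto (fun z => sphDist (y x) (y z) / (z - x)) (𝓝[>] x) (𝓝 (2 * ‖v x‖ / (1 + ‖y x‖ ^ 2))) := by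
        have h1 : Tendsto (fun z => ‖slope y x z‖) (𝓝[>] x) (𝓝 ‖v x‖) :=
          ((hasDerivAt_iff_tendsto_slope.1 (hy x)).mono_left (nhdsWithin_mono _ fun z hz => ne_of_gt hz)).norm
        have h2 : Tendsto (fun z => Real.sqrt (1 + ‖y z‖^2)) (𝓝[>] x) (𝓝 (Real.sqrt (1 + ‖y x‖^2))) := by
          have : Continuous fun z => Real.sqrt (1 + ‖y z‖^2) := by fun_prop
          exact (this.tendsto x).mono_left nhdsWithin_le_nhds
        have h3 := (h1.const_mul 2).div ((tendsto_const_nhds (x := Real.sqrt (1 + ‖y x‖^2))).mul h2) (by positivity)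
        rw [Real.mul_self_sqrt (by positivity)] at h3
        refine h3.congr' ?_
        filter_upwards [self_mem_nhdsWithin] with z hz
        have hz' : 0 < z - x := sub_pos.2 hz
        simp only [Pi.div_apply]
        rw [sph_cc, slope_def_module, norm_smul, dist_comm, dist_eq_norm, Real.norm_eq_abs, abs_inv, abs_of_pos hz']
        field_simp
      apply Eventually.frequently
      filter_upwards [hT.eventually (gt_mem_nhds hr), self_mem_nhdsWithin] with z hz hz2
      refine lt_of_le_of_lt ?_ hz
      have hz' : 0 < z - x := sub_pos.2 hz2
      rw [slope_def_field]
      apply div_le_div_of_nonneg_right _ hz'.le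
      linarith [sph_tri (y a) (y x) (y z)]
    · simp [sph_self]
    · apply Continuous.continuousOn
      exact (intervalIntegral.continuous_primitive (fun a b => hs.intervalIntegrable a b) a).add (by fun_prop)
    · intro x _
      apply HasDerivAt.hasDerivWithinAt
      exact (intervalIntegral.integral_hasDerivAt_right (hs.intervalIntegrable _ _) (hs.stronglyMeasurableAtFilter _ _) hs.continuousAt).add
        (((hasDerivAt_id x).sub_const a).const_mul ε)
    · intro x _ _
      linarith
  apply le_of_forall_pos_le_add
  intro δ hδ
  have := key (δ / (b - a + 1)) (by apply div_pos hδ; linarith)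
  refine this.trans ?_
  have h1 : 0 < b - a + 1 := by linarith
  have : δ / (b - a + 1) * (b - a) ≤ δ := by
    rw [div_mul_eq_mul_div, div_le_iff₀ h1]; nlinarith
  linarith

lemma cs_int (v : ℝ → ℝ) (hv : Continuous v) (a b : ℝ) (hab : a < b) :
    (∫ t in a..b, v t) ^ 2 ≤ (b - a) * ∫ t in a..b, v t ^ 2 := by
  set I := ∫ t in a..b, v t
  set m := I / (b - a)
  have h : 0 ≤ ∫ t in a..b, (v t - m) ^ 2 := intervalIntegral.integral_nonneg hab.le fun t _ => sq_nonneg _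
  have e : ∫ t in a..b, (v t - m) ^ 2 = (∫ t in a..b, v t ^ 2) - 2 * m * I + m ^ 2 * (b - a) := by
    have : ∀ t, (v t - m) ^ 2 = v t ^ 2 - 2 * m * v t + m ^ 2 := fun t => by ring
    simp only [this]
    rw [intervalIntegral.integral_add, intervalIntegral.integral_sub, intervalIntegral.integral_const_mul, intervalIntegral.integral_const]
    · simp [I]; ring
    all_goals apply Continuous.intervalIntegrable; fun_prop
  rw [e] at h
  have hb : 0 < b - a := by linarith
  have hm : m * (b - a) = I := by simp only [m]; field_simp
  nlinarith [mul_nonneg hb.le h]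

lemma path_energy (O : Set ℂ) (hO : IsOpen O) (Y : ℂ → ℂ) (hd : DifferentiableOn ℂ Y O) (θ : ℝ)
    (hθ : ∀ t : ℝ, (⟨t, θ⟩ : ℂ) ∈ O) (hfin : ∫⁻ t : ℝ, ENNReal.ofReal (spd Y ⟨t, θ⟩ ^ 2) ≠ ⊤) (a b : ℝ) :
    sphDist (Y ⟨a, θ⟩) (Y ⟨b, θ⟩) ^ 2 ≤ |b - a| * (∫⁻ t : ℝ, ENNReal.ofReal (spd Y ⟨t, θ⟩ ^ 2)).toReal := by
  wlog hab : a ≤ b generalizing a b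
  · have := this b a (le_of_not_ge hab)
    rwa [sph_comm, abs_sub_comm] at this
  rcases hab.eq_or_lt with rfl | hlt
  · simp [sph_self]
  have hline : ∀ t : ℝ, HasDerivAt (fun t : ℝ => (⟨t, θ⟩ : ℂ)) 1 t := by
    intro t
    have : (fun t : ℝ => (⟨t, θ⟩ : ℂ)) = fun t : ℝ => (t : ℂ) + θ * Complex.I := by
      funext t; apply Complex.ext <;> simp
    rw [this]
    simpa using (Complex.ofRealCLM.hasDerivAt (x := t)).add_const (θ * Complex.I)
  have hlc : Continuous (fun t : ℝ => (⟨t, θ⟩ : ℂ)) := continuous_iff_continuousAt.2 fun t => (hline t).continuousAt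
  have hy : ∀ t : ℝ, HasDerivAt (fun t : ℝ => Y ⟨t, θ⟩) (deriv Y ⟨t, θ⟩) t := by
    intro t
    have h1 := (hd.differentiableAt (hO.mem_nhds (hθ t))).hasDerivAt
    have := h1.scomp (𝕜 := ℝ) t (hline t)
    simp only [one_smul] at this
    exact this
  have hv : Continuous fun t : ℝ => deriv Y ⟨t, θ⟩ :=
    (hd.deriv hO).continuousOn.comp_continuous hlc hθ
  have hyc : Continuous (fun t : ℝ => Y ⟨t, θ⟩) := hd.continuousOn.comp_continuous hlc hθ
  have hs : Continuous fun t : ℝ => spd Y ⟨t, θ⟩ := by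
    unfold spd
    exact Continuous.div (hv.norm.const_mul 2) (continuous_const.add (hyc.norm.pow 2)) fun t => by positivity
  have h1 := path_len _ _ a b hab hy hv
  have h2 : ∫ t in a..b, spd Y ⟨t, θ⟩ ^ 2 ≤ (∫⁻ t : ℝ, ENNReal.ofReal (spd Y ⟨t, θ⟩ ^ 2)).toReal := by
    rw [intervalIntegral.integral_of_le hab, integral_eq_lintegral_of_nonneg_ae]
    · exact ENNReal.toReal_mono hfin (setLIntegral_le_lintegral _ _)
    · exact Eventually.of_forall fun t => sq_nonneg _
    · exact (hs.pow 2).aestronglyMeasurable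
  have h3 := cs_int _ hs a b hlt
  rw [abs_of_nonneg (by linarith)]
  calc _ ≤ (∫ t in a..b, spd Y ⟨t, θ⟩) ^ 2 := by
        apply pow_le_pow_left₀ (sph_nonneg _ _) h1
    _ ≤ _ := h3.trans (mul_le_mul_of_nonneg_left h2 (by linarith))

def ptS (u : WithLp 2 (ℂ × ℂ)) : Sphere := if u.snd = 0 then OnePoint.infty else ((u.fst / u.snd : ℂ) : Sphere)

lemma nn_sq (u : WithLp 2 (ℂ × ℂ)) : ‖u‖ ^ 2 = ‖u.fst‖ ^ 2 + ‖u.snd‖ ^ 2 := by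
  rw [WithLp.prod_norm_eq_of_L2, Real.sq_sqrt (by positivity)]

lemma nn_div (u : WithLp 2 (ℂ × ℂ)) (h : u.snd ≠ 0) : Real.sqrt (1 + ‖u.fst / u.snd‖ ^ 2) * ‖u.snd‖ = ‖u‖ := by
  have h' : 0 < ‖u.snd‖ := norm_pos_iff.2 h
  rw [← abs_of_nonneg (norm_nonneg u), ← Real.sqrt_sq_eq_abs, nn_sq]
  rw [← Real.sqrt_sq h'.le, ← Real.sqrt_mul (by positivity), Real.sqrt_sq h'.le]
  congr 1
  rw [norm_div]
  field_simp
  ring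

lemma pt_dist (u v : WithLp 2 (ℂ × ℂ)) (hu : u ≠ 0) (hv : v ≠ 0) :
    sphDist (ptS u) (ptS v) * (‖u‖ * ‖v‖) = 2 * ‖u.fst * v.snd - u.snd * v.fst‖ := by
  have inf : ∀ w : WithLp 2 (ℂ × ℂ), w.snd = 0 → ‖w‖ = ‖w.fst‖ := by
    intro w hw
    have := nn_sq w
    rw [hw] at this
    simp only [norm_zero] at this
    have h2 : ‖w‖ ^ 2 = ‖w.fst‖ ^ 2 := by linarith
    exact (pow_left_inj₀ (norm_nonneg _) (norm_nonneg _) two_ne_zero).1 h2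
  unfold ptS
  by_cases h1 : u.snd = 0 <;> by_cases h2 : v.snd = 0
  · simp [h1, h2, sph_self]
  · rw [if_pos h1, if_neg h2, sph_ic, inf u h1, ← nn_div v h2, h1]
    have : 0 < Real.sqrt (1 + ‖v.fst / v.snd‖ ^ 2) := by positivity
    rw [zero_mul, sub_zero, norm_mul]
    field_simp
  · rw [if_neg h1, if_pos h2, sph_ci, inf v h2, ← nn_div u h1, h2]
    have : 0 < Real.sqrt (1 + ‖u.fst / u.snd‖ ^ 2) := by positivity
    rw [mul_zero, zero_sub, norm_neg, norm_mul]
    field_simp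
  · rw [if_neg h1, if_neg h2, sph_cc, ← nn_div v h2, ← nn_div u h1]
    have : 0 < Real.sqrt (1 + ‖u.fst / u.snd‖ ^ 2) := by positivity
    have : 0 < Real.sqrt (1 + ‖v.fst / v.snd‖ ^ 2) := by positivity
    have e : u.fst * v.snd - u.snd * v.fst = (u.fst / u.snd - v.fst / v.snd) * (u.snd * v.snd) := by
      field_simp
    rw [e, norm_mul, norm_mul, dist_eq_norm]
    field_simp

lemma pt_surj (z : Sphere) : ∃ u : WithLp 2 (ℂ × ℂ), ‖u‖ = 1 ∧ ptS u = z := by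
  have : ∃ u : WithLp 2 (ℂ × ℂ), u ≠ 0 ∧ ptS u = z := by
    induction z using OnePoint.rec with
    | infty =>
      refine ⟨WithLp.toLp 2 (1, 0), ?_, by simp [ptS]⟩
      intro h
      have := congrArg WithLp.fst h
      simp at this
    | coe a =>
      refine ⟨WithLp.toLp 2 (a, 1), ?_, by simp [ptS]⟩
      intro h
      have := congrArg WithLp.snd h
      simp at this
  obtain ⟨u, hu, rfl⟩ := this
  have hn : (‖u‖ : ℂ) ≠ 0 := by exact_mod_cast norm_ne_zero_iff.2 hu
  refine ⟨((‖u‖ : ℂ))⁻¹ • u, ?_, ?_⟩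
  · rw [norm_smul]; simp; field_simp
  · unfold ptS
    simp only [WithLp.smul_snd, WithLp.smul_fst, smul_eq_mul, mul_eq_zero, inv_eq_zero, hn, false_or]
    split_ifs with h
    · rfl
    · congr 1; field_simp

lemma phi_exists (z z' : Sphere) (hne : z ≠ z') (B : Set Sphere) (hB : B.Finite) (hi : OnePoint.infty ∈ B) :
    ∃ Θ : Set ℝ, IsOpen Θ ∧ 1 ≤ volume Θ ∧ volume Θ ≠ ⊤ ∧ ∃ Φ : ℂ → ℂ,
      DifferentiableOn ℂ Φ {ζ | ζ.im ∈ Θ} ∧ Set.InjOn Φ {ζ | ζ.im ∈ Θ} ∧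
      (∀ ζ : ℂ, ζ.im ∈ Θ → (Φ ζ : Sphere) ∉ B) ∧
      (∀ ζ : ℂ, ζ.im ∈ Θ → ζ.re ≤ -1 → sphDist (Φ ζ) z ≤ 4 * Real.exp ζ.re) ∧
      (∀ ζ : ℂ, ζ.im ∈ Θ → 1 ≤ ζ.re → sphDist (Φ ζ) z' ≤ 4 * Real.exp (-ζ.re)) := by
  obtain ⟨Z, hZ, rfl⟩ := pt_surj z
  obtain ⟨Z', hZ', rfl⟩ := pt_surj z'
  have hZ0 : Z ≠ 0 := by rintro rfl; simp at hZ
  have hZ0' : Z' ≠ 0 := by rintro rfl; simp at hZ'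
  have hcr := pt_dist Z Z' hZ0 hZ0'
  rw [hZ, hZ', mul_one, mul_one] at hcr
  set D := Z.fst * Z'.snd - Z.snd * Z'.fst with hD
  have hDne : D ≠ 0 := by
    intro h
    rw [h] at hcr
    simp at hcr
    exact hne (sph_eq_zero.1 hcr)
  have hD1 : ‖D‖ ≤ 1 := by linarith [sph_le_two (ptS Z) (ptS Z')]
  let u : ℂ → WithLp 2 (ℂ × ℂ) := fun s => Z + s • Z'
  have huf : ∀ s, (u s).fst = Z.fst + s * Z'.fst := fun s => by simp [u]
  have hus : ∀ s, (u s).snd = Z.snd + s * Z'.snd := fun s => by simp [u]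
  have hcross : ∀ s s', (u s).fst * (u s').snd - (u s).snd * (u s').fst = (s' - s) * D := by
    intro s s'; rw [huf, hus, huf, hus, hD]; ring
  have hu0 : ∀ s, u s ≠ 0 := by
    intro s h
    have := hcross s (s + 1)
    rw [h] at this
    simp at this
    exact hDne this.symm
  have hptinj : ∀ s s', ptS (u s) = ptS (u s') → s = s' := by
    intro s s' h
    have := pt_dist (u s) (u s') (hu0 s) (hu0 s')
    rw [h, sph_self, hcross, zero_mul, norm_mul] at this
    have h2 : ‖s' - s‖ = 0 := by
      rcases mul_eq_zero.1 (by linarith : ‖s' - s‖ * ‖D‖ = 0) with h | h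
      · exact h
      · exact absurd (norm_eq_zero.1 h) hDne
    exact (sub_eq_zero.1 (norm_eq_zero.1 h2)).symm
  have hexp : ∀ ζ ζ' : ℂ, ζ.im ∈ Set.Ioo 0 (2 * Real.pi) → ζ'.im ∈ Set.Ioo 0 (2 * Real.pi) →
      Complex.exp ζ = Complex.exp ζ' → ζ = ζ' := by
    intro ζ ζ' h h' he
    have : ζ - Real.pi * Complex.I = ζ' - Real.pi * Complex.I := by
      apply Complex.exp_inj_of_neg_pi_lt_of_le_pi
      · simp; linarith [h.1]
      · simp; linarith [h.2]
      · simp; linarith [h'.1]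
      · simp; linarith [h'.2]
      · rw [Complex.exp_sub, Complex.exp_sub, he]
    simpa using this
  let S : Set ℂ := {ζ | ζ.im ∈ Set.Ioo 0 (2 * Real.pi) ∧ ptS (u (Complex.exp ζ)) ∈ B}
  have hS : S.Finite := by
    apply Set.Finite.of_injOn (f := fun ζ => ptS (u (Complex.exp ζ))) (t := B) _ _ hB
    · intro ζ h; exact h.2
    · intro ζ h ζ' h' he
      exact hexp _ _ h.1 h'.1 (hptinj _ _ he)
  let Θ : Set ℝ := Set.Ioo 0 (2 * Real.pi) \ (Complex.im '' S)
  have hnb : ∀ ζ : ℂ, ζ.im ∈ Θ → ptS (u (Complex.exp ζ)) ∉ B := by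
    intro ζ h hb
    exact h.2 ⟨ζ, ⟨h.1, hb⟩, rfl⟩
  have hs0 : ∀ ζ : ℂ, ζ.im ∈ Θ → (u (Complex.exp ζ)).snd ≠ 0 := by
    intro ζ h h0
    apply hnb ζ h
    rw [ptS, if_pos h0]; exact hi
  have hvol : volume Θ = ENNReal.ofReal (2 * Real.pi) := by
    have : volume (Complex.im '' S) = 0 := (hS.image _).measure_zero _
    rw [measure_sdiff_null this, Real.volume_Ioo, sub_zero]
  have hnu : ∀ s, |1 - ‖s‖| ≤ ‖u s‖ := by
    intro s
    have h1 := abs_norm_sub_norm_le Z (-(s • Z'))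
    rw [sub_neg_eq_add, norm_neg, norm_smul, hZ, hZ', mul_one] at h1
    exact h1
  have hpt : ∀ ζ : ℂ, ζ.im ∈ Θ → (((u (Complex.exp ζ)).fst / (u (Complex.exp ζ)).snd : ℂ) : Sphere) = ptS (u (Complex.exp ζ)) := by
    intro ζ h
    rw [ptS, if_neg (hs0 ζ h)]
  refine ⟨Θ, isOpen_Ioo.sdiff (hS.image _).isClosed, ?_, ?_, fun ζ => (u (Complex.exp ζ)).fst / (u (Complex.exp ζ)).snd, ?_, ?_, ?_, ?_, ?_⟩
  · rw [hvol, ← ENNReal.ofReal_one]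
    apply ENNReal.ofReal_le_ofReal
    linarith [Real.pi_gt_three]
  · rw [hvol]; exact ENNReal.ofReal_ne_top
  · intro ζ h
    have := hs0 ζ h
    simp only [huf, hus] at this ⊢
    apply DifferentiableAt.differentiableWithinAt
    exact DifferentiableAt.div (by fun_prop) (by fun_prop) this
  · intro ζ h ζ' h' he
    apply hexp _ _ h.1 h'.1
    apply hptinj
    rw [← hpt ζ h, ← hpt ζ' h']
    exact congrArg _ he
  · intro ζ h
    rw [hpt ζ h]; exact hnb ζ h
  · intro ζ h hr
    rw [hpt ζ h]
    have h1 := pt_dist (u (Complex.exp ζ)) Z (hu0 _) hZ0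
    have e : (u (Complex.exp ζ)).fst * Z.snd - (u (Complex.exp ζ)).snd * Z.fst = - (Complex.exp ζ * D) := by
      rw [huf, hus, hD]; ring
    rw [e, hZ, mul_one, norm_neg, norm_mul, Complex.norm_exp] at h1
    have h2 := hnu (Complex.exp ζ)
    rw [Complex.norm_exp] at h2
    have h3 : Real.exp ζ.re ≤ 1 / 2 := by
      have h4 : Real.exp ζ.re ≤ Real.exp (-1) := Real.exp_le_exp.2 hr
      have h5 : (2:ℝ) ≤ Real.exp 1 := by linarith [Real.add_one_le_exp 1]
      rw [Real.exp_neg] at h4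
      refine h4.trans ?_
      rw [one_div]; exact inv_anti₀ (by norm_num) h5
    have h4 : 1 / 2 ≤ ‖u (Complex.exp ζ)‖ := by
      refine le_trans ?_ h2
      rw [abs_of_nonneg (by linarith)]; linarith
    have h5 := sph_nonneg (ptS (u (Complex.exp ζ))) (ptS Z)
    have h6 : 0 < Real.exp ζ.re := Real.exp_pos _
    nlinarith [mul_le_mul_of_nonneg_left h4 h5, mul_le_mul_of_nonneg_left hD1 h6.le]
  · intro ζ h hr
    rw [hpt ζ h]
    have h1 := pt_dist (u (Complex.exp ζ)) Z' (hu0 _) hZ0'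
    have e : (u (Complex.exp ζ)).fst * Z'.snd - (u (Complex.exp ζ)).snd * Z'.fst = D := by
      rw [huf, hus, hD]; ring
    rw [e, hZ', mul_one] at h1
    have h2 := hnu (Complex.exp ζ)
    rw [Complex.norm_exp] at h2
    have h3 : 2 ≤ Real.exp ζ.re := by linarith [Real.add_one_le_exp ζ.re]
    have h4 : Real.exp ζ.re / 2 ≤ ‖u (Complex.exp ζ)‖ := by
      refine le_trans ?_ h2
      rw [abs_of_nonpos (by linarith)]; linarith
    have h5 := sph_nonneg (ptS (u (Complex.exp ζ))) (ptS Z')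
    rw [Real.exp_neg, ← div_eq_mul_inv, le_div_iff₀ (by linarith)]
    nlinarith [mul_le_mul_of_nonneg_left h4 h5]

lemma tree_energy {N : ℕ} {p q : Fin N → ℂ[X]} (hg : Good p q) : ∃ C1 : ℝ, 0 ≤ C1 ∧ ∀ (n : ℕ) (z z' : Sphere), z ≠ z' →
    ∃ (Y : List (IX p q) → ℝ → Sphere) (E : List (IX p q) → ℝ),
      (∀ t ≤ -1, sphDist (Y [] t) z ≤ 4 * Real.exp t) ∧
      (∀ t, 1 ≤ t → sphDist (Y [] t) z' ≤ 4 * Real.exp (-t)) ∧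
      (∀ l, l.length < n → ∀ i t, Finset.univ.val.map (fun j => Y (⟨i, j⟩ :: l) t) = fiber (p i) (q i) (Y l t)) ∧
      (∀ l, l.length ≤ n → 0 ≤ E l ∧ ∀ a b, sphDist (Y l a) (Y l b) ^ 2 ≤ |b - a| * E l) ∧
      (∀ k ≤ n, ∑ l ∈ lev (IX p q) k, E l ≤ C1 * (n + 1) * N ^ k) := by
  obtain ⟨C, hC0, hC⟩ := rhoS_int
  refine ⟨C, hC0, fun n z z' hne => ?_⟩
  obtain ⟨Θ, hΘ, hv, hv', Φ, hΦd, hΦi, hΦb, hΦz, hΦz'⟩ := phi_exists z z' hne (Bad p q n) (bad_finite p q n) (bad_infty p q n)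
  obtain ⟨Y, hY0, hYd, hY2⟩ := tree_lift hg n Θ hΘ Φ hΦd hΦb
  have hO : IsOpen {ζ : ℂ | ζ.im ∈ Θ} := hΘ.preimage Complex.continuous_im
  have harea := area_sum hg n _ hO Y (by rw [hY0]; exact hΦi) hYd hY2
  have hN : (N : ℝ≥0∞) ≠ 0 := by
    have := hg.1
    exact_mod_cast (by omega : N ≠ 0)
  have hNk : ∀ k, (N : ℝ≥0∞) ^ k ≠ 0 := fun k => pow_ne_zero _ hN
  have hNk' : ∀ k, (N : ℝ≥0∞) ^ k ≠ ⊤ := fun k => ENNReal.pow_ne_top (ENNReal.natCast_ne_top N)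
  have hm : ∀ l : List (IX p q), l.length ≤ n → AEMeasurable (fun ζ => ENNReal.ofReal (spd (Y l) ζ ^ 2)) (volume.restrict {ζ : ℂ | ζ.im ∈ Θ}) := by
    intro l hl
    apply ContinuousOn.aemeasurable _ hO.measurableSet
    apply ENNReal.continuous_ofReal.comp_continuousOn
    apply ContinuousOn.pow
    unfold spd
    refine ContinuousOn.div ?_ ?_ fun ζ _ => by positivity
    · exact continuousOn_const.mul (((hYd l hl).deriv hO).continuousOn.norm)
    · exact continuousOn_const.add ((hYd l hl).continuousOn.norm.pow 2)
  have hmk : ∀ k ∈ Finset.range (n+1), AEMeasurable (fun ζ => ((N : ℝ≥0∞)^k)⁻¹ * ∑ l ∈ lev (IX p q) k, ENNReal.ofReal (spd (Y l) ζ ^ 2)) (volume.restrict {ζ : ℂ | ζ.im ∈ Θ}) := by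
    intro k hk
    refine AEMeasurable.const_mul (Finset.aemeasurable_fun_sum _ fun l hl => hm l ?_) _
    rw [mem_lev] at hl
    rw [Finset.mem_range] at hk
    omega
  obtain ⟨θ, hθ, hle⟩ := slice Θ hΘ.measurableSet hv hv'
    (fun ζ => ∑ k ∈ Finset.range (n+1), ((N : ℝ≥0∞)^k)⁻¹ * ∑ l ∈ lev (IX p q) k, ENNReal.ofReal (spd (Y l) ζ ^ 2))
    (ENNReal.ofReal (C * (n + 1))) (Finset.aemeasurable_fun_sum _ hmk) (by
      rw [lintegral_finsetSum' _ hmk]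
      calc _ ≤ ∑ k ∈ Finset.range (n+1), ENNReal.ofReal C := by
            apply Finset.sum_le_sum
            intro k hk
            rw [Finset.mem_range] at hk
            rw [lintegral_const_mul' _ _ (ENNReal.inv_ne_top.2 (hNk k)), lintegral_finsetSum' _ (fun l hl => hm l (by rw [mem_lev] at hl; omega))]
            calc _ ≤ ((N : ℝ≥0∞)^k)⁻¹ * (N ^ k * ∫⁻ y : ℂ, rhoS y) := by gcongr; exact harea k (by omega)
              _ = ∫⁻ y : ℂ, rhoS y := by rw [← mul_assoc, ENNReal.inv_mul_cancel (hNk k) (hNk' k), one_mul]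
              _ ≤ _ := hC
        _ = _ := by
            rw [Finset.sum_const, Finset.card_range, nsmul_eq_mul, mul_comm, ENNReal.ofReal_mul hC0]
            congr 1
            rw [ENNReal.ofReal_add (by positivity) zero_le_one]; simp)
  -- measurability on the line
  have hlc : Continuous (fun t : ℝ => (⟨t, θ⟩ : ℂ)) := by
    have : (fun t : ℝ => (⟨t, θ⟩ : ℂ)) = fun t : ℝ => (t : ℂ) + θ * Complex.I := by
      funext t; apply Complex.ext <;> simp
    rw [this]; fun_prop
  have hml : ∀ l : List (IX p q), l.length ≤ n → Measurable (fun t : ℝ => ENNReal.ofReal (spd (Y l) ⟨t, θ⟩ ^ 2)) := by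
    intro l hl
    apply Continuous.measurable
    apply ENNReal.continuous_ofReal.comp
    apply Continuous.pow
    unfold spd
    refine Continuous.div ?_ ?_ fun ζ => by positivity
    · exact continuous_const.mul (((hYd l hl).deriv hO).continuousOn.comp_continuous hlc fun t => hθ).norm
    · exact continuous_const.add (((hYd l hl).continuousOn.comp_continuous hlc fun t => hθ).norm.pow 2)
  have hsum : ∀ k ≤ n, ∑ l ∈ lev (IX p q) k, ∫⁻ t : ℝ, ENNReal.ofReal (spd (Y l) ⟨t, θ⟩ ^ 2) ≤ ENNReal.ofReal (C * (n + 1) * N ^ k) := by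
    intro k hk
    have h1 : ∫⁻ t : ℝ, ((N : ℝ≥0∞)^k)⁻¹ * ∑ l ∈ lev (IX p q) k, ENNReal.ofReal (spd (Y l) ⟨t, θ⟩ ^ 2) ≤ ENNReal.ofReal (C * (n + 1)) := by
      refine le_trans (lintegral_mono fun t => ?_) hle
      exact Finset.single_le_sum (f := fun k => ((N : ℝ≥0∞)^k)⁻¹ * ∑ l ∈ lev (IX p q) k, ENNReal.ofReal (spd (Y l) ⟨t, θ⟩ ^ 2)) (fun _ _ => zero_le) (Finset.mem_range.2 (by omega))
    rw [lintegral_const_mul' _ _ (ENNReal.inv_ne_top.2 (hNk k)), lintegral_finsetSum _ (fun l hl => hml l (by rw [mem_lev] at hl; omega))] at h1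
    calc _ = (N : ℝ≥0∞)^k * (((N : ℝ≥0∞)^k)⁻¹ * ∑ l ∈ lev (IX p q) k, ∫⁻ t : ℝ, ENNReal.ofReal (spd (Y l) ⟨t, θ⟩ ^ 2)) := by
          rw [← mul_assoc, ENNReal.mul_inv_cancel (hNk k) (hNk' k), one_mul]
      _ ≤ (N : ℝ≥0∞)^k * ENNReal.ofReal (C * (n + 1)) := by gcongr
      _ = _ := by
          rw [mul_comm, ENNReal.ofReal_mul (p := C * (n + 1)) (by positivity), ENNReal.ofReal_pow (by positivity), ENNReal.ofReal_natCast]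
  have hfin : ∀ l : List (IX p q), l.length ≤ n → ∫⁻ t : ℝ, ENNReal.ofReal (spd (Y l) ⟨t, θ⟩ ^ 2) ≠ ⊤ := by
    intro l hl
    refine ne_top_of_le_ne_top ENNReal.ofReal_ne_top (le_trans ?_ (hsum _ hl))
    exact Finset.single_le_sum (f := fun l => ∫⁻ t : ℝ, ENNReal.ofReal (spd (Y l) ⟨t, θ⟩ ^ 2)) (fun _ _ => zero_le) ((mem_lev _ _).2 rfl)
  refine ⟨fun l t => (Y l ⟨t, θ⟩ : Sphere), fun l => (∫⁻ t : ℝ, ENNReal.ofReal (spd (Y l) ⟨t, θ⟩ ^ 2)).toReal, ?_, ?_, ?_, ?_, ?_⟩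
  · intro t ht; show sphDist (Y [] ⟨t, θ⟩ : Sphere) z ≤ _; rw [hY0]; exact hΦz ⟨t, θ⟩ hθ ht
  · intro t ht; show sphDist (Y [] ⟨t, θ⟩ : Sphere) z' ≤ _; rw [hY0]; exact hΦz' ⟨t, θ⟩ hθ ht
  · intro l hl i t; exact (hY2 l hl i ⟨t, θ⟩ hθ).1
  · intro l hl
    exact ⟨ENNReal.toReal_nonneg, fun a b => path_energy _ hO (Y l) (hYd l hl) θ (fun t => hθ) (hfin l hl) a b⟩
  · intro k hk
    rw [← ENNReal.toReal_sum (fun l hl => hfin l (by rw [mem_lev] at hl; omega))]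
    exact ENNReal.toReal_le_of_le_ofReal (by positivity) (hsum k hk)

lemma end_tree {N : ℕ} {p q : Fin N → ℂ[X]} (hg : Good p q) (n : ℕ) (z : Sphere) (Y : List (IX p q) → ℝ → Sphere)
    (U : Ultrafilter ℝ) (h0 : Tendsto (Y []) U (𝓝 z))
    (hf : ∀ l, l.length < n → ∀ i t, Finset.univ.val.map (fun j => Y (⟨i, j⟩ :: l) t) = fiber (p i) (q i) (Y l t)) :
    ∃ y, IsTree p q z y ∧ ∀ l, l.length ≤ n → Tendsto (Y l) U (𝓝 (y l)) := by
  have hlim : ∀ l, ∃ v, Tendsto (Y l) U (𝓝 v) := by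
    intro l
    obtain ⟨v, -, hv⟩ := isCompact_univ.ultrafilter_le_nhds (U.map (Y l)) (by simp)
    exact ⟨v, hv⟩
  choose y0 hy0 using hlim
  have hroot : y0 [] = z := tendsto_nhds_unique (hy0 []) h0
  choose tr htr using exists_tree p q
  refine ⟨fun l => tr (y0 (l.drop (l.length - n))) (l.take (l.length - n)), ⟨?_, ?_⟩, ?_⟩
  · simp [(htr _).1, hroot]
  · intro l i
    by_cases hl : l.length < n
    · have e1 : l.length - n = 0 := by omega
      have e2 : l.length + 1 - n = 0 := by omega
      simp only [List.length_cons, e1, e2, List.drop_zero, List.take_zero, (htr _).1]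
      exact fiber_lim _ _ (hg.cop _) (hg.deg _) (U : Filter ℝ) (fun t j => Y (⟨i, j⟩ :: l) t) (Y l) _ _
        (Eventually.of_forall fun t => hf l hl i t) (hy0 l) (fun j => hy0 _)
    · have e2 : l.length + 1 - n = (l.length - n) + 1 := by omega
      simp only [List.length_cons, e2, List.drop_succ_cons, List.take_succ_cons]
      exact (htr _).2 _ _
  · intro l hl
    have e1 : l.length - n = 0 := by omega
    simp only [e1, List.drop_zero, List.take_zero, (htr _).1]
    exact hy0 l

lemma far_level (d : ℕ) (S : ℝ) (hS : 0 < S) (s : Multiset ℝ) (hs : s.card ≤ d) :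
    ∃ r, 0 < r ∧ r ≤ S ∧ ∀ v ∈ s, S / (2 * (d + 1)) ≤ |r - v| := by
  by_contra! H
  have hd : (0 : ℝ) < d + 1 := by positivity
  have H2 : ∀ j : Fin (d + 1), ∃ v ∈ s, |((j : ℕ) + 1) * S / (d + 1) - v| < S / (2 * (d + 1)) := by
    intro j
    refine H _ (by positivity) ?_
    rw [div_le_iff₀ hd, mul_comm]
    have : ((j : ℕ) : ℝ) + 1 ≤ d + 1 := by exact_mod_cast j.2
    gcongr
  choose v hv hvd using H2
  have hinj : Function.Injective v := by
    intro j k hjk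
    by_contra hne
    have h1 := hvd j
    have h2 := hvd k
    rw [← hjk] at h2
    have h3 : |((j : ℕ) + 1) * S / (d + 1) - ((k : ℕ) + 1) * S / (d + 1)| < S / (d + 1) := by
      calc _ = |(((j : ℕ) + 1) * S / (d + 1) - v j) - (((k : ℕ) + 1) * S / (d + 1) - v j)| := by congr 1; ring
        _ ≤ _ := abs_sub _ _
        _ < S / (2 * (d + 1)) + S / (2 * (d + 1)) := add_lt_add h1 h2
        _ = _ := by field_simp; norm_num
    have h4 : ((j : ℕ) + 1) * S / (d + 1) - ((k : ℕ) + 1) * S / (d + 1) = (((j : ℕ) : ℝ) - (k : ℕ)) * (S / (d + 1)) := by ring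
    rw [h4, abs_mul, abs_of_pos (by positivity : 0 < S / ((d : ℝ) + 1))] at h3
    have h5 : |((j : ℕ) : ℝ) - (k : ℕ)| < 1 := by
      by_contra! h; nlinarith [show 0 < S / ((d : ℝ) + 1) by positivity]
    have h6 : |((j : ℕ) : ℤ) - (k : ℕ)| < 1 := by exact_mod_cast h5
    rw [Int.abs_lt_one_iff] at h6
    exact hne (Fin.ext (by omega))
  have := Finset.card_le_card_of_injOn v (s := Finset.univ) (t := s.toFinset) (fun j _ => by simpa using hv j) hinj.injOn
  have h2 := Multiset.toFinset_card_le s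
  simp at this
  omega

lemma step_crude (P Q : ℂ[X]) (A : ℝ) (b : Sphere) (hk : ∀ y, sprod y (fiber P Q b) ≤ A * sphDist (ratEval P Q y) b)
    (η : ℝ → Sphere) (hη : Continuous η) (U : Ultrafilter ℝ) (hU : (U : Filter ℝ) ≤ atBot) (y : Sphere)
    (hy : Tendsto η U (𝓝 y)) (T β : ℝ) (hA : 0 ≤ A) (hβ0 : 0 ≤ β) (hβ : ∀ t ≤ T, sphDist (ratEval P Q (η t)) b ≤ β) (t : ℝ) (ht : t ≤ T) :
    (sphDist (η t) y / (2 * (max P.natDegree Q.natDegree + 1 : ℕ))) ^ (max P.natDegree Q.natDegree) ≤ A * β ∨ sphDist (η t) y = 0 := by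
  rcases (sph_nonneg (η t) y).eq_or_lt with h0 | h0
  · exact Or.inr h0.symm
  left
  obtain ⟨r, hr0, hrS, hr⟩ := far_level (max P.natDegree Q.natDegree) _ h0 ((fiber P Q b).map (fun ζ => sphDist y ζ))
    (by rw [Multiset.card_map, fiber_card])
  have hg0 := sph_tendsto.1 hy
  obtain ⟨t', ht', ht''⟩ : ∃ t' ≤ t, sphDist (η t') y ≤ r := by
    have e1 : ∀ᶠ t' in (U : Filter ℝ), sphDist (η t') y ≤ r := (hg0.eventually (gt_mem_nhds hr0)).mono fun _ h => le_of_lt h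
    have e2 : ∀ᶠ t' in (U : Filter ℝ), t' ≤ t := hU (eventually_le_atBot t)
    obtain ⟨t', h⟩ := (e2.and e1).exists
    exact ⟨t', h⟩
  have hc : Continuous (fun t => sphDist (η t) y) := sph_cont.comp (hη.prodMk continuous_const)
  obtain ⟨t2, ht2, ht2'⟩ := intermediate_value_Icc ht' hc.continuousOn ⟨ht'', hrS⟩
  have h1 := hk (η t2)
  have h2 := hβ t2 (ht2.2.trans ht)
  have h3 := sprod_ge (η t2) (fiber P Q b) (sphDist (η t) y / (2 * (max P.natDegree Q.natDegree + 1 : ℕ))) (by positivity) (by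
    intro ζ hζ
    have h4 := hr _ (Multiset.mem_map_of_mem _ hζ)
    push_cast at h4 ⊢
    refine h4.trans ?_
    rw [← ht2']
    have a1 := sph_tri (η t2) ζ y
    have a2 := sph_tri y (η t2) ζ
    rw [sph_comm ζ y] at a1
    rw [sph_comm y (η t2)] at a2
    have a3 := sph_tri (η t2) y ζ
    rw [abs_le]
    constructor <;> linarith)
  rw [fiber_card] at h3
  exact h3.trans (h1.trans (by gcongr))

lemma step_fine (P Q : ℂ[X]) (A : ℝ) (hA : 0 ≤ A) (b : Sphere) (η y : Sphere) (hk : sprod η (fiber P Q b) ≤ A * sphDist (ratEval P Q η) b)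
    (hy : y ∈ fiber P Q b) (β s : ℝ) (hs : 0 < s) (hβ : sphDist (ratEval P Q η) b ≤ β)
    (hn : ∀ ζ ∈ (fiber P Q b).erase y, s ≤ sphDist y ζ) (hg : sphDist η y ≤ s / 2) :
    sphDist η y * (s / 2) ^ (max P.natDegree Q.natDegree - 1) ≤ A * β := by
  have h3 := sprod_ge η ((fiber P Q b).erase y) (s / 2) (by positivity) (by
    intro ζ hζ
    have h4 := hn ζ hζ
    have a2 := sph_tri y η ζ
    rw [sph_comm y η] at a2
    linarith)
  rw [Multiset.card_erase_of_mem hy, fiber_card] at h3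
  rw [sprod_erase _ y _ hy] at hk
  have := sph_nonneg η y
  calc _ ≤ sphDist η y * sprod η ((fiber P Q b).erase y) := by gcongr; exact h3
    _ ≤ _ := hk
    _ ≤ _ := by gcongr

lemma degR_le_Dtot {N : ℕ} (p q : Fin N → ℂ[X]) (i : Fin N) : degR p q i ≤ Dtot p q :=
  Finset.single_le_sum (f := fun i => degR p q i) (fun _ _ => Nat.zero_le _) (Finset.mem_univ i)

lemma step_exp {N : ℕ} {p q : Fin N → ℂ[X]} (hg : Good p q) (s : ℝ) (hs : 0 < s) :
    ∃ c : ℝ, 0 ≤ c ∧ ∀ (i : Fin N) (b : Sphere) (η : ℝ → Sphere) (U : Ultrafilter ℝ) (y : Sphere) (lam T : ℝ),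
      Continuous η → (U : Filter ℝ) ≤ atBot → Tendsto η U (𝓝 y) → c ≤ lam → y ∈ fiber (p i) (q i) b →
      (∀ t ≤ T, sphDist (ratEval (p i) (q i) (η t)) b ≤ Real.exp (-lam)) → ∀ t ≤ T,
      sphDist (η t) y ≤ Real.exp (-(lam / Dtot p q - c)) ∧
      ((∀ ζ ∈ (fiber (p i) (q i) b).erase y, s ≤ sphDist y ζ) → sphDist (η t) y ≤ Real.exp (-(lam - c))) := by
  have hkey := fun i => key (p i) (q i) (hg.cop i) (hg.deg i)
  choose A0 hA0 hk using hkey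
  set A := ∑ i, A0 i with hAdef
  have hAi : ∀ i, A0 i ≤ A := fun i => Finset.single_le_sum (f := A0) (fun j _ => by linarith [hA0 j]) (Finset.mem_univ i)
  have hA1 : 1 ≤ A := (hA0 ⟨0, hg.1⟩).trans (hAi _)
  have hD1 : 1 ≤ Dtot p q := (hg.deg ⟨0, hg.1⟩).trans (degR_le_Dtot p q _)
  have hD1' : (1 : ℝ) ≤ Dtot p q := by exact_mod_cast hD1
  set D : ℝ := ((Dtot p q : ℕ) : ℝ) with hD
  set s' := min s 1 with hs'
  have hs0 : 0 < s' := lt_min hs one_pos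
  have hs1 : s' ≤ 1 := min_le_right _ _
  set c1 := Real.log (2 * (D + 1) * A) with hc1
  set c2 := Real.log (2 / s') with hc2
  have hA2 : 1 ≤ 2 * (D + 1) * A := by nlinarith
  have hc1n : 0 ≤ c1 := Real.log_nonneg hA2
  have hs2 : 1 ≤ 2 / s' := by rw [le_div_iff₀ hs0]; linarith
  have hc2n : 0 ≤ c2 := Real.log_nonneg hs2
  have hc3 : 0 ≤ Real.log A := Real.log_nonneg hA1
  have m1 : 0 ≤ D * (c1 + c2) := by positivity
  have m2 : 0 ≤ D * c2 := by positivity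
  refine ⟨c1 + D * (c1 + c2) + Real.log A + D * c2, by positivity, ?_⟩
  intro i b η U y lam T hη hU hy hlam hyb hβ t ht
  have hcr : sphDist (η t) y ≤ Real.exp (-(lam / D - c1)) := by
    rcases step_crude (p i) (q i) A b (fun y => (hk i y b).1.trans (by gcongr; exacts [sph_nonneg _ _, hAi i])) η hη U hU y hy T _ (by linarith) (Real.exp_pos _).le hβ t ht with h | h
    · set d := max (p i).natDegree (q i).natDegree with hd
      have hdD : d ≤ Dtot p q := degR_le_Dtot p q i
      set v := sphDist (η t) y / (2 * ((d + 1 : ℕ) : ℝ)) with hv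
      have hv0 : 0 ≤ v := div_nonneg (sph_nonneg _ _) (by positivity)
      have hle1 : A * Real.exp (-lam) ≤ 1 := by
        rw [Real.exp_neg, ← div_eq_mul_inv, div_le_one (Real.exp_pos _), ← Real.log_le_iff_le_exp (by linarith)]
        linarith
      have hd1 : d ≠ 0 := by have := hg.deg i; omega
      have hv1 : v ≤ 1 := (pow_le_one_iff_of_nonneg hv0 hd1).1 (h.trans hle1)
      have hvD : v ^ (Dtot p q) ≤ (A * Real.exp (-(lam / D))) ^ (Dtot p q) := by
        calc _ ≤ v ^ d := pow_le_pow_of_le_one hv0 hv1 hdD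
          _ ≤ _ := h
          _ ≤ A ^ (Dtot p q) * Real.exp (-lam) := by
              gcongr
              exact le_self_pow₀ hA1 (by omega)
          _ = _ := by
              rw [mul_pow, ← Real.exp_nat_mul]
              have : ((Dtot p q : ℕ) : ℝ) * -(lam / D) = -lam := by
                rw [← hD]; field_simp
              rw [this]
      have hv3 : v ≤ A * Real.exp (-(lam / D)) := by
        have hn : 0 ≤ A * Real.exp (-(lam / D)) := by positivity
        exact (pow_le_pow_iff_left₀ hv0 hn (by omega)).1 hvD
      have hgv : sphDist (η t) y = 2 * (d + 1) * v := by rw [hv]; push_cast; field_simp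
      have hdD' : (d : ℝ) ≤ D := by rw [hD]; exact_mod_cast hdD
      rw [hgv]
      calc _ ≤ 2 * (D + 1) * (A * Real.exp (-(lam / D))) := by gcongr
        _ = (2 * (D + 1) * A) * Real.exp (-(lam / D)) := by ring
        _ = Real.exp (-(lam / D - c1)) := by
            rw [show -(lam / D - c1) = c1 + -(lam / D) by ring, Real.exp_add, hc1, Real.exp_log (by linarith)]
    · rw [h]; positivity
  constructor
  · exact hcr.trans (Real.exp_le_exp.2 (by linarith))
  · intro hn
    have hs2' : sphDist (η t) y ≤ s' / 2 := by
      refine hcr.trans ?_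
      have : c2 ≤ lam / D - c1 := by
        rw [le_sub_iff_add_le, le_div_iff₀ (by linarith)]; nlinarith
      calc _ ≤ Real.exp (-c2) := Real.exp_le_exp.2 (by linarith)
        _ = s' / 2 := by rw [Real.exp_neg, hc2, Real.exp_log (by positivity), inv_div]
    have h := step_fine (p i) (q i) A (by linarith) b (η t) y ((hk i _ b).1.trans (by gcongr; exacts [sph_nonneg _ _, hAi i])) hyb _ s' hs0 (hβ t ht) (fun ζ hζ => (min_le_left _ _).trans (hn ζ hζ)) hs2'
    have hpow : (s' / 2) ^ (Dtot p q) ≤ (s' / 2) ^ (max (p i).natDegree (q i).natDegree - 1) :=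
      pow_le_pow_of_le_one (by positivity) (by linarith) (by have := degR_le_Dtot p q i; unfold degR at this; omega)
    have h2 : sphDist (η t) y * (s' / 2) ^ (Dtot p q) ≤ A * Real.exp (-lam) :=
      (mul_le_mul_of_nonneg_left hpow (sph_nonneg _ _)).trans h
    have h3 : (s' / 2) ^ (Dtot p q) = Real.exp (-(D * c2)) := by
      rw [Real.exp_neg, hD, Real.exp_nat_mul, hc2, Real.exp_log (by positivity), ← inv_pow, inv_div]
    rw [h3, Real.exp_neg, ← div_eq_mul_inv, div_le_iff₀ (Real.exp_pos _)] at h2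
    refine h2.trans ?_
    rw [← Real.exp_log (show 0 < A by linarith), ← Real.exp_add, ← Real.exp_add, Real.exp_le_exp, Real.log_exp]
    linarith

lemma T_nd_len {N : ℕ} {p q : Fin N → ℂ[X]} (hg : Good p q) {z : Sphere} {y : List (IX p q) → Sphere}
    (h : IsTree p q z y) (w : ℕ → Fin N) (l : List (IX p q)) : (Tmap p q)^[l.length] (nd w y l) = (w, z) := by
  induction l with
  | nil => simp [nd, wd, h.1]
  | cons a l ih => rw [List.length_cons, Function.iterate_succ_apply, nd_T hg h, ih]

def cnt {N : ℕ} {p q : Fin N → ℂ[X]} (w : ℕ → Fin N) (y : List (IX p q) → Sphere) (s : ℝ) (l : List (IX p q)) : ℕ :=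
  ((Finset.range l.length).filter fun k => NearCrit p q s ((Tmap p q)^[k] (nd w y l))).card

lemma cnt_cons {N : ℕ} {p q : Fin N → ℂ[X]} (hg : Good p q) {z : Sphere} {y : List (IX p q) → Sphere}
    (h : IsTree p q z y) (w : ℕ → Fin N) (s : ℝ) (a : IX p q) (l : List (IX p q)) :
    cnt w y s (a :: l) = cnt w y s l + if NearCrit p q s (nd w y (a :: l)) then 1 else 0 := by
  unfold cnt
  rw [Finset.card_filter, Finset.card_filter, List.length_cons, Finset.sum_range_succ']
  simp only [Function.iterate_succ_apply, nd_T hg h]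
  simp only [Function.iterate_zero, id]
  congr 1

lemma one_end {N : ℕ} {p q : Fin N → ℂ[X]} (hg : Good p q) (hA : NoSuperAttract p q) (m : ℕ) (hm : 1 ≤ m) :
    ∃ c : ℝ, 0 ≤ c ∧ ∀ (n : ℕ) (x : SymX N) (_ : x ∈ juliaSet p q) (Y : List (IX p q) → ℝ → Sphere) (Lam : ℝ),
      (∀ t ≤ -1, sphDist (Y [] t) x.2 ≤ 4 * Real.exp t) →
      (∀ l, l.length ≤ n → Continuous (Y l)) →
      (∀ l, l.length < n → ∀ i t, Finset.univ.val.map (fun j => Y (⟨i, j⟩ :: l) t) = fiber (p i) (q i) (Y l t)) →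
      c * (n + 1) ≤ Lam / (Dtot p q : ℝ) ^ ((critPairs p q).card * (n / m) + m) →
      ∃ y, IsTree p q x.2 y ∧ ∀ l, l.length ≤ n → ∀ t ≤ -(Lam + 2), sphDist (Y l t) (y l) ≤
        Real.exp (-(Lam / (Dtot p q : ℝ) ^ ((critPairs p q).card * (n / m) + m) - c * n)) := by
  obtain ⟨s, hs, hcount⟩ := near_count hg hA m hm
  obtain ⟨c, hc, hstep⟩ := step_exp hg s hs
  refine ⟨c, hc, fun n x hx Y Lam hroot hcont hfib hLam => ?_⟩
  set Kmax := (critPairs p q).card * (n / m) + m with hKmax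
  have hD1 : 1 ≤ Dtot p q := (hg.deg ⟨0, hg.1⟩).trans (degR_le_Dtot p q _)
  have hD1' : (1 : ℝ) ≤ ((Dtot p q : ℕ) : ℝ) := by exact_mod_cast hD1
  have hDp : ∀ k : ℕ, (0 : ℝ) < ((Dtot p q : ℕ) : ℝ) ^ k := fun k => by positivity
  have hL0 : 0 ≤ Lam := by
    have : 0 ≤ Lam / (Dtot p q : ℝ) ^ Kmax := le_trans (by positivity) hLam
    rw [le_div_iff₀ (hDp _)] at this
    simpa using this
  let U : Ultrafilter ℝ := Ultrafilter.of atBot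
  have hU : (U : Filter ℝ) ≤ atBot := Ultrafilter.of_le _
  have h0 : Tendsto (Y []) U (𝓝 x.2) := by
    rw [sph_tendsto]
    refine Tendsto.mono_left ?_ hU
    refine squeeze_zero' (Eventually.of_forall fun _ => sph_nonneg _ _) ((eventually_le_atBot (-1)).mono hroot) ?_
    simpa using (Real.tendsto_exp_atBot).const_mul 4
  obtain ⟨y, hy, hlim⟩ := end_tree hg n x.2 Y U h0 hfib
  refine ⟨y, hy, ?_⟩
  have hcb : ∀ l : List (IX p q), l.length ≤ n → cnt x.1 y s l ≤ Kmax := by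
    intro l hl
    refine (hcount l.length (nd x.1 y l) (by rw [T_nd_len hg hy]; exact hx)).trans ?_
    rw [hKmax]
    gcongr
  have hmono : ∀ l : List (IX p q), l.length ≤ n → Lam / (Dtot p q : ℝ) ^ Kmax ≤ Lam / (Dtot p q : ℝ) ^ (cnt x.1 y s l) := by
    intro l hl
    have := hcb l hl
    gcongr
  have hmain : ∀ l : List (IX p q), l.length ≤ n → ∀ t ≤ -(Lam + 2), sphDist (Y l t) (y l) ≤
      Real.exp (-(Lam / (Dtot p q : ℝ) ^ (cnt x.1 y s l) - c * l.length)) := by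
    intro l
    induction l with
    | nil =>
      intro _ t ht
      rw [hy.1]
      refine (hroot t (by linarith)).trans ?_
      simp only [cnt, List.length_nil, Finset.range_zero, Finset.filter_empty, Finset.card_empty, pow_zero, div_one, Nat.cast_zero, mul_zero, sub_zero]
      have h4 : (4 : ℝ) ≤ Real.exp 2 := by
        have := Real.add_one_le_exp (1 : ℝ)
        rw [show (2 : ℝ) = 1 + 1 by norm_num, Real.exp_add]; nlinarith
      calc _ ≤ Real.exp 2 * Real.exp t := by gcongr
        _ = Real.exp (2 + t) := (Real.exp_add _ _).symm
        _ ≤ _ := Real.exp_le_exp.2 (by linarith)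
    | cons a l ih =>
      intro hl t ht
      rw [List.length_cons] at hl
      have ih := ih (by omega)
      have hlen : (l.length : ℝ) ≤ n := by exact_mod_cast (by omega : l.length ≤ n)
      have hyb : y (a :: l) ∈ fiber (p a.1) (q a.1) (y l) := by
        rw [mem_fiber _ _ (hg.cop _) (hg.deg _)]; exact tree_rat hg hy a l
      have hYr : ∀ t, ratEval (p a.1) (q a.1) (Y (a :: l) t) = Y l t := by
        intro t
        rw [← mem_fiber _ _ (hg.cop _) (hg.deg _), ← hfib l (by omega) a.1 t, Multiset.mem_map]
        exact ⟨a.2, Multiset.mem_coe.2 (List.mem_finRange _), rfl⟩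
      have hm1 := hmono l (by omega)
      obtain ⟨S1, S2⟩ := hstep a.1 (y l) (Y (a :: l)) U (y (a :: l)) (Lam / (Dtot p q : ℝ) ^ (cnt x.1 y s l) - c * l.length) (-(Lam + 2))
        (hcont _ (by simpa using hl)) hU (hlim _ (by simpa using hl)) (by nlinarith) hyb (fun t ht => by rw [hYr]; exact ih t ht) t ht
      rw [cnt_cons hg hy]
      push_cast [List.length_cons]
      split_ifs with hnc
      · refine S1.trans (Real.exp_le_exp.2 ?_)
        rw [sub_div, div_div, pow_succ]
        have : c * l.length / (Dtot p q : ℝ) ≤ c * l.length := div_le_self (by positivity) hD1'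
        linarith
      · refine (S2 ?_).trans (Real.exp_le_exp.2 ?_)
        · intro ζ hζ
          by_contra! hlt
          apply hnc
          refine ⟨ζ, ?_, hlt⟩
          simp only [nd, wd, consW_zero]
          rw [tree_rat hg hy]; exact hζ
        · rw [add_zero]; linarith
  intro l hl t ht
  refine (hmain l hl t ht).trans (Real.exp_le_exp.2 ?_)
  have hlen : (l.length : ℝ) ≤ n := by exact_mod_cast hl
  have := hmono l hl
  nlinarith

lemma core_num {u1 u2 u3 u4 g e : ℝ} (n1 : 0 ≤ u1) (n2 : 0 ≤ u2) (n4 : 0 ≤ u4) (a1 : u1 ≤ g) (a2 : u2 ≤ g)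
    (hd1 : g ≤ 1) (hd0 : 0 < g) (t : u4 ≤ u1 + u2 + u3) (a3 : u3 ^ 2 ≤ e) : u4 ^ 2 ≤ 3 * (2 * g + e) := by
  have b1 : u1 ^ 2 ≤ g := by nlinarith
  have b2 : u2 ^ 2 ≤ g := by nlinarith
  have b4 : u4 ^ 2 ≤ (u1 + u2 + u3) ^ 2 := by
    apply pow_le_pow_left₀ n4; linarith
  nlinarith [sq_nonneg (u1 - u2), sq_nonneg (u1 - u3), sq_nonneg (u2 - u3)]

set_option maxHeartbeats 1000000 in
lemma core {N : ℕ} {p q : Fin N → ℂ[X]} (hg : Good p q) (hA : NoSuperAttract p q) (ε : ℝ) (hε : 0 < ε) :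
    ∃ C : ℝ, 0 < C ∧ ∀ (n : ℕ) (x x' : SymX N), x ∈ juliaSet p q → x' ∈ juliaSet p q →
      ∃ y y', IsTree p q x.2 y ∧ IsTree p q x'.2 y' ∧ ∀ k ≤ n,
        ∑ l ∈ lev (IX p q) k, sphDist (y l) (y' l) ^ 2 ≤ C * Real.exp (ε * n) * N ^ k := by
  have hD1 : 1 ≤ Dtot p q := (hg.deg ⟨0, hg.1⟩).trans (degR_le_Dtot p q _)
  obtain ⟨C1, hC1, hen⟩ := tree_energy hg
  set D : ℝ := ((Dtot p q : ℕ) : ℝ) with hD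
  have hD1' : (1 : ℝ) ≤ D := by rw [hD]; exact_mod_cast hD1
  have hlogD : 0 ≤ Real.log D := Real.log_nonneg hD1'
  set K0 := (critPairs p q).card with hK0
  obtain ⟨m0, hm0⟩ := exists_nat_gt (K0 * Real.log D / (ε / 4))
  set m := m0 + 1 with hm
  have hmε : K0 * Real.log D ≤ ε / 4 * m := by
    rw [div_lt_iff₀ (by positivity)] at hm0
    rw [hm]; push_cast; nlinarith
  obtain ⟨c, hc, hend⟩ := one_end hg hA m (by omega)
  set u := min 1 (ε / 4) with hu
  have hu0 : 0 < u := lt_min one_pos (by positivity)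
  have hlin : ∀ n : ℕ, (n : ℝ) + 1 ≤ u⁻¹ * Real.exp (ε / 4 * n) := by
    intro n
    rw [inv_mul_eq_div, le_div_iff₀ hu0]
    have h1 := Real.add_one_le_exp (ε / 4 * n)
    have h2 : u ≤ 1 := min_le_left _ _
    have h3 : u ≤ ε / 4 := min_le_right _ _
    have : (0 : ℝ) ≤ n := by positivity
    nlinarith
  have hpowD : ∀ n : ℕ, D ^ (K0 * (n / m) + m) ≤ D ^ m * Real.exp (ε / 4 * n) := by
    intro n
    rw [pow_add, mul_comm]
    gcongr
    rw [← Real.exp_log (show 0 < D by linarith), ← Real.exp_nat_mul, Real.exp_le_exp]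
    have h1 : ((n / m : ℕ) : ℝ) * m ≤ n := by exact_mod_cast Nat.div_mul_le_self n m
    have h2 : (0 : ℝ) ≤ ((n / m : ℕ) : ℝ) := by positivity
    push_cast [-Nat.cast_div]
    calc (K0 : ℝ) * ((n / m : ℕ) : ℝ) * Real.log D = (K0 * Real.log D) * ((n / m : ℕ) : ℝ) := by ring
      _ ≤ (ε / 4 * m) * ((n / m : ℕ) : ℝ) := by gcongr
      _ = ε / 4 * (((n / m : ℕ) : ℝ) * m) := by ring
      _ ≤ _ := by gcongr
  have hcl : 0 ≤ c + Real.log D := by positivity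
  set C : ℝ := 3 * (2 + 2 * (D ^ m * (c + Real.log D) + 2) * C1 * (u⁻¹ * u⁻¹)) with hC
  have hNN : (1 : ℝ) ≤ N := by exact_mod_cast hg.1
  refine ⟨C, by positivity, fun n x x' hx hx' => ?_⟩
  by_cases hz : x.2 = x'.2
  · obtain ⟨y, hy⟩ := exists_tree p q x.2
    refine ⟨y, y, hy, hz ▸ hy, fun k hk => ?_⟩
    simp only [sph_self]
    rw [Finset.sum_eq_zero (fun _ _ => by norm_num)]
    positivity
  obtain ⟨Y, E, hr, hr', hfib, hE, hEs⟩ := hen n x.2 x'.2 hz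
  set Lam : ℝ := D ^ (K0 * (n / m) + m) * (c * (n + 1) + n * Real.log D) with hLam
  have hDp : 0 < D ^ (K0 * (n / m) + m) := by positivity
  have hLd : Lam / D ^ (K0 * (n / m) + m) = c * (n + 1) + n * Real.log D := by
    rw [hLam]; field_simp
  have hL0 : 0 ≤ Lam := by positivity
  have hLc : c * (n + 1) ≤ Lam / D ^ (K0 * (n / m) + m) := by
    rw [hLd]; nlinarith [show 0 ≤ n * Real.log D by positivity]
  have hcont : ∀ l, l.length ≤ n → Continuous (Y l) := by
    intro l hl
    rw [continuous_iff_continuousAt]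
    intro b
    rw [ContinuousAt, sph_tendsto]
    have h1 : Tendsto (fun a => Real.sqrt (|b - a| * E l)) (𝓝 b) (𝓝 0) := by
      have : Continuous (fun a => Real.sqrt (|b - a| * E l)) := by fun_prop
      simpa using this.tendsto b
    refine squeeze_zero (fun _ => sph_nonneg _ _) (fun a => ?_) h1
    exact Real.le_sqrt_of_sq_le ((hE l hl).2 a b)
  obtain ⟨y, hy, hyb⟩ := hend n x hx Y Lam hr hcont hfib hLc
  obtain ⟨y', hy', hyb'⟩ := hend n x' hx' (fun l t => Y l (-t)) Lam
    (fun t ht => by simpa using hr' (-t) (by linarith)) (fun l hl => (hcont l hl).comp continuous_neg)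
    (fun l hl i t => hfib l hl i (-t)) hLc
  refine ⟨y, y', hy, hy', fun k hk => ?_⟩
  have hend2 : Real.exp (-(Lam / D ^ (K0 * (n / m) + m) - c * n)) ≤ (D ^ n)⁻¹ := by
    rw [hLd]
    calc _ ≤ Real.exp (-(n * Real.log D)) := Real.exp_le_exp.2 (by nlinarith)
      _ = _ := by rw [Real.exp_neg, Real.exp_nat_mul, Real.exp_log (by linarith)]
  have hpt : ∀ l ∈ lev (IX p q) k, sphDist (y l) (y' l) ^ 2 ≤ 3 * (2 * (D ^ n)⁻¹ + 2 * (Lam + 2) * E l) := by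
    intro l hl
    have hln : l.length ≤ n := by rw [mem_lev] at hl; omega
    have a1 := (hyb l hln (-(Lam + 2)) le_rfl).trans hend2
    have a2 := (hyb' l hln (-(Lam + 2)) le_rfl).trans hend2
    simp only [neg_neg] at a2
    have a3 := (hE l hln).2 (-(Lam + 2)) (Lam + 2)
    rw [abs_of_nonneg (by linarith)] at a3
    have t1 := sph_tri (y l) (Y l (-(Lam + 2))) (y' l)
    have t2 := sph_tri (Y l (-(Lam + 2))) (Y l (Lam + 2)) (y' l)
    rw [sph_comm (y l) (Y l (-(Lam + 2)))] at t1
    have n1 := sph_nonneg (Y l (-(Lam + 2))) (y l)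
    have n2 := sph_nonneg (Y l (Lam + 2)) (y' l)
    have n3 := sph_nonneg (Y l (-(Lam + 2))) (Y l (Lam + 2))
    have n4 := sph_nonneg (y l) (y' l)
    have hd1 : (D ^ n)⁻¹ ≤ 1 := inv_le_one_of_one_le₀ (one_le_pow₀ hD1')
    have hd0 : 0 < (D ^ n)⁻¹ := by positivity
    exact core_num (u3 := sphDist (Y l (-(Lam + 2))) (Y l (Lam + 2))) n1 n2 n4 a1 a2 hd1 hd0 (by linarith) (by linarith)
  have hcard : ((lev (IX p q) k).card : ℝ) = D ^ k := by
    rw [card_lev, hD]; simp [Dtot, Fintype.card_sigma]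
  have hNk : (1 : ℝ) ≤ (N : ℝ) ^ k := one_le_pow₀ hNN
  have hDk : D ^ k * (D ^ n)⁻¹ ≤ 1 := by
    rw [← div_eq_mul_inv, div_le_one (by positivity)]
    exact pow_le_pow_right₀ hD1' hk
  have hexp1 : 1 ≤ Real.exp (ε / 4 * n) := Real.one_le_exp (by positivity)
  have hLamb : Lam + 2 ≤ (D ^ m * (c + Real.log D) + 2) * (Real.exp (ε / 4 * n) * (n + 1)) := by
    have h1 : Lam ≤ (D ^ m * Real.exp (ε / 4 * n)) * ((c + Real.log D) * (n + 1)) := by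
      rw [hLam]
      refine mul_le_mul (hpowD n) (by nlinarith) (by positivity) (by positivity)
    have h2 : 1 ≤ Real.exp (ε / 4 * n) * (n + 1) := by
      have : (0 : ℝ) ≤ n := by positivity
      nlinarith
    nlinarith
  calc _ ≤ ∑ l ∈ lev (IX p q) k, 3 * (2 * (D ^ n)⁻¹ + 2 * (Lam + 2) * E l) := Finset.sum_le_sum hpt
    _ = 3 * (2 * (D ^ k * (D ^ n)⁻¹) + 2 * (Lam + 2) * ∑ l ∈ lev (IX p q) k, E l) := by
        rw [← Finset.mul_sum, Finset.sum_add_distrib, Finset.sum_const, nsmul_eq_mul, hcard, ← Finset.mul_sum]; ring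
    _ ≤ 3 * (2 * 1 + 2 * ((D ^ m * (c + Real.log D) + 2) * (Real.exp (ε / 4 * n) * (n + 1))) * (C1 * (n + 1) * N ^ k)) := by
        gcongr
        · exact Finset.sum_nonneg fun l hl => (hE l (by rw [mem_lev] at hl; omega)).1
        · exact hEs k hk
    _ = 3 * (2 + 2 * (D ^ m * (c + Real.log D) + 2) * C1 * (((n : ℝ) + 1) * (n + 1)) * Real.exp (ε / 4 * n) * N ^ k) := by ring
    _ ≤ 3 * (2 + 2 * (D ^ m * (c + Real.log D) + 2) * C1 * ((u⁻¹ * Real.exp (ε / 4 * n)) * (u⁻¹ * Real.exp (ε / 4 * n))) * Real.exp (ε / 4 * n) * N ^ k) := by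
        have := hlin n
        gcongr
    _ = 3 * (2 + 2 * (D ^ m * (c + Real.log D) + 2) * C1 * (u⁻¹ * u⁻¹) * (Real.exp (ε / 4 * n) ^ 3 * N ^ k)) := by ring
    _ ≤ 3 * (2 * (Real.exp (ε / 4 * n) ^ 4 * N ^ k) + 2 * (D ^ m * (c + Real.log D) + 2) * C1 * (u⁻¹ * u⁻¹) * (Real.exp (ε / 4 * n) ^ 4 * N ^ k)) := by
        have : (1 : ℝ) ≤ Real.exp (ε / 4 * n) ^ 4 * N ^ k := one_le_mul_of_one_le_of_one_le (one_le_pow₀ hexp1) hNk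
        gcongr
        · linarith
        · norm_num
    _ = C * Real.exp (ε * n) * N ^ k := by
        rw [← Real.exp_nat_mul, hC, show ((4 : ℕ) : ℝ) * (ε / 4 * n) = ε * n by push_cast; ring]; ring

/-- accumulated weight along a branch -/
def wt {N : ℕ} {p q : Fin N → ℂ[X]} (f : SymX N → ℝ) (w : ℕ → Fin N) (y : List (IX p q) → Sphere) : List (IX p q) → ℝ
  | [] => 0
  | a :: l => f (nd w y (a :: l)) + wt f w y l

lemma LSum_iter {N : ℕ} {p q : Fin N → ℂ[X]} (hg : Good p q) {z : Sphere} {y : List (IX p q) → Sphere}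
    (h : IsTree p q z y) (w : ℕ → Fin N) (f : SymX N → ℝ) (k n : ℕ) :
    LSum p q f (k + n) (w, z) = ∑ l ∈ lev (IX p q) k, Real.exp (wt f w y l) * LSum p q f n (nd w y l) := by
  induction k generalizing n with
  | zero => simp [lev, wt, nd, wd, h.1]
  | succ k ih =>
    rw [show k + 1 + n = k + (n + 1) by ring, ih, sum_lev_succ]
    refine Finset.sum_congr rfl fun l _ => ?_
    rw [LSum_nd hg h, Finset.mul_sum]
    refine Finset.sum_congr rfl fun a _ => ?_
    rw [wt, Real.exp_add]; ring

/-- no bad suffix -/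
def gd {α : Type} (B : List α → Prop) : List α → Prop
  | [] => True
  | a :: l => gd B l ∧ ¬ B (a :: l)

lemma stop_dec {N : ℕ} {p q : Fin N → ℂ[X]} (hg : Good p q) {z : Sphere} {y : List (IX p q) → Sphere}
    (h : IsTree p q z y) (w : ℕ → Fin N) (f : SymX N → ℝ) (B : List (IX p q) → Prop) (n k : ℕ) (hk : k ≤ n) :
    LSum p q f n (w, z) ≤
      (∑ l ∈ lev (IX p q) k, if gd B l then Real.exp (wt f w y l) * LSum p q f (n - k) (nd w y l) else 0) +
      ∑ j ∈ Finset.range k, ∑ l ∈ lev (IX p q) (j + 1), if B l then Real.exp (wt f w y l) * LSum p q f (n - (j + 1)) (nd w y l) else 0 := by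
  induction k with
  | zero => simp [lev, wt, nd, wd, h.1, gd]
  | succ k ih =>
    refine (ih (by omega)).trans ?_
    rw [Finset.sum_range_succ, add_comm (∑ j ∈ Finset.range k, _), ← add_assoc]
    gcongr
    rw [← Finset.sum_add_distrib, sum_lev_succ]
    refine Finset.sum_le_sum fun l _ => ?_
    have hnn : ∀ a : IX p q, 0 ≤ Real.exp (wt f w y (a :: l)) * LSum p q f (n - (k + 1)) (nd w y (a :: l)) :=
      fun a => mul_nonneg (Real.exp_pos _).le (LSum_nonneg _ _ _ _ _)
    by_cases hl : gd B l
    · rw [if_pos hl, show n - k = (n - (k + 1)) + 1 by omega, LSum_nd hg h, Finset.mul_sum]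
      refine Finset.sum_le_sum fun a _ => ?_
      have e : Real.exp (wt f w y l) * (Real.exp (f (nd w y (a :: l))) * LSum p q f (n - (k + 1)) (nd w y (a :: l))) =
          Real.exp (wt f w y (a :: l)) * LSum p q f (n - (k + 1)) (nd w y (a :: l)) := by
        rw [wt, Real.exp_add]; ring
      rw [e]
      have := hnn a
      by_cases hb : B (a :: l)
      · rw [if_pos hb]; split_ifs <;> linarith
      · rw [if_pos (show gd B (a :: l) from ⟨hl, hb⟩), if_neg hb, add_zero]
    · rw [if_neg hl]
      refine Finset.sum_nonneg fun a _ => add_nonneg ?_ ?_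
      · split_ifs; exacts [hnn a, le_rfl]
      · split_ifs; exacts [hnn a, le_rfl]

lemma wd_agree {N : ℕ} {p q : Fin N → ℂ[X]} (w w' : ℕ → Fin N) (l : List (IX p q)) (n : ℕ) (hn : n < l.length) :
    wd w l n = wd w' l n := by
  induction l generalizing n with
  | nil => simp at hn
  | cons a l ih =>
    cases n with
    | zero => simp [wd, consW_zero]
    | succ n => simp only [wd, consW_succ]; exact ih n (by simpa using hn)

lemma shift_le {N : ℕ} {p q : Fin N → ℂ[X]} (w w' : ℕ → Fin N) (l : List (IX p q)) :
    shiftDist (wd w l) (wd w' l) ≤ (2 : ℝ)⁻¹ ^ l.length := by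
  unfold shiftDist
  split_ifs with h
  · apply pow_le_pow_of_le_one (by norm_num) (by norm_num)
    by_contra! hlt
    exact Nat.find_spec h (wd_agree w w' l _ (by omega))
  · positivity

lemma shift_nonneg {N : ℕ} (w w' : ℕ → Fin N) : 0 ≤ shiftDist w w' := by
  unfold shiftDist; split_ifs <;> positivity

lemma shift_le_one {N : ℕ} (w w' : ℕ → Fin N) : shiftDist w w' ≤ 1 := by
  unfold shiftDist; split_ifs
  · exact pow_le_one₀ (by norm_num) (by norm_num)
  · norm_num

lemma wt_comp {N : ℕ} {p q : Fin N → ℂ[X]} (f : SymX N → ℝ) (w w' : ℕ → Fin N) (y y' : List (IX p q) → Sphere)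
    (B : List (IX p q) → Prop) (b η : ℝ) (hη : 0 ≤ η) (k0 : ℕ)
    (h1 : ∀ l, f (nd w' y' l) ≤ f (nd w y l) + b)
    (h2 : ∀ l, k0 < l.length → ¬ B l → f (nd w' y' l) ≤ f (nd w y l) + η) (l : List (IX p q)) (hl : gd B l) :
    wt f w' y' l ≤ wt f w y l + (b * min l.length k0 + η * l.length) := by
  induction l with
  | nil => simp [wt]
  | cons a l ih =>
    have ih := ih hl.1
    simp only [wt, List.length_cons]
    by_cases hk : k0 < l.length + 1
    · have := h2 (a :: l) (by simpa using hk) hl.2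
      rw [show min l.length k0 = k0 by omega] at ih
      rw [show min (l.length + 1) k0 = k0 by omega]
      push_cast; linarith
    · have := h1 (a :: l)
      rw [show min l.length k0 = l.length by omega] at ih
      rw [show min (l.length + 1) k0 = l.length + 1 by omega]
      push_cast; linarith

lemma wt_le {N : ℕ} {p q : Fin N → ℂ[X]} (f : SymX N → ℝ) (w : ℕ → Fin N) (y : List (IX p q) → Sphere) (S : ℝ)
    (h : ∀ l, f (nd w y l) ≤ S) (l : List (IX p q)) : wt f w y l ≤ l.length * S := by
  induction l with
  | nil => simp [wt]
  | cons a l ih => simp only [wt, List.length_cons]; push_cast; linarith [h (a :: l)]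

lemma compare {N : ℕ} {p q : Fin N → ℂ[X]} (hg : Good p q) (hA : NoSuperAttract p q) (f : SymX N → ℝ) (b S : ℝ) (hb0 : 0 ≤ b)
    (hb : ∀ x ∈ juliaSet p q, -b ≤ f x ∧ f x ≤ b) (hS : ∀ x ∈ juliaSet p q, f x ≤ S) (CH α : ℝ) (hCH : 0 < CH) (hα : 0 < α)
    (hf : ∀ x ∈ juliaSet p q, ∀ y ∈ juliaSet p q, |f x - f y| ≤ CH * dX x y ^ α)
    (M : ℕ → ℝ) (hM : ∀ k, ∀ x ∈ juliaSet p q, LSum p q f k x ≤ M k) (η ε : ℝ) (hη : 0 < η) (hε : 0 < ε) :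
    ∃ C : ℝ, 0 < C ∧ ∃ k1 : ℕ, ∀ (n k0 : ℕ) (x x' : SymX N), k1 ≤ k0 → x ∈ juliaSet p q → x' ∈ juliaSet p q →
      LSum p q f n x' ≤ Real.exp (2 * b * k0 + η * n) * LSum p q f n x +
        C * Real.exp (ε * n) * ∑ j ∈ Finset.range n, if k0 < j + 1 then (Real.exp S * N) ^ (j + 1) * M (n - (j + 1)) else 0 := by
  obtain ⟨C, hC, hcore⟩ := core hg hA ε hε
  set δ : ℝ := (η / CH) ^ (1 / α) with hδ
  have hδ0 : 0 < δ := Real.rpow_pos_of_pos (by positivity) _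
  have hδα : CH * δ ^ α = η := by
    rw [hδ, ← Real.rpow_mul (by positivity), one_div, inv_mul_cancel₀ hα.ne', Real.rpow_one]; field_simp
  obtain ⟨k1, hk1⟩ := exists_pow_lt_of_lt_one hδ0 (show (2 : ℝ)⁻¹ < 1 by norm_num)
  refine ⟨C / δ ^ 2, by positivity, k1, fun n k0 x x' hk0 hx hx' => ?_⟩
  obtain ⟨y, y', hy, hy', hsum⟩ := hcore n x x' hx hx'
  obtain ⟨B, hBd⟩ : ∃ B : List (IX p q) → Prop, ∀ l, B l ↔ (k0 < l.length ∧ δ < sphDist (y l) (y' l)) := ⟨_, fun _ => Iff.rfl⟩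
  have hst := stop_dec hg hy' x'.1 f B n n le_rfl
  have e0 : (x'.1, x'.2) = x' := rfl
  rw [e0] at hst
  refine hst.trans (add_le_add ?_ ?_)
  · have hit := LSum_iter hg hy x.1 f n 0
    rw [show (x.1, x.2) = x from rfl, add_zero] at hit
    rw [hit, Finset.mul_sum]
    refine Finset.sum_le_sum fun l hl => ?_
    rw [mem_lev] at hl
    simp only [Nat.sub_self, LSum_zero, mul_one]
    split_ifs with hgd
    · rw [← Real.exp_add, Real.exp_le_exp]
      have := wt_comp f x.1 x'.1 y y' B (2 * b) η hη.le k0 (fun l => by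
        have h1 := hb _ (nd_julia hg hx hy l)
        have h2 := hb _ (nd_julia hg hx' hy' l)
        linarith) (fun l hl hB => by
        have h1 := hf _ (nd_julia hg hx' hy' l) _ (nd_julia hg hx hy l)
        have hσ : sphDist (y l) (y' l) ≤ δ := by by_contra! h; exact hB ((hBd l).2 ⟨hl, h⟩)
        have h2 : dX (nd x'.1 y' l) (nd x.1 y l) ≤ δ := by
          refine max_le ?_ ?_
          · refine (shift_le x'.1 x.1 l).trans (le_trans ?_ hk1.le)
            exact pow_le_pow_of_le_one (by norm_num) (by norm_num) (by omega)
          · show sphDist (y' l) (y l) ≤ δ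
            rw [sph_comm]; exact hσ
        have h3 : CH * dX (nd x'.1 y' l) (nd x.1 y l) ^ α ≤ η := by
          rw [← hδα]
          have : 0 ≤ dX (nd x'.1 y' l) (nd x.1 y l) := le_max_of_le_left (shift_nonneg _ _)
          gcongr
        have h4 := le_abs_self (f (nd x'.1 y' l) - f (nd x.1 y l))
        linarith) l hgd
      rw [hl] at this
      have h5 : (2 * b) * ((min n k0 : ℕ) : ℝ) ≤ 2 * b * k0 := by
        gcongr; exact min_le_right _ _
      linarith
    · positivity
  · rw [Finset.mul_sum]
    refine Finset.sum_le_sum fun j hj => ?_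
    rw [Finset.mem_range] at hj
    split_ifs with hjk
    · have hM0 : 0 ≤ M (n - (j + 1)) := (LSum_nonneg p q f _ x).trans (hM _ x hx)
      have hpt : ∀ l ∈ lev (IX p q) (j + 1), (if B l then Real.exp (wt f x'.1 y' l) * LSum p q f (n - (j + 1)) (nd x'.1 y' l) else 0) ≤
          (Real.exp S ^ (j + 1) * M (n - (j + 1)) / δ ^ 2) * sphDist (y l) (y' l) ^ 2 := by
        intro l hl
        rw [mem_lev] at hl
        split_ifs with hB
        · have h1 : Real.exp (wt f x'.1 y' l) ≤ Real.exp S ^ (j + 1) := by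
            rw [← Real.exp_nat_mul, Real.exp_le_exp, ← hl]
            exact wt_le f _ _ S (fun l => hS _ (nd_julia hg hx' hy' l)) l
          have h2 := hM (n - (j + 1)) _ (nd_julia hg hx' hy' l)
          have h3 : 1 ≤ sphDist (y l) (y' l) ^ 2 / δ ^ 2 := by
            rw [le_div_iff₀ (by positivity), one_mul]
            exact pow_le_pow_left₀ hδ0.le ((hBd l).1 hB).2.le 2
          calc _ ≤ Real.exp S ^ (j + 1) * M (n - (j + 1)) := by
                exact mul_le_mul h1 h2 (LSum_nonneg _ _ _ _ _) (by positivity)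
            _ ≤ Real.exp S ^ (j + 1) * M (n - (j + 1)) * (sphDist (y l) (y' l) ^ 2 / δ ^ 2) := le_mul_of_one_le_right (by positivity) h3
            _ = _ := by ring
        · have := sq_nonneg (sphDist (y l) (y' l)); positivity
      refine (Finset.sum_le_sum hpt).trans ?_
      rw [← Finset.mul_sum]
      calc _ ≤ (Real.exp S ^ (j + 1) * M (n - (j + 1)) / δ ^ 2) * (C * Real.exp (ε * n) * N ^ (j + 1)) := by
            gcongr; exact hsum (j + 1) (by omega)
        _ = _ := by rw [mul_pow]; ring
    · rw [mul_zero]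
      refine le_of_eq (Finset.sum_eq_zero fun l hl => ?_)
      rw [mem_lev] at hl
      rw [if_neg]
      intro hB
      exact hjk (hl ▸ ((hBd l).1 hB).1)

lemma sup_facts {N : ℕ} {p q : Fin N → ℂ[X]} (hg : Good p q) (f : SymX N → ℝ) (b : ℝ) (hb0 : 0 ≤ b)
    (hb : ∀ x ∈ juliaSet p q, -b ≤ f x ∧ f x ≤ b) (hne : (juliaSet p q).Nonempty) :
    ∃ (M : ℕ → ℝ) (P' : ℝ), (∀ k, ∀ x ∈ juliaSet p q, LSum p q f k x ≤ M k) ∧ (∀ k, 0 < M k) ∧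
      (∀ k, ∃ x ∈ juliaSet p q, M k / 2 < LSum p q f k x) ∧
      Tendsto (fun n : ℕ => Real.log (M n) / n) atTop (𝓝 P') ∧ (∀ n : ℕ, Real.exp (P' * n) ≤ M n) ∧ pressure p q f ≤ P' := by
  haveI : Nonempty ↥(juliaSet p q) := hne.to_subtype
  have hD := Dtot_pos hg
  have hD' : (1 : ℝ) ≤ ((Dtot p q : ℕ) : ℝ) := by exact_mod_cast hD
  have hbdd : ∀ n, BddAbove (Set.range fun x : ↥(juliaSet p q) => LSum p q f n x) := by
    intro n
    refine ⟨(Dtot p q * Real.exp b) ^ n, ?_⟩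
    rintro _ ⟨x, rfl⟩
    exact (LSum_bounds hg f (-b) b hb n x x.2).2
  set M : ℕ → ℝ := fun n => ⨆ x : ↥(juliaSet p q), LSum p q f n x with hMdef
  have hM : ∀ k, ∀ x ∈ juliaSet p q, LSum p q f k x ≤ M k := fun k x hx => le_ciSup (hbdd k) ⟨x, hx⟩
  obtain ⟨x0, hx0⟩ := hne
  have hMpos : ∀ k, 0 < M k := fun k => (LSum_pos hg f (-b) b hb k x0 hx0).trans_le (hM k x0 hx0)
  have hMlow : ∀ k, (Dtot p q * Real.exp (-b)) ^ k ≤ M k := fun k => ((LSum_bounds hg f (-b) b hb k x0 hx0).1).trans (hM k x0 hx0)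
  have hsub : Subadditive fun n => Real.log (M n) := by
    intro m n
    rw [← Real.log_mul (hMpos m).ne' (hMpos n).ne']
    apply Real.log_le_log (hMpos _)
    refine ciSup_le fun x => ?_
    obtain ⟨y, hy⟩ := exists_tree p q x.1.2
    have h1 := LSum_iter hg hy x.1.1 f m n
    have h2 := LSum_iter hg hy x.1.1 f m 0
    rw [add_zero] at h2
    simp only [LSum_zero, mul_one] at h2
    have e : (x.1.1, x.1.2) = x.1 := rfl
    rw [e] at h1 h2
    rw [h1]
    calc _ ≤ ∑ l ∈ lev (IX p q) m, Real.exp (wt f x.1.1 y l) * M n := by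
          gcongr with l hl
          exact hM n _ (nd_julia hg x.2 hy l)
      _ = LSum p q f m x * M n := by rw [h2, Finset.sum_mul]
      _ ≤ _ := by
          have := hMpos n
          gcongr
          exact hM m x x.2
  have hlowlog : ∀ n : ℕ, n * Real.log (Dtot p q * Real.exp (-b)) ≤ Real.log (M n) := by
    intro n
    rw [← Real.log_pow]
    exact Real.log_le_log (by positivity) (hMlow n)
  have hbb : BddBelow (Set.range fun n : ℕ => Real.log (M n) / n) := by
    refine ⟨min 0 (Real.log (Dtot p q * Real.exp (-b))), ?_⟩
    rintro _ ⟨n, rfl⟩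
    rcases Nat.eq_zero_or_pos n with rfl | hn
    · simp
    · refine (min_le_right _ _).trans ?_
      have hn' : (0 : ℝ) < n := by exact_mod_cast hn
      show _ ≤ Real.log (M n) / n
      rw [le_div_iff₀ hn', mul_comm]
      exact hlowlog n
  refine ⟨M, hsub.lim, hM, hMpos, ?_, hsub.tendsto_lim hbb, ?_, ?_⟩
  · intro k
    obtain ⟨x, hx⟩ := exists_lt_of_lt_ciSup (show M k / 2 < ⨆ x : ↥(juliaSet p q), LSum p q f k x by
      have := hMpos k
      show M k / 2 < M k
      linarith)
    exact ⟨x, x.2, hx⟩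
  · intro n
    rcases Nat.eq_zero_or_pos n with rfl | hn
    · have := hM 0 x0 hx0
      rw [LSum_zero] at this
      simpa using this
    · have h := hsub.lim_le_div hbb hn.ne'
      have hn' : (0 : ℝ) < n := by exact_mod_cast hn
      rw [le_div_iff₀ hn'] at h
      rw [← Real.exp_log (hMpos n)]
      exact Real.exp_le_exp.2 h
  · refine ciSup_le fun x => ?_
    refine le_of_forall_pos_le_add fun e he => ?_
    refine limsup_le_of_le ?_ ?_
    · refine IsCoboundedUnder.of_frequently_ge (a := Real.log (Dtot p q * Real.exp (-b))) ?_
      refine Eventually.frequently ?_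
      filter_upwards [eventually_gt_atTop 0] with n hn
      have hn' : (0 : ℝ) < n := by exact_mod_cast hn
      rw [inv_mul_eq_div, le_div_iff₀ hn', mul_comm, ← Real.log_pow]
      exact Real.log_le_log (by positivity) (LSum_bounds hg f (-b) b hb n x x.2).1
    · have := (hsub.tendsto_lim hbb).eventually (gt_mem_nhds (show hsub.lim < hsub.lim + e by linarith))
      filter_upwards [this] with n hn
      refine le_trans ?_ hn.le
      rw [inv_mul_eq_div]
      gcongr
      · exact LSum_pos hg f (-b) b hb n x x.2
      · exact hM n x x.2

lemma lower {N : ℕ} {p q : Fin N → ℂ[X]} (hg : Good p q) (hA : NoSuperAttract p q) (f : SymX N → ℝ) (b S : ℝ) (hb0 : 0 ≤ b)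
    (hb : ∀ x ∈ juliaSet p q, -b ≤ f x ∧ f x ≤ b) (hS : ∀ x ∈ juliaSet p q, f x ≤ S) (CH α : ℝ) (hCH : 0 < CH) (hα : 0 < α)
    (hf : ∀ x ∈ juliaSet p q, ∀ y ∈ juliaSet p q, |f x - f y| ≤ CH * dX x y ^ α)
    (hP : S + Real.log N < pressure p q f) (θ : ℝ) (hθ : 0 < θ) (x : SymX N) (hx : x ∈ juliaSet p q) :
    ∀ᶠ n : ℕ in atTop, Real.exp ((pressure p q f - θ) * n) ≤ LSum p q f n x := by
  obtain ⟨M, P', hM, hMpos, hMx, hlim, hlow, hPP⟩ := sup_facts hg f b hb0 hb ⟨x, hx⟩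
  set γ := P' - (S + Real.log N) with hγ
  have hγ0 : 0 < γ := by rw [hγ]; linarith
  have hNpos : (0 : ℝ) < N := by exact_mod_cast hg.1
  have hSN : Real.exp S * N = Real.exp (P' - γ) := by
    rw [show P' - γ = S + Real.log N by rw [hγ]; ring, Real.exp_add, Real.exp_log hNpos]
  set κ := θ / (4 * (2 * b + 1)) with hκ
  have hκ0 : 0 < κ := by positivity
  have hκb : 2 * b * κ ≤ θ / 4 := by
    rw [hκ, ← mul_div_assoc, div_le_div_iff₀ (by positivity) (by norm_num)]
    nlinarith
  set ε := γ * κ / 4 with hε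
  have hε0 : 0 < ε := by positivity
  obtain ⟨C, hC, k1, hcomp⟩ := compare hg hA f b S hb0 hb hS CH α hCH hα hf M hM (θ / 4) ε (by positivity) hε0
  -- uniform upper bound
  obtain ⟨C2, hC20, hC2⟩ : ∃ C2 : ℝ, 0 < C2 ∧ ∀ k : ℕ, M k ≤ C2 * Real.exp ((P' + ε) * k) := by
    have h1 := hlim.eventually (gt_mem_nhds (show P' < P' + ε by linarith))
    obtain ⟨K, hK⟩ := eventually_atTop.1 h1
    have hnn : ∀ k, 0 ≤ M k * Real.exp (-((P' + ε) * k)) := fun k => mul_nonneg (hMpos k).le (Real.exp_pos _).le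
    have hsn : 0 ≤ ∑ k ∈ Finset.range (K + 1), M k * Real.exp (-((P' + ε) * k)) := Finset.sum_nonneg fun k _ => hnn k
    refine ⟨1 + ∑ k ∈ Finset.range (K + 1), M k * Real.exp (-((P' + ε) * k)), by linarith, fun k => ?_⟩
    by_cases hk : k < K + 1
    · have h2 := Finset.single_le_sum (f := fun k : ℕ => M k * Real.exp (-((P' + ε) * k))) (fun k _ => hnn k) (Finset.mem_range.2 hk)
      calc M k = (M k * Real.exp (-((P' + ε) * k))) * Real.exp ((P' + ε) * k) := by
            rw [mul_assoc, ← Real.exp_add, neg_add_cancel, Real.exp_zero, mul_one]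
        _ ≤ _ := by gcongr; linarith
    · have h2 := hK k (by omega)
      have hk0 : (0 : ℝ) < k := by exact_mod_cast (by omega : 0 < k)
      rw [div_lt_iff₀ hk0] at h2
      calc M k = Real.exp (Real.log (M k)) := (Real.exp_log (hMpos k)).symm
        _ ≤ 1 * Real.exp ((P' + ε) * k) := by rw [one_mul]; exact Real.exp_le_exp.2 h2.le
        _ ≤ _ := by gcongr; linarith
  have hdecay : Tendsto (fun n : ℕ => C * C2 * ((n : ℝ) * Real.exp (-(γ * κ / 2) * n))) atTop (𝓝 0) := by
    have h1 := Real.tendsto_pow_mul_exp_neg_atTop_nhds_zero 1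
    have h2 : Tendsto (fun n : ℕ => (γ * κ / 2) * (n : ℝ)) atTop atTop :=
      Tendsto.const_mul_atTop (by positivity) tendsto_natCast_atTop_atTop
    have h3 := (h1.comp h2).const_mul (C * C2 / (γ * κ / 2))
    rw [mul_zero] at h3
    refine h3.congr fun n => ?_
    simp only [Function.comp, pow_one]
    rw [show -(γ * κ / 2 * (n : ℝ)) = -(γ * κ / 2) * n by ring]
    field_simp
  have hev1 := hdecay.eventually (gt_mem_nhds (show (0 : ℝ) < 1 / 4 by norm_num))
  have hev2 : ∀ᶠ n : ℕ in atTop, (k1 : ℝ) ≤ κ * n :=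
    (Tendsto.const_mul_atTop hκ0 tendsto_natCast_atTop_atTop).eventually_ge_atTop _
  have hev3 : ∀ᶠ n : ℕ in atTop, 2 * b + Real.log 4 ≤ θ / 2 * n :=
    (Tendsto.const_mul_atTop (by positivity) tendsto_natCast_atTop_atTop).eventually_ge_atTop _
  filter_upwards [hev1, hev2, hev3] with n h1 h2 h3
  set k0 := ⌈κ * n⌉₊ with hk0
  have hk0l : κ * n ≤ k0 := Nat.le_ceil _
  have hk0u : (k0 : ℝ) ≤ κ * n + 1 := (Nat.ceil_lt_add_one (by positivity)).le
  have hk1 : k1 ≤ k0 := by exact_mod_cast h2.trans hk0l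
  obtain ⟨x', hx', hhalf⟩ := hMx n
  have hc := hcomp n k0 x x' hk1 hx hx'
  have hn0 : (0 : ℝ) ≤ n := by positivity
  have hbad : C * Real.exp (ε * n) * (∑ j ∈ Finset.range n, if k0 < j + 1 then (Real.exp S * N) ^ (j + 1) * M (n - (j + 1)) else 0) ≤ M n / 4 := by
    have hterm : ∀ j ∈ Finset.range n, (if k0 < j + 1 then (Real.exp S * N) ^ (j + 1) * M (n - (j + 1)) else 0) ≤
        C2 * Real.exp (P' * n + ε * n - γ * κ * n) := by
      intro j hj
      rw [Finset.mem_range] at hj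
      split_ifs with hjk
      · have hj1 : κ * n ≤ ((j + 1 : ℕ) : ℝ) := hk0l.trans (by exact_mod_cast hjk.le)
        rw [hSN, ← Real.exp_nat_mul]
        calc _ ≤ Real.exp (((j + 1 : ℕ) : ℝ) * (P' - γ)) * (C2 * Real.exp ((P' + ε) * ((n - (j + 1) : ℕ) : ℝ))) := by
              gcongr; exact hC2 _
          _ = C2 * Real.exp (((j + 1 : ℕ) : ℝ) * (P' - γ) + (P' + ε) * ((n - (j + 1) : ℕ) : ℝ)) := by rw [Real.exp_add]; ring
          _ ≤ _ := by
              gcongr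
              rw [Nat.cast_sub (by omega)]
              have : γ * (κ * n) ≤ γ * ((j + 1 : ℕ) : ℝ) := by gcongr
              have h5 : 0 ≤ ε * ((j + 1 : ℕ) : ℝ) := by positivity
              nlinarith
      · positivity
    calc _ ≤ C * Real.exp (ε * n) * (∑ j ∈ Finset.range n, C2 * Real.exp (P' * n + ε * n - γ * κ * n)) := by
          gcongr with j hj; exact hterm j hj
      _ = C * C2 * (n * Real.exp (-(γ * κ / 2) * n)) * Real.exp (P' * n) := by
          rw [Finset.sum_const, Finset.card_range, nsmul_eq_mul]
          have : Real.exp (ε * n) * Real.exp (P' * n + ε * n - γ * κ * n) = Real.exp (-(γ * κ / 2) * n) * Real.exp (P' * n) := by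
            rw [← Real.exp_add, ← Real.exp_add]; congr 1; rw [hε]; ring
          linear_combination C * n * C2 * this
      _ ≤ 1 / 4 * M n := by
          gcongr
          exact hlow n
      _ = _ := by ring
  have hfin : M n / 4 ≤ Real.exp (2 * b * k0 + θ / 4 * n) * LSum p q f n x := by linarith
  have hfin2 : Real.exp (P' * n) / 4 * Real.exp (-(2 * b * k0 + θ / 4 * n)) ≤ LSum p q f n x := by
    rw [Real.exp_neg, ← div_eq_mul_inv, div_le_iff₀ (Real.exp_pos _)]
    have := hlow n
    linarith
  refine le_trans ?_ hfin2
  rw [show Real.exp (P' * n) / 4 = Real.exp (P' * n - Real.log 4) by rw [Real.exp_sub, Real.exp_log (by norm_num)], ← Real.exp_add, Real.exp_le_exp]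
  have g1 : 2 * b * k0 ≤ 2 * b * (κ * n + 1) := by gcongr
  have g2 : 2 * b * κ * n ≤ θ / 4 * n := by gcongr
  have g3 : pressure p q f * n ≤ P' * n := by gcongr
  nlinarith

lemma upper {N : ℕ} {p q : Fin N → ℂ[X]} (hg : Good p q) (f : SymX N → ℝ) (b : ℝ)
    (hb : ∀ x ∈ juliaSet p q, -b ≤ f x ∧ f x ≤ b) (θ : ℝ) (hθ : 0 < θ) (x : SymX N) (hx : x ∈ juliaSet p q) :
    ∀ᶠ n : ℕ in atTop, LSum p q f n x ≤ Real.exp ((pressure p q f + θ) * n) := by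
  have hD := Dtot_pos hg
  have hD' : (1 : ℝ) ≤ ((Dtot p q : ℕ) : ℝ) := by exact_mod_cast hD
  have hup : ∀ x ∈ juliaSet p q, ∀ n : ℕ, 0 < n → (n : ℝ)⁻¹ * Real.log (LSum p q f n x) ≤ Real.log (Dtot p q * Real.exp b) := by
    intro x hx n hn
    have hn' : (0 : ℝ) < n := by exact_mod_cast hn
    rw [inv_mul_eq_div, div_le_iff₀ hn', mul_comm, ← Real.log_pow]
    exact Real.log_le_log (LSum_pos hg f (-b) b hb n x hx) (LSum_bounds hg f (-b) b hb n x hx).2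
  have hlo : ∀ x ∈ juliaSet p q, ∀ n : ℕ, 0 < n → Real.log (Dtot p q * Real.exp (-b)) ≤ (n : ℝ)⁻¹ * Real.log (LSum p q f n x) := by
    intro x hx n hn
    have hn' : (0 : ℝ) < n := by exact_mod_cast hn
    rw [inv_mul_eq_div, le_div_iff₀ hn', mul_comm, ← Real.log_pow]
    exact Real.log_le_log (by positivity) (LSum_bounds hg f (-b) b hb n x hx).1
  have hB : BddAbove (Set.range fun x : ↥(juliaSet p q) => limsup (fun n : ℕ => (n : ℝ)⁻¹ * Real.log (LSum p q f n ↑x)) atTop) := by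
    refine ⟨Real.log (Dtot p q * Real.exp b), ?_⟩
    rintro _ ⟨x, rfl⟩
    refine limsup_le_of_le ?_ ?_
    · refine IsCoboundedUnder.of_frequently_ge (a := Real.log (Dtot p q * Real.exp (-b))) ?_
      refine Eventually.frequently ?_
      filter_upwards [eventually_gt_atTop 0] with n hn using hlo x x.2 n hn
    · filter_upwards [eventually_gt_atTop 0] with n hn using hup x x.2 n hn
  have h1 : limsup (fun n : ℕ => (n : ℝ)⁻¹ * Real.log (LSum p q f n x)) atTop ≤ pressure p q f := le_ciSup hB ⟨x, hx⟩
  have h2 := eventually_lt_of_limsup_lt (lt_of_le_of_lt h1 (show pressure p q f < pressure p q f + θ by linarith))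
    ⟨Real.log (Dtot p q * Real.exp b), by
      rw [eventually_map]
      filter_upwards [eventually_gt_atTop 0] with n hn using hup x hx n hn⟩
  filter_upwards [h2, eventually_gt_atTop 0] with n hn hn0
  have hn' : (0 : ℝ) < n := by exact_mod_cast hn0
  rw [inv_mul_eq_div, div_lt_iff₀ hn'] at hn
  rw [← Real.exp_log (LSum_pos hg f (-b) b hb n x hx)]
  exact Real.exp_le_exp.2 hn.le

lemma orb_integral {N : ℕ} {p q : Fin N → ℂ[X]} (g : C(↥(juliaSet p q), ℝ)) (y : SymX N) (n : ℕ)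
    (hy : ∀ k < n, (Tmap p q)^[k] y ∈ juliaSet p q) :
    ∫ x, g x ∂(orbMeas p q y n) = (n : ℝ)⁻¹ * birk p q (jextend p q g) n y := by
  rcases Nat.eq_zero_or_pos n with rfl | hn
  · simp [orbMeas, birk]
  have hc : IsClosed (juliaSet p q) := isClosed_closure
  have hme : MeasurableEmbedding (Subtype.val : ↥(juliaSet p q) → SymX N) :=
    hc.isClosedEmbedding_subtypeVal.measurableEmbedding
  set pt : ℕ → ↥(juliaSet p q) := fun k => if h : k < n then ⟨_, hy k h⟩ else ⟨_, hy 0 hn⟩ with hpt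
  have hpt' : ∀ k < n, (pt k : SymX N) = (Tmap p q)^[k] y := by
    intro k hk; simp [hpt, hk]
  have key : orbMeas p q y n = (n : ℝ≥0∞)⁻¹ • ∑ k ∈ Finset.range n, Measure.dirac (pt k) := by
    ext s hs
    rw [orbMeas, hme.comap_apply]
    simp only [Measure.smul_apply, Measure.finsetSum_apply]
    congr 1
    refine Finset.sum_congr rfl fun k hk => ?_
    rw [Measure.dirac_apply' _ (hme.measurableSet_image.2 hs), Measure.dirac_apply' _ hs, ← hpt' k (Finset.mem_range.1 hk)]
    simp [Set.indicator]
  rw [key, integral_smul_measure, integral_finsetSum_measure]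
  · simp only [ENNReal.toReal_inv, ENNReal.toReal_natCast, smul_eq_mul]
    congr 1
    rw [birk]
    refine Finset.sum_congr rfl fun k hk => ?_
    rw [integral_dirac' _ _ g.continuous.stronglyMeasurable, ← hpt' k (Finset.mem_range.1 hk)]
    simp [jextend]
  · intro k _
    exact integrable_dirac' g.continuous.stronglyMeasurable (by simp)

lemma ms_filter_bound {α ι : Type*} (s : Multiset α) (B : α → Prop) [DecidablePred B] (h : α → ℝ) (t : Finset ι)
    (c : ι → ℝ) (H : ι → α → ℝ) (hc : ∀ i, 0 ≤ c i) (hH : ∀ i a, 0 ≤ H i a)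
    (hB : ∀ a ∈ s, B a → h a ≤ ∑ i ∈ t, c i * H i a) :
    ((s.filter B).map h).sum ≤ ∑ i ∈ t, c i * (s.map (H i)).sum := by
  induction s using Multiset.induction with
  | empty => simp
  | cons a s ih =>
    have ih' := ih fun b hb => hB b (Multiset.mem_cons_of_mem hb)
    have e : ∑ i ∈ t, c i * ((a ::ₘ s).map (H i)).sum = (∑ i ∈ t, c i * H i a) + ∑ i ∈ t, c i * (s.map (H i)).sum := by
      rw [← Finset.sum_add_distrib]
      refine Finset.sum_congr rfl fun i _ => ?_
      simp [mul_add]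
    rw [e]
    by_cases ha : B a
    · rw [Multiset.filter_cons_of_pos _ ha, Multiset.map_cons, Multiset.sum_cons]
      exact add_le_add (hB a (Multiset.mem_cons_self a s) ha) ih'
    · rw [Multiset.filter_cons_of_neg _ ha]
      have : 0 ≤ ∑ i ∈ t, c i * H i a := Finset.sum_nonneg fun i _ => mul_nonneg (hc i) (hH i a)
      linarith

instance julia_compact {N : ℕ} {p q : Fin N → ℂ[X]} : CompactSpace ↥(juliaSet p q) :=
  isCompact_iff_compactSpace.1 (isClosed_closure.isCompact)

lemma jext_mem {N : ℕ} {p q : Fin N → ℂ[X]} (f : ↥(juliaSet p q) → ℝ) (x : SymX N) (hx : x ∈ juliaSet p q) :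
    jextend p q f x = f ⟨x, hx⟩ := dif_pos hx

lemma holder_bdd {N : ℕ} {p q : Fin N → ℂ[X]} (f : ↥(juliaSet p q) → ℝ) (hf : HolderOnJ p q f)
    (x0 : ↥(juliaSet p q)) : ∃ b, 0 ≤ b ∧ ∀ x, |f x| ≤ b := by
  obtain ⟨C, hC, α, hα, h⟩ := hf
  refine ⟨|f x0| + C * 2 ^ α, by positivity, fun x => ?_⟩
  have h1 := h x x0
  have h2 : 0 ≤ dX (x : SymX N) (x0 : SymX N) := le_max_of_le_right (sph_nonneg _ _)
  have h3 : dX (x : SymX N) (x0 : SymX N) ≤ 2 := max_le ((shift_le_one _ _).trans (by norm_num)) (sph_le_two _ _)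
  have h4 : dX (x : SymX N) (x0 : SymX N) ^ α ≤ 2 ^ α := Real.rpow_le_rpow h2 h3 hα.1.le
  have h5 : C * dX (x : SymX N) (x0 : SymX N) ^ α ≤ C * 2 ^ α := by gcongr
  have h6 := abs_sub_abs_le_abs_sub (f x) (f x0)
  linarith

lemma LL_lsc {N : ℕ} {p q : Fin N → ℂ[X]} (f : ↥(juliaSet p q) → ℝ) : LowerSemicontinuous (LLfun p q f) := by
  unfold LLfun
  refine lowerSemicontinuous_iSup fun g => Continuous.lowerSemicontinuous ?_
  refine continuous_coe_real_ereal.comp (Continuous.sub ?_ continuous_const)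
  exact ProbabilityMeasure.continuous_integral_continuousMap g

lemma rho_pos {N : ℕ} {p q : Fin N → ℂ[X]} (f : ↥(juliaSet p q) → ℝ)
    (μf : ProbabilityMeasure ↥(juliaSet p q)) (hLpos : ∀ m, m ≠ μf → 0 < LLfun p q f m)
    (U : Set (ProbabilityMeasure ↥(juliaSet p q))) (hUopen : IsOpen U) (hμfU : μf ∈ U) :
    0 < rho p q f Uᶜ := by
  have hK : IsCompact Uᶜ := hUopen.isClosed_compl.isCompact
  rcases Set.eq_empty_or_nonempty Uᶜ with h | h
  · rw [h]; simp [rho]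
  · obtain ⟨m, hm, hmin⟩ := ((LL_lsc f).lowerSemicontinuousOn Uᶜ).exists_isMinOn h hK
    have h1 : 0 < LLfun p q f m := hLpos m fun e => hm (e ▸ hμfU)
    refine h1.trans_le ?_
    exact le_iInf₂ fun m' hm' => hmin hm'

lemma cover {N : ℕ} {p q : Fin N → ℂ[X]} (f : ↥(juliaSet p q) → ℝ)
    (K : Set (ProbabilityMeasure ↥(juliaSet p q))) (hK : IsCompact K) (a : ℝ) (ha : (a : EReal) < rho p q f K) :
    ∃ t : Finset C(↥(juliaSet p q), ℝ), ∀ m ∈ K, ∃ g ∈ t, a < (∫ x, g x ∂(m : Measure ↥(juliaSet p q))) - Qfun p q f g := by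
  obtain ⟨t, ht⟩ := hK.elim_finite_subcover (fun g : C(↥(juliaSet p q), ℝ) =>
    {m : ProbabilityMeasure ↥(juliaSet p q) | a < (∫ x, g x ∂(m : Measure ↥(juliaSet p q))) - Qfun p q f g})
    (fun g => isOpen_lt continuous_const ((ProbabilityMeasure.continuous_integral_continuousMap g).sub continuous_const))
    (by
      intro m hm
      have h1 : (a : EReal) < LLfun p q f m := ha.trans_le (iInf₂_le m hm)
      obtain ⟨g, hg⟩ := lt_iSup_iff.1 h1
      exact Set.mem_iUnion.2 ⟨g, EReal.coe_lt_coe_iff.1 hg⟩)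
  refine ⟨t, fun m hm => ?_⟩
  obtain ⟨g, hg, h⟩ := Set.mem_iUnion₂.1 (ht hm)
  exact ⟨g, hg, h⟩

lemma bad_bound {N : ℕ} {p q : Fin N → ℂ[X]} (hg : Good p q) (f : ↥(juliaSet p q) → ℝ)
    (K : Set (ProbabilityMeasure ↥(juliaSet p q))) (a : ℝ) (t : Finset C(↥(juliaSet p q), ℝ))
    (ht : ∀ m ∈ K, ∃ g ∈ t, a < (∫ x, g x ∂(m : Measure ↥(juliaSet p q))) - Qfun p q f g)
    (x : SymX N) (hx : x ∈ juliaSet p q) (n : ℕ) (hn : 0 < n) (B : SymX N → Prop) [DecidablePred B]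
    (hB : ∀ y, B y → inK p q (orbMeas p q y n) K) :
    (((preimTn p q n x).filter B).map fun y => Real.exp (birk p q (jextend p q f) n y)).sum ≤
      ∑ g ∈ t, Real.exp (-(a + Qfun p q f g) * n) * LSum p q (jextend p q fun x => f x + g x) n x := by
  have hn' : (0 : ℝ) < n := by exact_mod_cast hn
  refine ms_filter_bound _ B _ t (fun g => Real.exp (-(a + Qfun p q f g) * n))
    (fun g y => Real.exp (birk p q (jextend p q fun x => f x + g x) n y)) (fun _ => by positivity) (fun _ _ => by positivity) ?_
  intro y hy hBy
  have horb : ∀ k < n, (Tmap p q)^[k] y ∈ juliaSet p q := fun k hk => preimTn_orbit hg n x y hx hy k hk.le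
  obtain ⟨ν, hν, hνK⟩ := hB y hBy
  obtain ⟨g, hgt, hlt⟩ := ht ν hνK
  rw [hν, orb_integral g y n horb, inv_mul_eq_div] at hlt
  have e : birk p q (jextend p q fun x => f x + g x) n y = birk p q (jextend p q f) n y + birk p q (jextend p q g) n y := by
    simp only [birk]
    rw [← Finset.sum_add_distrib]
    refine Finset.sum_congr rfl fun k hk => ?_
    have := horb k (Finset.mem_range.1 hk)
    rw [jext_mem _ _ this, jext_mem _ _ this, jext_mem _ _ this]
  have h2 : (a + Qfun p q f g) * n < birk p q (jextend p q g) n y := by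
    rw [← lt_div_iff₀ hn']; linarith
  refine le_trans ?_ (Finset.single_le_sum (f := fun g : C(↥(juliaSet p q), ℝ) => Real.exp (-(a + Qfun p q f g) * n) * Real.exp (birk p q (jextend p q fun x => f x + g x) n y)) (fun i _ => by positivity) hgt)
  show _ ≤ Real.exp (-(a + Qfun p q f g) * n) * Real.exp (birk p q (jextend p q fun x => f x + g x) n y)
  rw [← Real.exp_add, Real.exp_le_exp, e]
  linarith

lemma ld_step {N : ℕ} {p q : Fin N → ℂ[X]}
    (hg : Good p q) (hA1 : NoSuperAttract p q)
    (f : ↥(juliaSet p q) → ℝ) (hf : HolderOnJ p q f)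
    (hP : pressure p q (jextend p q f) > (⨆ x : ↥(juliaSet p q), f x) + Real.log N)
    (K : Set (ProbabilityMeasure ↥(juliaSet p q))) (hK : IsCompact K)
    (x : SymX N) (hx : x ∈ juliaSet p q) (a : ℝ) (ha : (a : EReal) < rho p q f K) (θ : ℝ) (hθ : 0 < θ) :
    limsup (preimLDSeq p q f x K) atTop ≤ ((3 * θ - a : ℝ) : EReal) := by
  obtain ⟨t, ht⟩ := cover f K hK a ha
  obtain ⟨b, hb0, hb⟩ := holder_bdd f hf ⟨x, hx⟩
  have hbf : ∀ x ∈ juliaSet p q, -b ≤ jextend p q f x ∧ jextend p q f x ≤ b := by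
    intro y hy; rw [jext_mem _ _ hy]; exact abs_le.1 (hb _)
  have hlow : ∀ᶠ n : ℕ in atTop, Real.exp ((pressure p q (jextend p q f) - θ) * n) ≤ LSum p q (jextend p q f) n x := by
    obtain ⟨C, hC, α, hα, h⟩ := hf
    refine lower hg hA1 (jextend p q f) b (⨆ x : ↥(juliaSet p q), f x) hb0 hbf ?_ C α hC hα.1 ?_ hP θ hθ x hx
    · intro y hy
      rw [jext_mem _ _ hy]
      exact le_ciSup (f := f) ⟨b, by rintro _ ⟨z, rfl⟩; exact (abs_le.1 (hb z)).2⟩ _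
    · intro y hy z hz
      rw [jext_mem _ _ hy, jext_mem _ _ hz]
      exact h ⟨y, hy⟩ ⟨z, hz⟩
  have hup : ∀ᶠ n : ℕ in atTop, ∀ g ∈ t, LSum p q (jextend p q fun x => f x + g x) n x ≤
      Real.exp ((pressure p q (jextend p q fun x => f x + g x) + θ) * n) := by
    rw [Filter.eventually_all_finset]
    intro g _
    refine upper hg _ (b + ‖g‖) ?_ θ hθ x hx
    intro y hy
    rw [jext_mem _ _ hy]
    have h1 := abs_le.1 (hb ⟨y, hy⟩)
    have h2 := abs_le.1 (g.norm_coe_le_norm ⟨y, hy⟩)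
    constructor <;> linarith [h1.1, h1.2, h2.1, h2.2]
  have hlog : ∀ᶠ n : ℕ in atTop, Real.log (t.card + 1) ≤ θ * n := by
    have := (tendsto_natCast_atTop_atTop (R := ℝ)).const_mul_atTop hθ
    exact this.eventually_ge_atTop _
  refine limsup_le_of_le (by isBoundedDefault) ?_
  filter_upwards [hlow, hup, hlog, eventually_gt_atTop 0] with n h1 h2 h3 hn
  have hn' : (0 : ℝ) < n := by exact_mod_cast hn
  have hbad := bad_bound hg f K a t ht x hx n hn (fun y => inK p q (orbMeas p q y n) K) (fun _ h => h)
  unfold preimLDSeq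
  split_ifs with h0
  · exact bot_le
  rw [EReal.coe_le_coe_iff]
  have hnn : 0 ≤ (((preimTn p q n x).filter fun y => inK p q (orbMeas p q y n) K).map
        fun y => Real.exp (birk p q (jextend p q f) n y)).sum := by
    refine Multiset.sum_nonneg ?_
    intro z hz
    obtain ⟨y, _, rfl⟩ := Multiset.mem_map.1 hz
    positivity
  have hle : (((preimTn p q n x).filter fun y => inK p q (orbMeas p q y n) K).map
        fun y => Real.exp (birk p q (jextend p q f) n y)).sum ≤ (t.card + 1) * Real.exp ((pressure p q (jextend p q f) + θ - a) * n) := by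
    refine hbad.trans ?_
    calc _ ≤ ∑ g ∈ t, Real.exp ((pressure p q (jextend p q f) + θ - a) * n) := by
          refine Finset.sum_le_sum fun g hg => ?_
          calc _ ≤ Real.exp (-(a + Qfun p q f g) * n) * Real.exp ((pressure p q (jextend p q fun x => f x + g x) + θ) * n) := by
                gcongr; exact h2 g hg
            _ = _ := by
                rw [← Real.exp_add]; congr 1; unfold Qfun; ring
      _ = t.card * Real.exp ((pressure p q (jextend p q f) + θ - a) * n) := by simp
      _ ≤ _ := by gcongr; linarith
  generalize hs : (((preimTn p q n x).filter fun y => inK p q (orbMeas p q y n) K).map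
        fun y => Real.exp (birk p q (jextend p q f) n y)).sum = s at *
  have hspos : 0 < s := lt_of_le_of_ne hnn (Ne.symm h0)
  have hL : 0 < LSum p q (jextend p q f) n x := (Real.exp_pos _).trans_le h1
  rw [inv_mul_eq_div, div_le_iff₀ hn', Real.log_div hspos.ne' hL.ne']
  have l1 : Real.log s ≤ Real.log (t.card + 1) + (pressure p q (jextend p q f) + θ - a) * n := by
    have := Real.log_le_log hspos hle
    rwa [Real.log_mul (by positivity) (by positivity), Real.log_exp] at this
  have l2 : (pressure p q (jextend p q f) - θ) * n ≤ Real.log (LSum p q (jextend p q f) n x) := by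
    rw [Real.le_log_iff_exp_le hL]; exact h1
  nlinarith

theorem final {N : ℕ} (p q : Fin N → ℂ[X])
    (hg : Good p q) (hA1 : NoSuperAttract p q)
    (f : ↥(juliaSet p q) → ℝ) (hf : HolderOnJ p q f)
    (hP : pressure p q (jextend p q f) > (⨆ x : ↥(juliaSet p q), f x) + Real.log N)
    (μf : ProbabilityMeasure ↥(juliaSet p q)) (hμfT : MTinv p q μf)
    (hL0 : LLfun p q f μf = 0) (hLpos : ∀ m, m ≠ μf → 0 < LLfun p q f m)
    (𝒰 : Set (ProbabilityMeasure ↥(juliaSet p q))) (hUopen : IsOpen 𝒰) (hμfU : μf ∈ 𝒰)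
    (x : SymX N) (hx : x ∈ juliaSet p q) :
    0 < rho p q f 𝒰ᶜ ∧
    limsup (preimLDSeq p q f x 𝒰ᶜ) atTop ≤ -(rho p q f 𝒰ᶜ) ∧
    -(rho p q f 𝒰ᶜ) < 0 := by
  have hK : IsCompact 𝒰ᶜ := hUopen.isClosed_compl.isCompact
  have hpos := rho_pos f μf hLpos 𝒰 hUopen hμfU
  refine ⟨hpos, ?_, ?_⟩
  · by_contra hcon
    push Not at hcon
    have h2 : -limsup (preimLDSeq p q f x 𝒰ᶜ) atTop < rho p q f 𝒰ᶜ := EReal.neg_lt_comm.1 hcon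
    obtain ⟨a, ha1, ha2⟩ := EReal.lt_iff_exists_real_btwn.1 h2
    obtain ⟨a', ha1', ha2'⟩ := EReal.lt_iff_exists_real_btwn.1 ha2
    have haa : a < a' := EReal.coe_lt_coe_iff.1 ha1'
    have h3 := ld_step hg hA1 f hf hP 𝒰ᶜ hK x hx a' ha2' ((a' - a) / 3) (by linarith)
    have h4 : (3 * ((a' - a) / 3) - a' : ℝ) = -a := by ring
    rw [h4, EReal.coe_neg] at h3
    have h5 := EReal.neg_lt_comm.1 ha1
    exact absurd h3 (not_le.2 h5)
  · simpa using EReal.neg_lt_neg_iff.2 hpos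

theorem large_deviation_preimages
    (hg : Good p q) (hA1 : NoSuperAttract p q)
    (f : ↥(juliaSet p q) → ℝ) (hf : HolderOnJ p q f)
    (hP : pressure p q (jextend p q f) > (⨆ x : ↥(juliaSet p q), f x) + Real.log N)
    (μf : ProbabilityMeasure ↥(juliaSet p q)) (hμfT : MTinv p q μf)
    (hL0 : LLfun p q f μf = 0) (hLpos : ∀ m, m ≠ μf → 0 < LLfun p q f m)
    (𝒰 : Set (ProbabilityMeasure ↥(juliaSet p q))) (hUopen : IsOpen 𝒰) (hμfU : μf ∈ 𝒰)
    (x : SymX N) (hx : x ∈ juliaSet p q) :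
    0 < rho p q f 𝒰ᶜ ∧
    limsup (preimLDSeq p q f x 𝒰ᶜ) atTop ≤ -(rho p q f 𝒰ᶜ) ∧
    -(rho p q f 𝒰ᶜ) < 0 := by
  exact final p q hg hA1 f hf hP μf hμfT hL0 hLpos 𝒰 hUopen hμfU x hx

end SkewRational
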